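/- arXiv:1804.03845 — 2 statements merged into one kernel-verified Lean document; each statement's English description precedes it below -/
import Mathlib

section
/- Let H:C([-T,0];ℝ)→ℝ be three times continuously Fréchet differentiable with D³H of polynomial growth, let DH(ζ) be identified via Riesz representation with a finite signed Borel measure DH(ζ)(dρ) on [-T,0], and define u(t,η) := E[H(Y_T^{t,η})]. Then for every t∈[0,T], η∈C([-T,0];ℝ) and h∈C([-T,0];ℝ), the Fréchet derivative of u(t,·) satisfies Du(t,η)(h) = E[ ∫_{[-T,t−T[} h(ρ+T−t) DH(Y_T^{t,η})(dρ) ] + h(0) · E[ DH(Y_T^{t,η})([t−T,0]) ]. -/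
open MeasureTheory ProbabilityTheory Set Filter Topology

lemma aux_growth {E F : Type*} [NormedAddCommGroup E] [NormedSpace ℝ E]
    [NormedAddCommGroup F] [NormedSpace ℝ F] (f : E → F) (hf : Differentiable ℝ f) (n : ℕ)
    (hg : ∃ C : ℝ, 0 ≤ C ∧ ∀ x, ‖fderiv ℝ f x‖ ≤ C * (1 + ‖x‖ ^ n)) :
    ∃ C : ℝ, 0 ≤ C ∧ ∀ x, ‖f x‖ ≤ C * (1 + ‖x‖ ^ (n + 1)) := by
  obtain ⟨C, hC, hb⟩ := hg
  refine ⟨‖f 0‖ + 2 * C, by positivity, fun x => ?_⟩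
  have h1 : ‖f x - f 0‖ ≤ C * (1 + ‖x‖ ^ n) * ‖x - 0‖ := by
    refine Convex.norm_image_sub_le_of_norm_fderiv_le (𝕜 := ℝ) (s := Metric.closedBall 0 ‖x‖)
      (fun y _ => hf y) (fun y hy => (hb y).trans ?_) (convex_closedBall _ _) (by simp) (by simp)
    have : ‖y‖ ≤ ‖x‖ := by simpa using hy
    gcongr
  have h2 : ‖f x‖ ≤ ‖f 0‖ + ‖f x - f 0‖ := by
    have := norm_add_le (f 0) (f x - f 0)
    simpa using this
  have h3 : ‖x‖ ≤ 1 + ‖x‖ ^ (n + 1) := by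
    rcases le_total ‖x‖ 1 with h | h
    · have : 0 ≤ ‖x‖ ^ (n + 1) := by positivity
      linarith
    · have : ‖x‖ ≤ ‖x‖ ^ (n + 1) := le_self_pow₀ h (Nat.succ_ne_zero n)
      linarith
  rw [sub_zero] at h1
  have h4 : (1 + ‖x‖ ^ n) * ‖x‖ ≤ 2 * (1 + ‖x‖ ^ (n + 1)) := by
    have e : (1 + ‖x‖ ^ n) * ‖x‖ = ‖x‖ + ‖x‖ ^ (n + 1) := by ring
    rw [e]; linarith
  have h5 := mul_le_mul_of_nonneg_left h4 hC
  have h6 : 0 ≤ ‖f 0‖ * ‖x‖ ^ (n + 1) := by positivity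
  nlinarith

set_option maxSynthPendingDepth 10 in
set_option synthInstance.maxHeartbeats 400000 in
set_option maxHeartbeats 1000000 in
lemma aux_growth3 {E : Type*} [NormedAddCommGroup E] [NormedSpace ℝ E] (H : E → ℝ)
    (hH : ContDiff ℝ 3 H) (C : ℝ) (hC : 0 < C) (p : ℝ) (hp : 1 ≤ p)
    (hgr : ∀ ζ, ‖iteratedFDeriv ℝ 3 H ζ‖ ≤ C * (1 + ‖ζ‖ ^ p)) :
    ∃ n k : ℕ, (∃ C : ℝ, 0 ≤ C ∧ ∀ x, ‖H x‖ ≤ C * (1 + ‖x‖ ^ n)) ∧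
      ∃ C : ℝ, 0 ≤ C ∧ ∀ x, ‖fderiv ℝ H x‖ ≤ C * (1 + ‖x‖ ^ k) := by
  have hd1 : ContDiff ℝ 2 (fderiv ℝ H) := hH.fderiv_right (by norm_num)
  have hd2 : ContDiff ℝ 1 (fderiv ℝ (fderiv ℝ H)) := hd1.fderiv_right (by norm_num)
  have hg3 : ∃ C : ℝ, 0 ≤ C ∧ ∀ x, ‖fderiv ℝ (fderiv ℝ (fderiv ℝ H)) x‖ ≤
      C * (1 + ‖x‖ ^ ⌈p⌉₊) := by
    refine ⟨2 * C, by positivity, fun x => ?_⟩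
    have e : ‖fderiv ℝ (fderiv ℝ (fderiv ℝ H)) x‖ = ‖iteratedFDeriv ℝ 3 H x‖ := by
      rw [← norm_iteratedFDeriv_fderiv, ← norm_iteratedFDeriv_fderiv,
        ← norm_iteratedFDeriv_fderiv, norm_iteratedFDeriv_zero]
    rw [e]
    refine (hgr x).trans ?_
    have h1 : ‖x‖ ^ p ≤ 1 + ‖x‖ ^ ⌈p⌉₊ := by
      rcases le_total ‖x‖ 1 with hx | hx
      · have := Real.rpow_le_one (norm_nonneg x) hx (by linarith : 0 ≤ p)
        have h2 : 0 ≤ ‖x‖ ^ ⌈p⌉₊ := by positivity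
        linarith
      · have := Real.rpow_le_rpow_of_exponent_le hx (Nat.le_ceil p)
        rw [Real.rpow_natCast] at this
        linarith
    have h2 : 0 ≤ ‖x‖ ^ ⌈p⌉₊ := by positivity
    nlinarith
  have hg2 := aux_growth _ (hd2.differentiable (by norm_num)) _ hg3
  have hg1 := aux_growth _ (hd1.differentiable (by norm_num)) _ hg2
  have hg0 := aux_growth _ (hH.differentiable (by norm_num)) _ hg1
  exact ⟨_, _, hg0, hg1⟩

lemma aux_measurable {X Ω : Type*} [TopologicalSpace X] [CompactSpace X]
    [SecondCountableTopology X] [T2Space X] [Nonempty X] [MeasurableSpace Ω] (Z : Ω → C(X, ℝ))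
    (hZ : ∀ x, Measurable fun ω => Z ω x) : StronglyMeasurable Z := by
  borelize C(X, ℝ)
  rw [stronglyMeasurable_iff_measurable]
  have hd : ∀ c : C(X, ℝ), Measurable fun ω => dist (Z ω) c := by
    intro c
    refine measurable_of_Iic fun r => ?_
    have : (fun ω => dist (Z ω) c) ⁻¹' Iic r =
        ⋂ n : ℕ, {ω | dist (Z ω (TopologicalSpace.denseSeq X n))
          (c (TopologicalSpace.denseSeq X n)) ≤ r} := by
      ext ω
      simp only [mem_preimage, mem_Iic, mem_iInter, mem_ofPred_eq]
      rw [ContinuousMap.dist_le_iff_of_nonempty]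
      constructor
      · intro h n; exact h _
      · intro h x
        have hcl : IsClosed {x | dist (Z ω x) (c x) ≤ r} :=
          isClosed_le (by fun_prop) continuous_const
        have := (TopologicalSpace.denseRange_denseSeq X).closure_eq
        have h2 : closure (range (TopologicalSpace.denseSeq X)) ⊆ {x | dist (Z ω x) (c x) ≤ r} :=
          hcl.closure_subset_iff.2 (by rintro _ ⟨n, rfl⟩; exact h n)
        exact h2 (this ▸ mem_univ x)
    rw [this]
    refine MeasurableSet.iInter fun n => measurableSet_le ?_ measurable_const
    exact (hZ _).dist measurable_const
  refine measurable_of_isOpen fun U hU => ?_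
  have : Z ⁻¹' U = ⋃ n : ℕ, ⋃ q : ℚ, ⋃ _ : Metric.ball (TopologicalSpace.denseSeq C(X, ℝ) n) q ⊆ U,
      {ω | dist (Z ω) (TopologicalSpace.denseSeq C(X, ℝ) n) < q} := by
    ext ω
    simp only [mem_preimage, mem_iUnion, mem_ofPred_eq, exists_prop]
    constructor
    · intro h
      obtain ⟨ε, hε, hb⟩ := Metric.isOpen_iff.1 hU _ h
      obtain ⟨q, hq0, hq⟩ := exists_rat_btwn (half_pos hε)
      obtain ⟨n, hn⟩ := Metric.denseRange_iff.1
        (TopologicalSpace.denseRange_denseSeq C(X, ℝ)) (Z ω) q hq0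
      refine ⟨n, q, fun y hy => hb ?_, hn⟩
      rw [Metric.mem_ball] at hy ⊢
      calc dist y (Z ω) ≤ _ := dist_triangle_right _ _ _
        _ < ε := by linarith
    · rintro ⟨n, q, hs, hlt⟩
      exact hs hlt
  rw [this]
  exact MeasurableSet.iUnion fun n => MeasurableSet.iUnion fun q => MeasurableSet.iUnion fun _ =>
    measurableSet_lt (hd _) measurable_const

lemma aux_chain (T : ℝ) (hT : 0 < T) (w : ℝ → ℝ) (hw : Continuous w) (h0 : w 0 = 0) (a : ℝ)
    (ha : 0 ≤ a)
    (hinc : ∀ n k : ℕ, k < 2 ^ n → |w ((k + 1) * T / 2 ^ n) - w (k * T / 2 ^ n)| ≤ a * (4 / 5) ^ n) :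
    ∀ s ∈ Icc 0 T, |w s| ≤ 5 * a := by
  have key : ∀ n k : ℕ, k ≤ 2 ^ n → |w (k * T / 2 ^ n)| ≤ 5 * a * (1 - (4 / 5) ^ (n + 1)) := by
    intro n
    induction n with
    | zero =>
      intro k hk
      have : k = 0 ∨ k = 1 := by simp at hk; omega
      rcases this with rfl | rfl
      · simp [h0]; nlinarith
      · have := hinc 0 0 (by simp)
        simp [h0] at this ⊢
        linarith
    | succ n ih =>
      intro k hk
      have hp : (0 : ℝ) < (4 / 5) ^ (n + 1) := by positivity
      have ev : ∀ j : ℕ, ((2 * j : ℕ) : ℝ) * T / 2 ^ (n + 1) = j * T / 2 ^ n := by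
        intro j; push_cast; field_simp; ring
      rcases Nat.even_or_odd' k with ⟨j, rfl | rfl⟩
      · rw [ev]
        refine (ih j (by rw [pow_succ] at hk; omega)).trans ?_
        rw [pow_succ _ (n + 1)]
        nlinarith
      · have h1 := hinc (n + 1) (2 * j) (by omega)
        have h2 := ih j (by rw [pow_succ] at hk; omega)
        rw [ev] at h1
        have h3 : ((2 * j + 1 : ℕ) : ℝ) = ((2 * j : ℕ) : ℝ) + 1 := by push_cast; ring
        rw [h3]
        have h4 := abs_add_le (w ((((2 * j : ℕ) : ℝ) + 1) * T / 2 ^ (n + 1)) - w (j * T / 2 ^ n))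
          (w (j * T / 2 ^ n))
        rw [sub_add_cancel] at h4
        rw [pow_succ _ (n + 1)]
        nlinarith
  intro s hs
  have hfl : Tendsto (fun n : ℕ => (⌊s / T * 2 ^ n⌋₊ : ℝ) / 2 ^ n) atTop (𝓝 (s / T)) :=
    (tendsto_nat_floor_mul_div_atTop (div_nonneg hs.1 hT.le)).comp
      (tendsto_pow_atTop_atTop_of_one_lt (one_lt_two (α := ℝ)))
  have h1 : Tendsto (fun n : ℕ => |w ((⌊s / T * 2 ^ n⌋₊ : ℝ) * T / 2 ^ n)|) atTop (𝓝 |w s|) := by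
    refine (hw.abs.tendsto s).comp ?_
    have := hfl.mul_const T
    rw [div_mul_cancel₀ _ hT.ne'] at this
    refine this.congr fun n => ?_
    ring
  refine le_of_tendsto' h1 fun n => ?_
  refine (key n _ ?_).trans ?_
  · have : s / T * 2 ^ n ≤ ((2 ^ n : ℕ) : ℝ) := by
      push_cast
      have : s / T ≤ 1 := (div_le_one hT).2 hs.2
      nlinarith [pow_pos (zero_lt_two (α := ℝ)) n]
    exact Nat.floor_le_of_le this
  · have hp : (0 : ℝ) < (4 / 5) ^ (n + 1) := by positivity
    nlinarith

lemma aux_gauss (m : ℕ) : ∃ K : ENNReal, K ≠ ⊤ ∧ ∀ v : ℝ, 0 ≤ v →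
    ∫⁻ x, ENNReal.ofReal (x ^ (2 * m)) ∂(gaussianReal 0 v.toNNReal) = K * ENNReal.ofReal (v ^ m) := by
  refine ⟨∫⁻ x, ENNReal.ofReal (x ^ (2 * m)) ∂(gaussianReal 0 1), ?_, fun v hv => ?_⟩
  · have h := (memLp_id_gaussianReal' (μ := 0) (v := 1) ((2 * m : ℕ) : ENNReal)
      (ENNReal.natCast_ne_top _)).integrable_norm_pow'
    have h2 : Integrable (fun x : ℝ => x ^ (2 * m)) (gaussianReal 0 1) := by
      refine h.congr (ae_of_all _ fun x => ?_)
      simp [pow_mul]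
    exact h2.lintegral_lt_top.ne
  · have h := gaussianReal_map_const_mul (μ := 0) (v := 1) (√v)
    have h2 : gaussianReal 0 v.toNNReal = (gaussianReal 0 1).map (√v * ·) := by
      rw [h]
      congr 1
      · simp
      · ext; simp [Real.sq_sqrt hv, hv]
    rw [h2, lintegral_map (by fun_prop) (by fun_prop), ← lintegral_mul_const _ (by fun_prop)]
    refine lintegral_congr fun x => ?_
    rw [← ENNReal.ofReal_mul (by rw [pow_mul]; positivity), mul_pow, pow_mul √v, Real.sq_sqrt hv,
      mul_comm]

lemma aux_sup (T : ℝ) (hT : 0 < T)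
    {Ω : Type*} [MeasurableSpace Ω] (P : Measure Ω)
    (W : ℝ → Ω → ℝ)
    (hW_meas : ∀ s, Measurable (W s))
    (hW_cont : ∀ ω, Continuous fun s => W s ω)
    (hW_zero : ∀ ω, W 0 ω = 0)
    (hW_incr : ∀ s t : ℝ, 0 ≤ s → s ≤ t →
      Measure.map (fun ω => W t ω - W s ω) P = gaussianReal 0 (Real.toNNReal (t - s)))
    (m : ℕ) (hm : 3 ≤ m) :
    ∃ R : Ω → ENNReal, ∫⁻ ω, R ω ∂P ≠ ⊤ ∧ ∀ ω, ∀ s ∈ Icc 0 T,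
      ENNReal.ofReal (|W s ω| ^ (2 * m)) ≤ ENNReal.ofReal (5 ^ (2 * m)) * R ω := by
  obtain ⟨K, hK, hg⟩ := aux_gauss m
  let D : ℕ → ℕ → Ω → ℝ := fun n k ω => W ((k + 1) * T / 2 ^ n) ω - W (k * T / 2 ^ n) ω
  have hDm : ∀ n k, Measurable (D n k) := fun n k => (hW_meas _).sub (hW_meas _)
  let R : Ω → ENNReal := fun ω => ∑' n : ℕ, ∑ k ∈ Finset.range (2 ^ n),
    ENNReal.ofReal ((D n k ω) ^ (2 * m)) * ENNReal.ofReal (((5 / 4) ^ n) ^ (2 * m))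
  refine ⟨R, ?_, ?_⟩
  · have hDi : ∀ n k, ∫⁻ ω, ENNReal.ofReal ((D n k ω) ^ (2 * m)) ∂P
        = K * ENNReal.ofReal ((T / 2 ^ n) ^ m) := by
      intro n k
      have h1 := hW_incr (k * T / 2 ^ n) ((k + 1) * T / 2 ^ n) (by positivity) (by gcongr; linarith)
      have e : ((k + 1) * T / 2 ^ n - k * T / 2 ^ n : ℝ) = T / 2 ^ n := by ring
      rw [e] at h1
      rw [← hg _ (by positivity), ← h1, lintegral_map (by fun_prop) (hDm n k)]
    have hle : ∫⁻ ω, R ω ∂P ≤ ∑' n : ℕ, K * ENNReal.ofReal (T ^ m) *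
        ENNReal.ofReal ((2 * (25 / 32) ^ m) ^ n) := by
      rw [lintegral_tsum (fun n => by fun_prop)]
      refine ENNReal.tsum_le_tsum fun n => ?_
      rw [lintegral_finsetSum _ (fun k _ => by fun_prop)]
      simp_rw [lintegral_mul_const _ ((hDm n _).pow_const _).ennreal_ofReal, hDi]
      rw [Finset.sum_const, Finset.card_range, nsmul_eq_mul]
      have e2 : ((2 ^ n : ℕ) : ENNReal) = ENNReal.ofReal (2 ^ n) := by
        rw [← ENNReal.ofReal_natCast]; simp
      rw [e2, mul_assoc K, mul_assoc K, mul_left_comm _ K, ← ENNReal.ofReal_mul (by positivity),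
        ← ENNReal.ofReal_mul (by positivity), ← ENNReal.ofReal_mul (by positivity)]
      refine le_of_eq ?_
      congr 2
      rw [div_pow, ← pow_mul, ← pow_mul, mul_pow, ← pow_mul]
      have : (25 / 32 : ℝ) ^ (m * n) = ((5 / 4) ^ (n * (2 * m))) / 2 ^ (n * m) := by
        rw [show n * (2 * m) = 2 * (m * n) by ring, pow_mul (5 / 4 : ℝ), mul_comm n m, ← div_pow]
        norm_num
      rw [this]
      ring
    refine ne_top_of_le_ne_top ?_ hle
    rw [ENNReal.tsum_mul_left]
    refine ENNReal.mul_ne_top (ENNReal.mul_ne_top hK ENNReal.ofReal_ne_top) ?_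
    refine Summable.tsum_ofReal_ne_top (summable_geometric_of_lt_one (by positivity) ?_)
    have : (25 / 32 : ℝ) ^ m ≤ (25 / 32 : ℝ) ^ 3 :=
      pow_le_pow_of_le_one (by norm_num) (by norm_num) hm
    norm_num at this ⊢
    linarith
  · intro ω s hs
    by_cases hR : R ω = ⊤
    · rw [hR, ENNReal.mul_top]
      · exact le_top
      · simp
    set r := (R ω).toReal with hr
    have hr0 : 0 ≤ r := ENNReal.toReal_nonneg
    have hm2 : ((2 * m : ℕ) : ℝ) ≠ 0 := by
      have : 2 * m ≠ 0 := by omega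
      exact_mod_cast this
    set a := r ^ (1 / ((2 * m : ℕ) : ℝ)) with ha
    have ha0 : 0 ≤ a := by positivity
    have har : a ^ (2 * m) = r := by
      rw [ha, ← Real.rpow_natCast, ← Real.rpow_mul hr0, one_div, inv_mul_cancel₀ hm2, Real.rpow_one]
    have hb := aux_chain T hT (fun s => W s ω) (hW_cont ω) (hW_zero ω) a ha0 (by
      intro n k hk
      have h1 : ENNReal.ofReal ((D n k ω) ^ (2 * m)) * ENNReal.ofReal (((5 / 4) ^ n) ^ (2 * m))
          ≤ R ω :=
        (Finset.single_le_sum (f := fun k => ENNReal.ofReal ((D n k ω) ^ (2 * m)) *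
          ENNReal.ofReal (((5 / 4) ^ n) ^ (2 * m))) (fun _ _ => zero_le)
          (Finset.mem_range.2 hk)).trans (ENNReal.le_tsum n)
      have hev : (D n k ω) ^ (2 * m) = |D n k ω| ^ (2 * m) := by
        rw [pow_mul, pow_mul, sq_abs]
      rw [hev, ← ENNReal.ofReal_mul (by positivity), ← mul_pow,
        ENNReal.ofReal_le_iff_le_toReal hR, ← hr, ← har] at h1
      have h2 := le_of_pow_le_pow_left₀ (by omega) ha0 h1
      have h3 : |D n k ω| = |D n k ω| * (5 / 4) ^ n * (4 / 5) ^ n := by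
        rw [mul_assoc, ← mul_pow]; norm_num
      show |D n k ω| ≤ _
      rw [h3]
      gcongr) s hs
    have : |W s ω| ^ (2 * m) ≤ 5 ^ (2 * m) * r := by
      rw [← har, ← mul_pow]
      gcongr
    calc _ ≤ ENNReal.ofReal (5 ^ (2 * m) * r) := ENNReal.ofReal_le_ofReal this
      _ = _ := by rw [ENNReal.ofReal_mul (by positivity), hr, ENNReal.ofReal_toReal hR]

lemma aux_deriv {E Ω : Type*} [NormedAddCommGroup E] [NormedSpace ℝ E]
    [MeasurableSpace Ω] (P : Measure Ω) [IsProbabilityMeasure P]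
    (Z : Ω → E) (hZ : StronglyMeasurable Z) (hZi : ∀ n : ℕ, Integrable (fun ω => ‖Z ω‖ ^ n) P)
    (A : E →L[ℝ] E) (H : E → ℝ) (hH : ContDiff ℝ 1 H)
    (n k : ℕ) (hg0 : ∃ C : ℝ, 0 ≤ C ∧ ∀ x, ‖H x‖ ≤ C * (1 + ‖x‖ ^ n))
    (hg1 : ∃ C : ℝ, 0 ≤ C ∧ ∀ x, ‖fderiv ℝ H x‖ ≤ C * (1 + ‖x‖ ^ k)) (η : E) :
    Integrable (fun ω => fderiv ℝ H (A η + Z ω)) P ∧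
    ∀ h, fderiv ℝ (fun x => ∫ ω, H (A x + Z ω) ∂P) η h = ∫ ω, fderiv ℝ H (A η + Z ω) (A h) ∂P := by
  obtain ⟨C0, hC0, hb0⟩ := hg0
  obtain ⟨C1, hC1, hb1⟩ := hg1
  have hHc := hH.continuous
  have hDc : Continuous (fderiv ℝ H) := hH.continuous_fderiv (by norm_num)
  have hm : ∀ x, StronglyMeasurable fun ω => A x + Z ω := fun x => stronglyMeasurable_const.add hZ
  set B := ‖A‖ * (‖η‖ + 1) with hB
  have hB0 : 0 ≤ B := by positivity
  let bd : ℝ → ℕ → Ω → ℝ := fun C l ω => C * (1 + 2 ^ (l - 1) * (B ^ l + ‖Z ω‖ ^ l))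
  have hbdi : ∀ C l, Integrable (bd C l) P := fun C l =>
    ((integrable_const _).add (((integrable_const _).add (hZi l)).const_mul _)).const_mul _
  have hbd : ∀ C, 0 ≤ C → ∀ l ω, ∀ x ∈ Metric.ball η 1,
      C * (1 + ‖A x + Z ω‖ ^ l) ≤ bd C l ω := by
    intro C hC l ω x hx
    have h1 : ‖x‖ ≤ ‖η‖ + 1 := by
      have : ‖x - η‖ < 1 := by simpa [dist_eq_norm] using hx
      have h2 := norm_add_le (x - η) η
      rw [sub_add_cancel] at h2
      linarith
    have h2 : ‖A x + Z ω‖ ≤ B + ‖Z ω‖ := by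
      refine (norm_add_le _ _).trans ?_
      gcongr
      exact (A.le_opNorm x).trans (by rw [hB]; gcongr)
    have h3 : ‖A x + Z ω‖ ^ l ≤ 2 ^ (l - 1) * (B ^ l + ‖Z ω‖ ^ l) :=
      (pow_le_pow_left₀ (norm_nonneg _) h2 l).trans (add_pow_le hB0 (norm_nonneg _) l)
    show _ ≤ C * (1 + 2 ^ (l - 1) * (B ^ l + ‖Z ω‖ ^ l))
    gcongr
  have hself : η ∈ Metric.ball η 1 := Metric.mem_ball_self one_pos
  have hDi : Integrable (fun ω => fderiv ℝ H (A η + Z ω)) P :=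
    (hbdi C1 k).mono' (hDc.comp_stronglyMeasurable (hm η)).aestronglyMeasurable
      (ae_of_all _ fun ω => (hb1 _).trans (hbd C1 hC1 k ω η hself))
  refine ⟨hDi, fun h => ?_⟩
  have hcomp : Continuous fun L : E →L[ℝ] ℝ => L.comp A := by fun_prop
  have hF := hasFDerivAt_integral_of_dominated_of_fderiv_le (𝕜 := ℝ) (μ := P)
    (F := fun x ω => H (A x + Z ω)) (F' := fun x ω => (fderiv ℝ H (A x + Z ω)).comp A)
    (x₀ := η) (s := Metric.ball η 1) (bound := fun ω => bd C1 k ω * ‖A‖)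
    (Metric.ball_mem_nhds η one_pos)
    (Eventually.of_forall fun x => (hHc.comp_stronglyMeasurable (hm x)).aestronglyMeasurable)
    ((hbdi C0 n).mono' (hHc.comp_stronglyMeasurable (hm η)).aestronglyMeasurable
      (ae_of_all _ fun ω => (hb0 _).trans (hbd C0 hC0 n ω η hself)))
    (hcomp.comp_aestronglyMeasurable hDi.1)
    (ae_of_all _ fun ω x hx => (ContinuousLinearMap.opNorm_comp_le _ _).trans (by
      gcongr
      exact (hb1 _).trans (hbd C1 hC1 k ω x hx)))
    ((hbdi C1 k).mul_const _)
    (ae_of_all _ fun ω x _ => by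
      have h1 : HasFDerivAt H (fderiv ℝ H (A x + Z ω)) (A x + Z ω) :=
        (hH.differentiable (by norm_num) _).hasFDerivAt
      exact h1.comp x (A.hasFDerivAt.add_const (Z ω)))
  rw [hF.fderiv, ContinuousLinearMap.integral_apply]
  · rfl
  · exact (ContinuousLinearMap.compL ℝ E E ℝ |>.flip A).integrable_comp hDi

lemma aux_moments (T : ℝ) (hT : 0 < T)
    {Ω : Type*} [MeasurableSpace Ω] (P : Measure Ω) [IsProbabilityMeasure P]
    (W : ℝ → Ω → ℝ) (σ t : ℝ) (ht : t ∈ Icc 0 T)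
    (hsup : ∀ m : ℕ, 3 ≤ m → ∃ R : Ω → ENNReal, ∫⁻ ω, R ω ∂P ≠ ⊤ ∧ ∀ ω, ∀ s ∈ Icc 0 T,
      ENNReal.ofReal (|W s ω| ^ (2 * m)) ≤ ENNReal.ofReal (5 ^ (2 * m)) * R ω)
    (Z : Ω → C(Icc (-T) (0 : ℝ), ℝ)) (hZm : StronglyMeasurable Z)
    (hZ : ∀ ω x, Z ω x = σ * (W (max (T + x) t) ω - W t ω)) (n : ℕ) :
    Integrable (fun ω => ‖Z ω‖ ^ n) P := by
  set m := n + 3 with hmdef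
  obtain ⟨R, hR, hb⟩ := hsup m (by omega)
  have hpow : ∀ l : ℕ, AEStronglyMeasurable (fun ω => ‖Z ω‖ ^ l) P :=
    fun l => (hZm.norm.pow l).aestronglyMeasurable
  set c : ENNReal := ENNReal.ofReal (|σ| ^ (2 * m) * 2 ^ (2 * m - 1)) *
    (ENNReal.ofReal (5 ^ (2 * m)) + ENNReal.ofReal (5 ^ (2 * m))) with hc
  have hctop : c ≠ ⊤ := ENNReal.mul_ne_top ENNReal.ofReal_ne_top
    (ENNReal.add_ne_top.2 ⟨ENNReal.ofReal_ne_top, ENNReal.ofReal_ne_top⟩)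
  have key : ∀ ω, ENNReal.ofReal (‖Z ω‖ ^ (2 * m)) ≤ c * R ω := by
    intro ω
    have : Nonempty (Icc (-T) (0 : ℝ)) := ⟨⟨0, by simp [hT.le]⟩⟩
    obtain ⟨x, -, hx⟩ := isCompact_univ.exists_isMaxOn univ_nonempty
      ((Z ω).continuous.norm.continuousOn)
    have h1 : ‖Z ω‖ ≤ ‖Z ω x‖ :=
      (ContinuousMap.norm_le_of_nonempty _).2 fun y => hx (mem_univ y)
    set s := max (T + (x : ℝ)) t with hs
    have hsI : s ∈ Icc 0 T := by
      refine ⟨ht.1.trans (le_max_right _ _), max_le ?_ ht.2⟩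
      linarith [x.2.2]
    have h2 : ‖Z ω x‖ ≤ |σ| * (|W s ω| + |W t ω|) := by
      rw [hZ, Real.norm_eq_abs, abs_mul]
      gcongr
      exact abs_sub _ _
    have h3 : ‖Z ω‖ ^ (2 * m) ≤
        (|σ| ^ (2 * m) * 2 ^ (2 * m - 1)) * (|W s ω| ^ (2 * m) + |W t ω| ^ (2 * m)) := by
      refine (pow_le_pow_left₀ (norm_nonneg _) (h1.trans h2) _).trans ?_
      rw [mul_pow, mul_assoc]
      gcongr
      exact add_pow_le (abs_nonneg _) (abs_nonneg _) _
    refine (ENNReal.ofReal_le_ofReal h3).trans ?_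
    rw [ENNReal.ofReal_mul (by positivity), ENNReal.ofReal_add (by positivity) (by positivity), hc,
      mul_assoc, add_mul]
    gcongr
    · exact hb ω s hsI
    · exact hb ω t ht
  have hbig : Integrable (fun ω => ‖Z ω‖ ^ (2 * m)) P := by
    refine ⟨hpow _, ?_⟩
    rw [hasFiniteIntegral_iff_ofReal (ae_of_all _ fun ω => by positivity)]
    refine (lintegral_mono key).trans_lt ?_
    rw [lintegral_const_mul' _ _ hctop]
    exact (ENNReal.mul_ne_top hctop hR).lt_top
  refine ((integrable_const (1 : ℝ)).add hbig).mono' (hpow n) (ae_of_all _ fun ω => ?_)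
  rw [Real.norm_of_nonneg (by positivity)]
  show ‖Z ω‖ ^ n ≤ 1 + ‖Z ω‖ ^ (2 * m)
  rcases le_total ‖Z ω‖ 1 with h | h
  · have h1 := pow_le_one₀ (n := n) (norm_nonneg _) h
    have : 0 ≤ ‖Z ω‖ ^ (2 * m) := by positivity
    linarith
  · have := pow_le_pow_right₀ h (show n ≤ 2 * m by omega)
    linarith

lemma aux_split (T : ℝ) (hT : 0 < T) (t : ℝ) (ht : t ∈ Icc 0 T) (μ : Measure ℝ) [IsFiniteMeasure μ]
    (hμ : μ (Icc (-T) 0)ᶜ = 0) (h : C(Icc (-T) (0 : ℝ), ℝ)) :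
    ∫ ρ, h (projIcc (-T) 0 (neg_nonpos.mpr hT.le)
        ((projIcc (-T) 0 (neg_nonpos.mpr hT.le) ρ : ℝ) + T - t)) ∂μ =
      (∫ ρ in Ico (-T) (t - T), h (projIcc (-T) 0 (neg_nonpos.mpr hT.le) (ρ + T - t)) ∂μ) +
      h (projIcc (-T) 0 (neg_nonpos.mpr hT.le) 0) * (μ (Icc (t - T) 0)).toReal := by
  have hT' := neg_nonpos.mpr hT.le
  have hres : μ.restrict (Icc (-T) 0) = μ := Measure.restrict_eq_self_of_ae_mem (by
    rw [ae_iff]; exact hμ)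
  have hbi : ∀ f : ℝ → Icc (-T) (0 : ℝ), Continuous f → Integrable (fun ρ => h (f ρ)) μ := by
    intro f hf
    refine (integrable_const ‖h‖).mono' (h.continuous.comp hf).aestronglyMeasurable
      (ae_of_all _ fun ρ => h.norm_coe_le_norm _)
  have hpc : Continuous (projIcc (-T) 0 hT') := continuous_projIcc
  have hint : Integrable (fun ρ => h (projIcc (-T) 0 hT' (ρ + T - t))) μ :=
    hbi _ (hpc.comp (by fun_prop))
  have hU : Icc (-T) 0 = Ico (-T) (t - T) ∪ Icc (t - T) 0 := by
    rw [Ico_union_Icc_eq_Icc] <;> linarith [ht.1, ht.2]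
  calc _ = ∫ ρ in Icc (-T) 0, h (projIcc (-T) 0 hT'
        ((projIcc (-T) 0 hT' ρ : ℝ) + T - t)) ∂μ := by rw [hres]
    _ = ∫ ρ in Icc (-T) 0, h (projIcc (-T) 0 hT' (ρ + T - t)) ∂μ := by
      refine setIntegral_congr_fun measurableSet_Icc fun ρ hρ => ?_
      simp only [projIcc_of_mem hT' hρ]
    _ = (∫ ρ in Ico (-T) (t - T), h (projIcc (-T) 0 hT' (ρ + T - t)) ∂μ) +
        ∫ ρ in Icc (t - T) 0, h (projIcc (-T) 0 hT' (ρ + T - t)) ∂μ := by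
      rw [← setIntegral_union ?_ measurableSet_Icc hint.integrableOn hint.integrableOn, ← hU]
      rw [Set.disjoint_left]
      intro x hx hx'
      exact absurd hx.2 (not_lt.2 hx'.1)
    _ = _ := by
      congr 1
      rw [setIntegral_congr_fun (g := fun _ => h (projIcc (-T) 0 hT' 0)) measurableSet_Icc]
      · rw [setIntegral_const, smul_eq_mul, mul_comm]; rfl
      · intro ρ hρ
        have : projIcc (-T) 0 hT' (ρ + T - t) = projIcc (-T) 0 hT' 0 := by
          rw [projIcc_of_right_le hT' (by linarith [hρ.1] : (0 : ℝ) ≤ ρ + T - t),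
            projIcc_of_right_le hT' le_rfl]
        simp only [this]

lemma aux_approx (T : ℝ) (hT : 0 < T) (t : ℝ) :
    ∃ g : ℕ → C(Icc (-T) (0 : ℝ), ℝ), (∀ n, ‖g n‖ ≤ 1) ∧
      ∀ (μ : Measure ℝ) [IsFiniteMeasure μ], μ (Icc (-T) 0)ᶜ = 0 → t ∈ Icc 0 T →
        Tendsto (fun n => ∫ ρ, g n (projIcc (-T) 0 (neg_nonpos.mpr hT.le) ρ) ∂μ) atTop
          (𝓝 (μ (Icc (t - T) 0)).toReal) := by
  have hT' := neg_nonpos.mpr hT.le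
  let g : ℕ → C(Icc (-T) (0 : ℝ), ℝ) := fun n =>
    ⟨fun x => max 0 (1 - n * max (t - T - x) 0), by fun_prop⟩
  have hgv : ∀ n x, g n x = max 0 (1 - n * max (t - T - x) 0) := fun n x => rfl
  have hg1 : ∀ n, ‖g n‖ ≤ 1 := by
    intro n
    refine (ContinuousMap.norm_le _ zero_le_one).2 fun x => ?_
    rw [hgv, Real.norm_of_nonneg (le_max_left _ _)]
    refine max_le zero_le_one ?_
    have : (0 : ℝ) ≤ n * max (t - T - x) 0 := by positivity
    linarith
  refine ⟨g, hg1, fun μ _ hμ ht => ?_⟩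
  have hlim : (μ (Icc (t - T) 0)).toReal = ∫ ρ, (Icc (t - T) 0).indicator 1 ρ ∂μ := by
    rw [integral_indicator_one measurableSet_Icc]; rfl
  rw [hlim]
  refine tendsto_integral_of_dominated_convergence (fun _ => (1 : ℝ)) (fun n => ?_)
    (integrable_const _) (fun n => ae_of_all _ fun ρ => ((g n).norm_coe_le_norm _).trans (hg1 n)) ?_
  · exact ((g n).continuous.comp continuous_projIcc).aestronglyMeasurable
  · have hae : ∀ᵐ ρ ∂μ, ρ ∈ Icc (-T) 0 := by rw [ae_iff]; exact hμ
    filter_upwards [hae] with ρ hρ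
    simp only [hgv, projIcc_of_mem hT' hρ]
    by_cases h : t - T ≤ ρ
    · have : ρ ∈ Icc (t - T) 0 := ⟨h, hρ.2⟩
      rw [indicator_of_mem this, max_eq_right (by linarith : t - T - ρ ≤ 0)]
      simp
    · have : ρ ∉ Icc (t - T) 0 := fun h' => h h'.1
      rw [indicator_of_notMem this]
      push Not at h
      have hpos : 0 < t - T - ρ := by linarith
      refine tendsto_const_nhds.congr' ?_
      filter_upwards [eventually_ge_atTop ⌈1 / (t - T - ρ)⌉₊] with n hn
      rw [max_eq_left hpos.le, eq_comm, max_eq_left_iff]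
      have h1 := Nat.ceil_le.1 hn
      rw [div_le_iff₀ hpos] at h1
      linarith

/-- Let `H ∈ C³(C([-T,0];ℝ))` with `D³H` of polynomial growth, with `DH(ζ)`
identified via Riesz representation with a finite signed Borel measure `DH(ζ)(dρ)` on `[-T,0]`
(encoded as the difference `mp ζ − mm ζ` of finite Borel measures carried by `[-T,0]`), and
define `u(t,η) := E[H(Y_T^{t,η})]`.  Then, for every `t ∈ [0,T]`, `η` and `h`,
`Du(t,η)(h) = E[ ∫_{[-T,t−T[} h(ρ+T−t) DH(Y_T^{t,η})(dρ) ] + h(0) · E[ DH(Y_T^{t,η})([t−T,0]) ]`. -/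
theorem first_derivative_of_u
    (T : ℝ) (hT : 0 < T) (σ : ℝ)
    {Ω : Type*} [MeasurableSpace Ω] (P : Measure Ω) [IsProbabilityMeasure P]
    -- the Brownian motion `W`
    (W : ℝ → Ω → ℝ)
    (hW_meas : ∀ s, Measurable (W s))
    (hW_cont : ∀ ω, Continuous fun s => W s ω)
    (hW_zero : ∀ ω, W 0 ω = 0)
    (hW_incr : ∀ s t : ℝ, 0 ≤ s → s ≤ t →
      Measure.map (fun ω => W t ω - W s ω) P = gaussianReal 0 (Real.toNNReal (t - s)))
    (hW_indep : ∀ s t : ℝ, 0 ≤ s → s ≤ t →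
      Indep (MeasurableSpace.comap (fun ω => W t ω - W s ω) inferInstance)
        (⨆ r ∈ Set.Icc (0 : ℝ) s, MeasurableSpace.comap (W r) inferInstance) P)
    -- the functional Brownian flow `Y ω t η = Y_T^{t,η}(ω)`
    (Y : Ω → ℝ → C(Set.Icc (-T) (0 : ℝ), ℝ) → C(Set.Icc (-T) (0 : ℝ), ℝ))
    (hY : ∀ (ω : Ω) (t : ℝ), 0 ≤ t → t ≤ T →
      ∀ (η : C(Set.Icc (-T) (0 : ℝ), ℝ)) (x : Set.Icc (-T) (0 : ℝ)),
        Y ω t η x =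
          if (x : ℝ) ≤ t - T then
            η (Set.projIcc (-T) 0 (neg_nonpos.mpr hT.le) ((x : ℝ) + T - t))
          else
            η (Set.projIcc (-T) 0 (neg_nonpos.mpr hT.le) 0) + σ * (W (T + x) ω - W t ω))
    -- `H ∈ C³` with `D³H` of polynomial growth
    (H : C(Set.Icc (-T) (0 : ℝ), ℝ) → ℝ)
    (hH : ContDiff ℝ 3 H)
    (hH3_growth : ∃ C > (0 : ℝ), ∃ p : ℝ, 1 ≤ p ∧
      ∀ ζ : C(Set.Icc (-T) (0 : ℝ), ℝ), ‖iteratedFDeriv ℝ 3 H ζ‖ ≤ C * (1 + ‖ζ‖ ^ p))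
    -- Riesz representation of `DH(ζ)` by the finite signed measure `mp ζ − mm ζ` on `[-T,0]`
    (mp mm : C(Set.Icc (-T) (0 : ℝ), ℝ) → Measure ℝ)
    (hmp_fin : ∀ ζ, IsFiniteMeasure (mp ζ))
    (hmm_fin : ∀ ζ, IsFiniteMeasure (mm ζ))
    (hmp_supp : ∀ ζ, mp ζ (Set.Icc (-T) 0)ᶜ = 0)
    (hmm_supp : ∀ ζ, mm ζ (Set.Icc (-T) 0)ᶜ = 0)
    (hDH_repr : ∀ (ζ h : C(Set.Icc (-T) (0 : ℝ), ℝ)),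
      fderiv ℝ H ζ h =
        (∫ ρ, h (Set.projIcc (-T) 0 (neg_nonpos.mpr hT.le) ρ) ∂(mp ζ)) -
          ∫ ρ, h (Set.projIcc (-T) 0 (neg_nonpos.mpr hT.le) ρ) ∂(mm ζ))
    -- `u(t,η) = E[H(Y_T^{t,η})]`
    (u : ℝ → C(Set.Icc (-T) (0 : ℝ), ℝ) → ℝ)
    (hu : ∀ t η, u t η = ∫ ω, H (Y ω t η) ∂P) :
    ∀ t ∈ Set.Icc (0 : ℝ) T, ∀ η h : C(Set.Icc (-T) (0 : ℝ), ℝ),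
      fderiv ℝ (u t) η h =
        (∫ ω,
          ((∫ ρ in Set.Ico (-T) (t - T),
              h (Set.projIcc (-T) 0 (neg_nonpos.mpr hT.le) (ρ + T - t)) ∂(mp (Y ω t η))) -
            ∫ ρ in Set.Ico (-T) (t - T),
              h (Set.projIcc (-T) 0 (neg_nonpos.mpr hT.le) (ρ + T - t)) ∂(mm (Y ω t η))) ∂P)
        + h (Set.projIcc (-T) 0 (neg_nonpos.mpr hT.le) 0) *
            ∫ ω, ((mp (Y ω t η) (Set.Icc (t - T) 0)).toReal -
              (mm (Y ω t η) (Set.Icc (t - T) 0)).toReal) ∂P := by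
  intro t ht η h
  have hT' := neg_nonpos.mpr hT.le
  have hne : Nonempty (Icc (-T) (0 : ℝ)) := ⟨⟨0, by simp [hT.le]⟩⟩
  -- the linear part of the flow
  let φ : C(Icc (-T) (0 : ℝ), Icc (-T) (0 : ℝ)) :=
    ⟨fun x => projIcc (-T) 0 hT' ((x : ℝ) + T - t),
      (continuous_projIcc (h := hT')).comp (by fun_prop)⟩
  let A : C(Icc (-T) (0 : ℝ), ℝ) →L[ℝ] C(Icc (-T) (0 : ℝ), ℝ) :=
    LinearMap.mkContinuous
      { toFun := fun f => f.comp φ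
        map_add' := fun f g => rfl
        map_smul' := fun c f => rfl } 1 (by
      intro f
      rw [one_mul]
      exact (ContinuousMap.norm_le _ (norm_nonneg _)).2 fun x => f.norm_coe_le_norm _)
  have hA : ∀ f x, A f x = f (projIcc (-T) 0 hT' ((x : ℝ) + T - t)) := fun f x => rfl
  -- the random part of the flow
  let Z : Ω → C(Icc (-T) (0 : ℝ), ℝ) := fun ω =>
    ⟨fun x => σ * (W (max (T + (x : ℝ)) t) ω - W t ω), by
      have := hW_cont ω
      exact continuous_const.mul ((this.comp (by fun_prop)).sub continuous_const)⟩
  have hZ : ∀ ω x, Z ω x = σ * (W (max (T + (x : ℝ)) t) ω - W t ω) := fun ω x => rfl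
  have hZm : StronglyMeasurable Z := aux_measurable Z fun x => by
    simp only [hZ]
    exact ((hW_meas _).sub (hW_meas _)).const_mul σ
  have hZi : ∀ n : ℕ, Integrable (fun ω => ‖Z ω‖ ^ n) P :=
    aux_moments T hT P W σ t ht
      (aux_sup T hT P W hW_meas hW_cont hW_zero hW_incr) Z hZm hZ
  have hYZ : ∀ ω f, Y ω t f = A f + Z ω := by
    intro ω f
    ext x
    rw [hY ω t ht.1 ht.2 f x, ContinuousMap.add_apply, hA, hZ]
    split_ifs with hx
    · rw [max_eq_right (by linarith)]; ring
    · push Not at hx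
      rw [max_eq_left (by linarith),
        projIcc_of_right_le hT' (by linarith : (0 : ℝ) ≤ (x : ℝ) + T - t),
        projIcc_of_right_le hT' le_rfl]
  -- polynomial growth of `H` and its derivative
  obtain ⟨C, hC, p, hp, hgr⟩ := hH3_growth
  obtain ⟨n0, n1, hg0, hg1⟩ := aux_growth3 H hH C hC p hp hgr
  obtain ⟨hDi, hder⟩ := aux_deriv P Z hZm hZi A H (hH.of_le (by norm_num)) _ _ hg0 hg1 η
  have hut : u t = fun x => ∫ ω, H (A x + Z ω) ∂P := by
    funext x
    rw [hu]
    simp only [hYZ]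
  simp only [hYZ]
  rw [hut, hder h]
  -- the mass of `[t - T, 0]` is integrable
  obtain ⟨g, hgn, hglim⟩ := aux_approx T hT t
  let M : Ω → ℝ := fun ω => (mp (A η + Z ω) (Icc (t - T) 0)).toReal -
    (mm (A η + Z ω) (Icc (t - T) 0)).toReal
  have hMlim : ∀ ω, Tendsto (fun n => fderiv ℝ H (A η + Z ω) (g n)) atTop (𝓝 (M ω)) := by
    intro ω
    have := hmp_fin (A η + Z ω)
    have := hmm_fin (A η + Z ω)
    have h1 := (hglim (mp (A η + Z ω)) (hmp_supp _) ht).sub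
      (hglim (mm (A η + Z ω)) (hmm_supp _) ht)
    refine h1.congr fun n => ?_
    rw [hDH_repr]
  have hMm : AEStronglyMeasurable M P :=
    aestronglyMeasurable_of_tendsto_ae atTop
      (fun n => (hDi.apply_continuousLinearMap (g n)).1) (ae_of_all _ hMlim)
  have hMi : Integrable M P := by
    refine hDi.norm.mono' hMm (ae_of_all _ fun ω => ?_)
    refine le_of_tendsto' (hMlim ω).norm fun n => ?_
    refine (ContinuousLinearMap.le_opNorm _ _).trans ?_
    exact mul_le_of_le_one_right (norm_nonneg _) (hgn n)
  have hpt : ∀ ω, (∫ ρ in Ico (-T) (t - T), h (projIcc (-T) 0 hT' (ρ + T - t)) ∂(mp (A η + Z ω))) -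
      (∫ ρ in Ico (-T) (t - T), h (projIcc (-T) 0 hT' (ρ + T - t)) ∂(mm (A η + Z ω))) =
      fderiv ℝ H (A η + Z ω) (A h) - h (projIcc (-T) 0 hT' 0) * M ω := by
    intro ω
    have := hmp_fin (A η + Z ω)
    have := hmm_fin (A η + Z ω)
    have e1 := aux_split T hT t ht (mp (A η + Z ω)) (hmp_supp _) h
    have e2 := aux_split T hT t ht (mm (A η + Z ω)) (hmm_supp _) h
    rw [hDH_repr]
    simp only [hA]
    rw [e1, e2]
    show _ = _ - _ * ((mp (A η + Z ω) (Icc (t - T) 0)).toReal -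
      (mm (A η + Z ω) (Icc (t - T) 0)).toReal)
    ring
  simp only [hpt]
  rw [integral_sub (hDi.apply_continuousLinearMap (A h)) (hMi.const_mul _), integral_const_mul]
  show _ = _ - _ * (∫ ω, M ω ∂P) + _ * ∫ ω, M ω ∂P
  ring
end

section
/- Let H:C([-T,0];ℝ)→ℝ be three times continuously Fréchet differentiable with D³H of polynomial growth, satisfying: (i) for every η, the measure representing DH(η) is absolutely continuous with density x ↦ D_xH(η) in H¹([-T,0]); (ii) ‖DH(η)‖_{H¹} ≤ C(1+‖η‖_∞^p) for some C>0, p≥1 and all η; (iii) η ↦ DH(η) is continuous from C([-T,0];ℝ) to H¹([-T,0]); (iv) for every ζ, D²H(ζ) is represented by a finite signed Borel measure m_ζ on [-T,0]². Define u(t,η) := E[H(Y_T^{t,η})]. Then for every t∈[0,T[ and η∈C([-T,0];ℝ), the partial derivative ∂_t u(t,η) exists and ∂_t u(t,η) = − E[ ∫_{]-t,0]} D_{x−T+t}H(Y_T^{t,η}) d⁻η(x) ] − (σ²/2) E[ m_{Y_T^{t,η}}( ]t−T,0] × ]t−T,0] ) ], where the first term is a deterministic forward integral. -/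
open MeasureTheory ProbabilityTheory Set Filter Topology


lemma aux_measurable_of_eval {Ω X : Type*} {m : MeasurableSpace Ω} [TopologicalSpace X]
    [CompactSpace X] [T2Space X] [SecondCountableTopology X]
    [MeasurableSpace C(X, ℝ)] [BorelSpace C(X, ℝ)]
    (f : Ω → C(X, ℝ)) (hf : ∀ x, Measurable (fun ω => f ω x)) : Measurable f := by
  obtain ⟨D, hDc, hDd⟩ := TopologicalSpace.exists_countable_dense X
  have hball : ∀ (c : C(X, ℝ)) (r : ℝ), MeasurableSet {ω | f ω ∈ Metric.ball c r} := by
    intro c r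
    have hcl : ∀ r : ℝ, 0 ≤ r → MeasurableSet {ω | dist (f ω) c ≤ r} := by
      intro r hr
      have : {ω | dist (f ω) c ≤ r} = ⋂ x ∈ D, {ω | dist (f ω x) (c x) ≤ r} := by
        ext ω
        simp only [mem_ofPred_eq, mem_iInter]
        rw [ContinuousMap.dist_le hr]
        constructor
        · intro h x _; exact h x
        · intro h x
          have hclosed : IsClosed {x | dist (f ω x) (c x) ≤ r} :=
            isClosed_le (by fun_prop) continuous_const
          have : closure D ⊆ {x | dist (f ω x) (c x) ≤ r} :=
            hclosed.closure_subset_iff.mpr (fun x hx => h x hx)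
          exact this (hDd x)
      rw [this]
      refine MeasurableSet.biInter hDc (fun x _ => ?_)
      exact measurableSet_le ((hf x).dist measurable_const) measurable_const
    have hm : Measurable (fun ω => dist (f ω) c) := by
      refine measurable_of_Iic (fun r => ?_)
      by_cases hr : 0 ≤ r
      · exact hcl r hr
      · have : (fun ω => dist (f ω) c) ⁻¹' Iic r = ∅ := by
          ext ω
          simp only [mem_preimage, mem_Iic, mem_empty_iff_false, iff_false, not_le]
          exact lt_of_lt_of_le (not_le.mp hr) dist_nonneg
        rw [this]; exact MeasurableSet.empty
    exact measurableSet_lt hm measurable_const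
  refine measurable_of_isOpen (fun s hs => ?_)
  have hx : ∀ x : s, ∃ r > 0, Metric.ball (x : C(X, ℝ)) r ⊆ s :=
    fun x => Metric.isOpen_iff.mp hs x x.2
  choose r hr hsub using hx
  obtain ⟨t, htc, ht⟩ := TopologicalSpace.isOpen_iUnion_countable
    (fun x : s => Metric.ball (x : C(X, ℝ)) (r x)) (fun _ => Metric.isOpen_ball)
  have hs' : s = ⋃ x ∈ t, Metric.ball (x : C(X, ℝ)) (r x) := by
    rw [ht]
    apply Subset.antisymm
    · intro x hx
      exact mem_iUnion.mpr ⟨⟨x, hx⟩, Metric.mem_ball_self (hr _)⟩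
    · exact iUnion_subset hsub
  rw [hs', preimage_iUnion₂]
  exact MeasurableSet.biUnion htc (fun x _ => hball _ _)

/-- Mean value inequality with polynomial growth of the derivative. -/
lemma aux_lip_growth {E F : Type*} [NormedAddCommGroup E] [NormedSpace ℝ E]
    [NormedAddCommGroup F] [NormedSpace ℝ F] (f : E → F) (hf : Differentiable ℝ f)
    (C : ℝ) (hC : 0 ≤ C) (n : ℕ) (hg : ∀ x, ‖fderiv ℝ f x‖ ≤ C * (1 + ‖x‖) ^ n)
    (R : ℝ) (x y : E) (hx : ‖x‖ ≤ R) (hy : ‖y‖ ≤ R) :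
    ‖f y - f x‖ ≤ C * (1 + R) ^ n * ‖y - x‖ := by
  refine (convex_closedBall (0 : E) R).norm_image_sub_le_of_norm_fderiv_le (𝕜 := ℝ)
    (fun z _ => hf z) (fun z hz => ?_) (by simpa using hx) (by simpa using hy)
  have hz' : ‖z‖ ≤ R := by simpa using hz
  refine (hg z).trans ?_
  gcongr

lemma aux_growth_of_deriv {E F : Type*} [NormedAddCommGroup E] [NormedSpace ℝ E]
    [NormedAddCommGroup F] [NormedSpace ℝ F] (f : E → F) (hf : Differentiable ℝ f)
    (h : ∃ C : ℝ, ∃ n : ℕ, 0 ≤ C ∧ ∀ x, ‖fderiv ℝ f x‖ ≤ C * (1 + ‖x‖) ^ n) :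
    ∃ C : ℝ, ∃ n : ℕ, 0 ≤ C ∧ ∀ x, ‖f x‖ ≤ C * (1 + ‖x‖) ^ n := by
  obtain ⟨C, n, hC, hg⟩ := h
  refine ⟨‖f 0‖ + C, n + 1, by positivity, fun x => ?_⟩
  have h1 := aux_lip_growth f hf C hC n hg ‖x‖ 0 x (by simp) le_rfl
  rw [sub_zero] at h1
  have h2 : ‖f x‖ ≤ ‖f 0‖ + ‖f x - f 0‖ := by
    have := norm_add_le (f 0) (f x - f 0); simpa using this
  have h3 : (1:ℝ) ≤ (1 + ‖x‖) ^ (n + 1) := one_le_pow₀ (by linarith [norm_nonneg x])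
  have h4 : C * (1 + ‖x‖) ^ n * ‖x‖ ≤ C * (1 + ‖x‖) ^ (n + 1) := by
    rw [pow_succ, mul_assoc]; gcongr; linarith
  nlinarith [norm_nonneg (f 0)]

lemma aux_rpow_le (C p a : ℝ) (hC : 0 < C) (ha : 0 ≤ a) (hp : 1 ≤ p) :
    C * (1 + a ^ p) ≤ 2 * C * (1 + a) ^ (⌈p⌉₊) := by
  have h1 : a ^ p ≤ (1 + a) ^ (⌈p⌉₊) := by
    rw [← Real.rpow_natCast]
    calc a ^ p ≤ (1 + a) ^ p := Real.rpow_le_rpow ha (by linarith) (by linarith)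
      _ ≤ _ := Real.rpow_le_rpow_of_exponent_le (by linarith) (Nat.le_ceil p)
  have h2 : (1:ℝ) ≤ (1 + a) ^ (⌈p⌉₊) := one_le_pow₀ (by linarith)
  nlinarith

/-- Second order Taylor expansion with cubic remainder. -/
lemma aux_taylor {E : Type*} [NormedAddCommGroup E] [NormedSpace ℝ E]
    (H : E → ℝ) (hH : ContDiff ℝ 3 H) (L : ℝ) (v h : E)
    (hL : ∀ τ ∈ Icc (0:ℝ) 1,
      ‖fderiv ℝ (fderiv ℝ H) (v + τ • h) - fderiv ℝ (fderiv ℝ H) v‖ ≤ L * ‖h‖) :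
    |H (v + h) - H v - fderiv ℝ H v h - fderiv ℝ (fderiv ℝ H) v h h / 2| ≤ L * ‖h‖ ^ 3 := by
  have hd1 : Differentiable ℝ H := hH.differentiable (by norm_num)
  have hc2 : ContDiff ℝ 2 (fderiv ℝ H) := hH.fderiv_right (by norm_num)
  have hd2 : Differentiable ℝ (fderiv ℝ H) := hc2.differentiable (by norm_num)
  have hline : ∀ τ : ℝ, HasDerivAt (fun τ : ℝ => v + τ • h) h τ := by
    intro τ
    simpa using ((hasDerivAt_id τ).smul_const h).const_add v
  have hA : ∀ τ : ℝ, HasDerivAt (fun τ : ℝ => fderiv ℝ H (v + τ • h) h)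
      (fderiv ℝ (fderiv ℝ H) (v + τ • h) h h) τ := by
    intro τ
    have h1 : HasDerivAt (fun τ : ℝ => fderiv ℝ H (v + τ • h))
      (fderiv ℝ (fderiv ℝ H) (v + τ • h) h) τ :=
      (hd2 (v + τ • h)).hasFDerivAt.comp_hasDerivAt τ (hline τ)
    exact (h1.clm_apply (hasDerivAt_const τ h)).congr_deriv (by simp)
  have hB : ∀ τ : ℝ, HasDerivAt (fun τ : ℝ => H (v + τ • h))
      (fderiv ℝ H (v + τ • h) h) τ := fun τ =>
      (hd1 (v + τ • h)).hasFDerivAt.comp_hasDerivAt τ (hline τ)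
  have step1 : ∀ τ ∈ Icc (0:ℝ) 1,
      ‖fderiv ℝ H (v + τ • h) h - fderiv ℝ H v h - τ * fderiv ℝ (fderiv ℝ H) v h h‖
        ≤ L * ‖h‖ ^ 3 := by
    intro τ hτ
    have hLh : 0 ≤ L * ‖h‖ := (norm_nonneg (fderiv ℝ (fderiv ℝ H) (v + (0:ℝ) • h) -
      fderiv ℝ (fderiv ℝ H) v)).trans (hL 0 (by simp))
    have key := norm_image_sub_le_of_norm_deriv_le_segment' (a := (0:ℝ)) (b := 1)
      (f := fun τ => fderiv ℝ H (v + τ • h) h - fderiv ℝ H v h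
        - τ * fderiv ℝ (fderiv ℝ H) v h h)
      (f' := fun τ => fderiv ℝ (fderiv ℝ H) (v + τ • h) h h - fderiv ℝ (fderiv ℝ H) v h h)
      (C := L * ‖h‖ ^ 3)
      (fun x _ => (((hA x).sub_const _).sub
        ((hasDerivAt_id x).mul_const _)).hasDerivWithinAt.congr_deriv (by simp))
      (fun x hx => by
        have := hL x ⟨hx.1, hx.2.le⟩
        have e : fderiv ℝ (fderiv ℝ H) (v + x • h) h h - fderiv ℝ (fderiv ℝ H) v h h
          = (fderiv ℝ (fderiv ℝ H) (v + x • h) - fderiv ℝ (fderiv ℝ H) v) h h := by simp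
        rw [e]
        calc _ ≤ ‖(fderiv ℝ (fderiv ℝ H) (v + x • h) - fderiv ℝ (fderiv ℝ H) v)‖ * ‖h‖ * ‖h‖ :=
              ContinuousLinearMap.le_opNorm₂ _ _ _
          _ ≤ (L * ‖h‖) * ‖h‖ * ‖h‖ := by gcongr
          _ = _ := by ring) τ hτ
    simp only [zero_smul, add_zero, sub_self, zero_mul, sub_zero] at key
    refine key.trans ?_
    have : 0 ≤ L * ‖h‖ ^ 3 := by
      have : L * ‖h‖ ^ 3 = (L * ‖h‖) * ‖h‖ ^ 2 := by ring
      rw [this]; positivity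
    nlinarith [hτ.1, hτ.2]
  have key := norm_image_sub_le_of_norm_deriv_le_segment' (a := (0:ℝ)) (b := 1)
      (f := fun τ => H (v + τ • h) - τ * fderiv ℝ H v h
        - τ ^ 2 / 2 * fderiv ℝ (fderiv ℝ H) v h h)
      (f' := fun τ => fderiv ℝ H (v + τ • h) h - fderiv ℝ H v h
        - τ * fderiv ℝ (fderiv ℝ H) v h h)
      (C := L * ‖h‖ ^ 3)
      (fun x _ => by
        have h2 : HasDerivAt (fun τ : ℝ => τ ^ 2 / 2) x x := by
          have := ((hasDerivAt_id x).pow 2).div_const 2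
          exact this.congr_deriv (by simp)
        exact (((hB x).sub ((hasDerivAt_id x).mul_const _)).sub
          (h2.mul_const _)).hasDerivWithinAt.congr_deriv (by simp))
      (fun x hx => step1 x ⟨hx.1, hx.2.le⟩) 1 (by simp)
  have e : H (v + h) - H v - fderiv ℝ H v h - fderiv ℝ (fderiv ℝ H) v h h / 2 =
    H (v + (1:ℝ) • h) - 1 * fderiv ℝ H v h - 1 ^ 2 / 2 * fderiv ℝ (fderiv ℝ H) v h h
     - (H (v + (0:ℝ) • h) - 0 * fderiv ℝ H v h - 0 ^ 2 / 2 * fderiv ℝ (fderiv ℝ H) v h h) := by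
    simp only [one_smul, zero_smul, add_zero]; ring
  rw [e]
  simpa using key

/-- Mean value theorem along a segment. -/
lemma aux_mvt {E : Type*} [NormedAddCommGroup E] [NormedSpace ℝ E]
    (H : E → ℝ) (hH : Differentiable ℝ H) (v h : E) :
    ∃ ζ : E, ‖ζ - v‖ ≤ ‖h‖ ∧ (∀ R, ‖v‖ ≤ R → ‖v + h‖ ≤ R → ‖ζ‖ ≤ R) ∧
      H (v + h) - H v = fderiv ℝ H ζ h := by
  obtain ⟨z, hz, hzz⟩ := domain_mvt (f := H) (f' := fderiv ℝ H) (s := univ)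
    (x := v) (y := v + h) (fun x _ => (hH x).hasFDerivAt.hasFDerivWithinAt) convex_univ
    (mem_univ _) (mem_univ _)
  refine ⟨z, ?_, ?_, by simpa using hzz⟩
  · have := segment_subset_closedBall_left v (v + h) hz
    simpa [dist_eq_norm] using this
  · intro R h1 h2
    have := (convex_closedBall (0 : E) R).segment_subset (x := v) (y := v + h) (by simpa using h1)
      (by simpa using h2) hz
    simpa using this


lemma aux_abs_integrable (f : ℝ → ℝ) (S : Set ℝ) (hSf : volume S ≠ ⊤)
    (hf : IntegrableOn (fun x => (f x) ^ 2) S) :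
    IntegrableOn (fun x => |f x|) S ∧
      ∫ x in S, |f x| ≤ (volume S).toReal + ∫ x in S, (f x) ^ 2 := by
  have hone : IntegrableOn (fun _ : ℝ => (1:ℝ)) S := integrableOn_const hSf
  have hb : ∀ x, |f x| ≤ 1 + (f x) ^ 2 := by
    intro x
    have := sq_abs (f x)
    nlinarith [sq_nonneg (|f x| - 1)]
  have hi : IntegrableOn (fun x => |f x|) S := by
    refine Integrable.mono' (hone.add hf) ?_ (ae_of_all _ fun x => by simpa using hb x)
    have := (Real.continuous_sqrt.comp_aestronglyMeasurable hf.aestronglyMeasurable)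
    exact this.congr (ae_of_all _ fun x => by simp [Real.sqrt_sq_eq_abs])
  refine ⟨hi, ?_⟩
  calc ∫ x in S, |f x| ≤ ∫ x in S, (1 + (f x) ^ 2) :=
        integral_mono hi (Integrable.add hone hf : Integrable (fun x => 1 + (f x) ^ 2) _) hb
    _ = _ := by
        rw [integral_add hone hf]; simp [Measure.real]

lemma aux_l1_lip_of_measure (μ : Measure ℝ) [IsFiniteMeasure μ] (g : ℝ → ℝ)
    (h : ∀ x y, x ≤ y → |g y - g x| ≤ (μ (Icc x y)).toReal) :
    Measurable g ∧ ∀ ε > 0, ∫ x, |g (x + ε) - g x| ≤ (μ univ).toReal * ε := by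
  have hmeas : Measurable g := by
    set m1 : ℝ → ℝ := fun x => μ.real (Iic x) + μ.real (Iio x) with hm1
    have hm1mono : Monotone m1 := by
      intro x y hxy
      simp only [hm1]
      exact add_le_add (measureReal_mono (Iic_subset_Iic.mpr hxy) (measure_ne_top _ _))
        (measureReal_mono (Iio_subset_Iio hxy) (measure_ne_top _ _))
    have h2 : Monotone (fun x => g x + m1 x) := by
      intro x y hxy
      rcases hxy.eq_or_lt with rfl | hlt
      · exact le_rfl
      have hh := (abs_le.mp (h x y hxy)).1
      have e1 : μ.real (Iic y) = μ.real (Iic x) + μ.real (Ioc x y) := by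
        rw [← Iic_union_Ioc_eq_Iic hxy, measureReal_union _ measurableSet_Ioc]
        rw [Set.disjoint_left]; intro z hz hz'; exact absurd hz'.1 (not_lt.mpr hz)
      have e2 : μ.real (Iio y) = μ.real (Iio x) + μ.real (Ico x y) := by
        rw [← Iio_union_Ico_eq_Iio hxy, measureReal_union _ measurableSet_Ico]
        rw [Set.disjoint_left]; intro z hz hz'; exact absurd hz'.1 (not_le.mpr hz)
      have e3 : μ.real (Icc x y) ≤ μ.real (Ioc x y) + μ.real (Ico x y) := by
        refine le_trans (measureReal_mono ?_ (measure_ne_top _ _)) (measureReal_union_le _ _)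
        intro z hz
        rcases hz.1.eq_or_lt with rfl | h1
        · right; exact ⟨le_rfl, hlt⟩
        · left; exact ⟨h1, hz.2⟩
      simp only [hm1]
      have : (μ (Icc x y)).toReal = μ.real (Icc x y) := rfl
      linarith
    have : g = fun x => (g x + m1 x) - m1 x := by ext x; ring
    rw [this]
    exact h2.measurable.sub hm1mono.measurable
  refine ⟨hmeas, fun ε hε => ?_⟩
  have hm : Measurable (fun x => |g (x + ε) - g x|) := by
    have : Measurable (fun x => g (x + ε)) := hmeas.comp (measurable_id.add_const ε)
    fun_prop
  rw [integral_eq_lintegral_of_nonneg_ae (ae_of_all _ fun x => abs_nonneg _)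
    hm.aestronglyMeasurable]
  have key : ∫⁻ x, ENNReal.ofReal |g (x + ε) - g x| ≤ μ univ * ENNReal.ofReal ε := by
    calc ∫⁻ x, ENNReal.ofReal |g (x + ε) - g x|
        ≤ ∫⁻ x, μ (Icc x (x + ε)) := by
          refine lintegral_mono fun x => ?_
          exact ENNReal.ofReal_le_of_le_toReal (h x (x + ε) (by linarith))
      _ = ∫⁻ x, ∫⁻ z, ({p : ℝ × ℝ | p.1 ≤ p.2 ∧ p.2 ≤ p.1 + ε}).indicator 1 (x, z) ∂μ := by
          refine lintegral_congr fun x => ?_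
          rw [← lintegral_indicator_one measurableSet_Icc]
          refine lintegral_congr fun z => ?_
          rfl
      _ = ∫⁻ z, (∫⁻ x, ({p : ℝ × ℝ | p.1 ≤ p.2 ∧ p.2 ≤ p.1 + ε}).indicator 1 (x, z)) ∂μ := by
          refine lintegral_lintegral_swap ?_
          refine Measurable.aemeasurable ?_
          refine Measurable.indicator measurable_const ?_
          exact (measurableSet_le measurable_fst measurable_snd).inter
            (measurableSet_le measurable_snd (measurable_fst.add_const ε))
      _ = ∫⁻ z, ENNReal.ofReal ε ∂μ := by
          refine lintegral_congr fun z => ?_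
          have : ∀ x, ({p : ℝ × ℝ | p.1 ≤ p.2 ∧ p.2 ≤ p.1 + ε}).indicator (1 : ℝ × ℝ → ENNReal)
              (x, z) = (Icc (z - ε) z).indicator 1 x := by
            intro x
            simp only [Set.indicator, mem_ofPred_eq, mem_Icc, Pi.one_apply]
            congr 1
            apply propext
            constructor <;> rintro ⟨h1, h2⟩ <;> constructor <;> linarith
          simp_rw [this]
          rw [lintegral_indicator_one measurableSet_Icc, Real.volume_Icc]
          congr 1; ring
      _ = _ := by rw [lintegral_const, mul_comm]
  calc _ ≤ (μ univ * ENNReal.ofReal ε).toReal :=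
        ENNReal.toReal_mono (ENNReal.mul_ne_top (measure_ne_top _ _) ENNReal.ofReal_ne_top) key
    _ = _ := by rw [ENNReal.toReal_mul, ENNReal.toReal_ofReal hε.le]

/-- The (possibly badly represented) `H¹` density, extended by zero, is bounded and `L¹`-Lipschitz. -/
lemma aux_bv (T : ℝ) (hT : 0 < T) (g f : ℝ → ℝ)
    (hg : IntegrableOn (fun x => (g x) ^ 2) (Icc (-T) 0))
    (hf : IntegrableOn (fun x => (f x) ^ 2) (Icc (-T) 0))
    (hac : ∀ x ∈ Icc (-T) (0:ℝ), g x = g (-T) + ∫ y in (-T)..x, f y) (Q : ℝ)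
    (hQ : (∫ x in Icc (-T) 0, (g x) ^ 2) + ∫ x in Icc (-T) 0, (f x) ^ 2 ≤ Q) :
    let G := (Icc (-T) (0:ℝ)).indicator g
    let K := 6 * (T + Q) + 2 * ((T + Q) / T)
    Measurable G ∧ (∀ x, |G x| ≤ K) ∧ ∀ ε > 0, ∫ x, |G (x + ε) - G x| ≤ K * ε := by
  intro G K
  have hvol : (volume (Icc (-T) (0:ℝ))).toReal = T := by
    rw [Real.volume_Icc, ENNReal.toReal_ofReal] <;> linarith
  obtain ⟨hfi, hfM⟩ := aux_abs_integrable f _ (by simp) hf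
  obtain ⟨hgi, hgM⟩ := aux_abs_integrable g _ (by simp) hg
  rw [hvol] at hfM hgM
  set M := ∫ x in Icc (-T) 0, |f x| with hM
  have hg2 : 0 ≤ ∫ x in Icc (-T) 0, (g x) ^ 2 := integral_nonneg fun x => sq_nonneg _
  have hf2 : 0 ≤ ∫ x in Icc (-T) 0, (f x) ^ 2 := integral_nonneg fun x => sq_nonneg _
  have hM0 : 0 ≤ M := integral_nonneg fun x => abs_nonneg _
  have hMQ : M ≤ T + Q := by linarith
  have hsub : ∀ x y, x ≤ y → x ∈ Icc (-T) (0:ℝ) → y ∈ Icc (-T) (0:ℝ) →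
      |∫ z in x..y, f z| ≤ ∫ z in Icc x y, |f z| := by
    intro x y hxy hx hy
    rw [intervalIntegral.integral_of_le hxy, integral_Icc_eq_integral_Ioc]
    exact abs_integral_le_integral_abs
  have hsubM : ∀ x y, x ≤ y → x ∈ Icc (-T) (0:ℝ) → y ∈ Icc (-T) (0:ℝ) →
      ∫ z in Icc x y, |f z| ≤ M := by
    intro x y hxy hx hy
    exact setIntegral_mono_set hfi (ae_of_all _ fun x => abs_nonneg _)
      (Icc_subset_Icc hx.1 hy.2).eventuallyLE
  set S : Set ℝ := {x | x ∈ Icc (-T) (0:ℝ) ∧ IntervalIntegrable f volume (-T) x} with hS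
  have hnotS : ∀ x ∈ Icc (-T) (0:ℝ), x ∉ S → g x = g (-T) := by
    intro x hx hxS
    have : ¬ IntervalIntegrable f volume (-T) x := fun h => hxS ⟨hx, h⟩
    rw [hac x hx, intervalIntegral.integral_undef this, add_zero]
  have hSdown : ∀ x y, x ≤ y → x ∈ Icc (-T) (0:ℝ) → y ∈ S → x ∈ S := by
    intro x y hxy hx hy
    refine ⟨hx, hy.2.mono_set ?_⟩
    rw [uIcc_of_le hx.1, uIcc_of_le hy.1.1]
    exact Icc_subset_Icc le_rfl hxy
  have hSM : ∀ x ∈ Icc (-T) (0:ℝ), |g x - g (-T)| ≤ M := by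
    intro x hx
    rw [hac x hx, add_sub_cancel_left]
    exact (hsub _ _ hx.1 ⟨le_rfl, by linarith⟩ hx).trans (hsubM _ _ hx.1 ⟨le_rfl, by linarith⟩ hx)
  have hboth : ∀ x y, x ≤ y → x ∈ S → y ∈ S → |g y - g x| ≤ ∫ z in Icc x y, |f z| := by
    intro x y hxy hx hy
    have : g y - g x = ∫ z in x..y, f z := by
      rw [hac x hx.1, hac y hy.1, ← intervalIntegral.integral_interval_sub_left hy.2 hx.2]; ring
    rw [this]; exact hsub x y hxy hx.1 hy.1
  have hosc : ∀ x ∈ Icc (-T) (0:ℝ), ∀ y ∈ Icc (-T) (0:ℝ), |g x| ≤ 2 * M + |g y| := by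
    intro x hx y hy
    have h1 := hSM x hx
    have h2 := hSM y hy
    have h3 : |g x| ≤ |g x - g (-T)| + |g y - g (-T)| + |g y| := by
      have e : g x = (g x - g (-T)) - (g y - g (-T)) + g y := by ring
      calc |g x| = |(g x - g (-T)) - (g y - g (-T)) + g y| := by rw [← e]
        _ ≤ |(g x - g (-T)) - (g y - g (-T))| + |g y| := abs_add_le _ _
        _ ≤ _ := by gcongr; exact abs_sub _ _
    linarith
  set B := 2 * M + (T + Q) / T with hB
  have hbd : ∀ x ∈ Icc (-T) (0:ℝ), |g x| ≤ B := by
    intro x hx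
    have h1 : ∫ y in Icc (-T) 0, |g x| ≤ ∫ y in Icc (-T) 0, (2 * M + |g y|) := by
      refine setIntegral_mono_on (integrableOn_const (by simp))
        ((integrableOn_const (by simp)).add hgi) measurableSet_Icc (fun y hy => hosc x hx y hy)
    rw [integral_add (integrable_const _) hgi] at h1
    simp only [integral_const, Measure.real, Measure.restrict_apply_univ, hvol,
      smul_eq_mul] at h1
    have h2 : |g x| * T ≤ 2 * M * T + (T + Q) := by nlinarith
    have h3 : |g x| ≤ (2 * M * T + (T + Q)) / T := by rwa [le_div_iff₀ hT]
    rw [hB]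
    have : (2 * M * T + (T + Q)) / T = 2 * M + (T + Q) / T := by field_simp
    linarith
  have hB0 : 0 ≤ B := (abs_nonneg _).trans (hbd 0 ⟨by linarith, le_rfl⟩)
  have hQ0 : 0 ≤ Q := by linarith
  set a := sSup S with ha
  let μ : Measure ℝ := (volume.restrict (Icc (-T) 0)).withDensity (fun x => ENNReal.ofReal |f x|)
    + ENNReal.ofReal M • Measure.dirac a + ENNReal.ofReal B • Measure.dirac (-T)
    + ENNReal.ofReal B • Measure.dirac 0
  have hdens : ∀ x y, x ≤ y → x ∈ Icc (-T) (0:ℝ) → y ∈ Icc (-T) (0:ℝ) →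
      (volume.restrict (Icc (-T) 0)).withDensity (fun x => ENNReal.ofReal |f x|) (Icc x y)
        = ENNReal.ofReal (∫ z in Icc x y, |f z|) := by
    intro x y hxy hx hy
    have hss : Icc x y ⊆ Icc (-T) 0 := Icc_subset_Icc hx.1 hy.2
    rw [withDensity_apply _ measurableSet_Icc, Measure.restrict_restrict measurableSet_Icc,
      inter_eq_self_of_subset_left hss,
      ofReal_integral_eq_lintegral_ofReal (hfi.mono_set hss) (ae_of_all _ fun x => abs_nonneg _)]
  have htot : (volume.restrict (Icc (-T) 0)).withDensity (fun x => ENNReal.ofReal |f x|) univ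
        = ENNReal.ofReal M := by
    rw [withDensity_apply _ MeasurableSet.univ, Measure.restrict_univ,
      ofReal_integral_eq_lintegral_ofReal hfi (ae_of_all _ fun x => abs_nonneg _)]
  have hμ : μ univ = ENNReal.ofReal (2 * M + 2 * B) := by
    simp only [μ, Measure.add_apply, Measure.smul_apply, htot, measure_univ, smul_eq_mul, mul_one]
    rw [← ENNReal.ofReal_add hM0 hM0, ← ENNReal.ofReal_add (by positivity) hB0,
      ← ENNReal.ofReal_add (by positivity) hB0]
    congr 1; ring
  have : IsFiniteMeasure μ := ⟨by rw [hμ]; exact ENNReal.ofReal_lt_top⟩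
  have hmem : ∀ (c w : ℝ) (x y : ℝ), c ∈ Icc x y →
      (ENNReal.ofReal w • Measure.dirac c) (Icc x y) = ENNReal.ofReal w := by
    intro c w x y hc
    rw [Measure.smul_apply, Measure.dirac_apply' _ measurableSet_Icc, indicator_of_mem hc]
    simp
  have hmain : ∀ x y, x ≤ y → ENNReal.ofReal |G y - G x| ≤ μ (Icc x y) := by
    intro x y hxy
    have p1 : ENNReal.ofReal B • Measure.dirac (-T) ≤ μ :=
      le_trans (Measure.le_add_left le_rfl) (Measure.le_add_right le_rfl)
    have p2 : ENNReal.ofReal B • Measure.dirac 0 ≤ μ := Measure.le_add_left le_rfl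
    have p3 : ENNReal.ofReal M • Measure.dirac a ≤ μ :=
      le_trans (Measure.le_add_left le_rfl)
        (le_trans (Measure.le_add_right le_rfl) (Measure.le_add_right le_rfl))
    have p4 : (volume.restrict (Icc (-T) 0)).withDensity (fun x => ENNReal.ofReal |f x|) ≤ μ :=
      le_trans (Measure.le_add_right le_rfl)
        (le_trans (Measure.le_add_right le_rfl) (Measure.le_add_right le_rfl))
    by_cases hx : x ∈ Icc (-T) (0:ℝ) <;> by_cases hy : y ∈ Icc (-T) (0:ℝ)
    · rw [show G x = g x from indicator_of_mem hx g, show G y = g y from indicator_of_mem hy g]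
      by_cases hyS : y ∈ S
      · have hxS := hSdown x y hxy hx hyS
        refine le_trans ?_ (p4 (Icc x y))
        rw [hdens x y hxy hx hy]
        exact ENNReal.ofReal_le_ofReal (hboth x y hxy hxS hyS)
      · by_cases hxS : x ∈ S
        · have hbdd : BddAbove S := ⟨0, fun z hz => hz.1.2⟩
          have haxy : a ∈ Icc x y := by
            refine ⟨le_csSup hbdd hxS, csSup_le ⟨x, hxS⟩ fun z hz => ?_⟩
            by_contra hlt
            exact hyS (hSdown y z (not_le.mp hlt).le hy hz)
          refine le_trans ?_ (p3 (Icc x y))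
          rw [hmem a M x y haxy, hnotS y hy hyS, abs_sub_comm]
          exact ENNReal.ofReal_le_ofReal (hSM x hx)
        · rw [hnotS y hy hyS, hnotS x hx hxS]; simp
    · have hy0 : 0 < y := by
        by_contra h; exact hy ⟨hx.1.trans hxy, not_lt.mp h⟩
      rw [show G x = g x from indicator_of_mem hx g, show G y = 0 from indicator_of_notMem hy g]
      refine le_trans ?_ (p2 (Icc x y))
      rw [hmem 0 B x y ⟨hx.2, hy0.le⟩, zero_sub, abs_neg]
      exact ENNReal.ofReal_le_ofReal (hbd x hx)
    · have hx0 : x < -T := by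
        by_contra h; exact hx ⟨not_lt.mp h, hxy.trans hy.2⟩
      rw [show G y = g y from indicator_of_mem hy g, show G x = 0 from indicator_of_notMem hx g]
      refine le_trans ?_ (p1 (Icc x y))
      rw [hmem (-T) B x y ⟨hx0.le, hy.1⟩, sub_zero]
      exact ENNReal.ofReal_le_ofReal (hbd y hy)
    · rw [show G x = 0 from indicator_of_notMem hx g, show G y = 0 from indicator_of_notMem hy g]
      simp
  have hTQ : 0 ≤ (T + Q) / T := by positivity
  obtain ⟨hmeas, hlip⟩ := aux_l1_lip_of_measure μ G (fun x y hxy =>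
    (ENNReal.ofReal_le_iff_le_toReal (measure_ne_top _ _)).mp (hmain x y hxy))
  refine ⟨hmeas, fun x => ?_, fun ε hε => ?_⟩
  · by_cases hx : x ∈ Icc (-T) (0:ℝ)
    · rw [show G x = g x from indicator_of_mem hx g]
      refine (hbd x hx).trans ?_
      simp only [K, hB]; linarith
    · rw [show G x = 0 from indicator_of_notMem hx g, abs_zero]
      simp only [K]; positivity
  · refine (hlip ε hε).trans ?_
    rw [hμ, ENNReal.toReal_ofReal (by positivity)]
    gcongr
    simp only [K, hB]; linarith


lemma aux_shift_bound (T : ℝ) (g h : ℝ → ℝ) (hg : Integrable g) (hh : Continuous h)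
    (M K : ℝ) (hM : ∀ x, |h x| ≤ M)
    (hK : ∀ ε > 0, ∫ x, |g (x + ε) - g x| ≤ K * ε) (r s : ℝ) (hrs : r < s) :
    |∫ x, g x * (h (x + T - r) - h (x + T - s))| ≤ K * M * (s - r) := by
  have hM0 : 0 ≤ M := (abs_nonneg _).trans (hM 0)
  have hb : ∀ c : ℝ, ∀ g' : ℝ → ℝ, Integrable g' → Integrable (fun x => g' x * h (x + T - c)) := by
    intro c g' hg'
    refine hg'.mul_bdd (c := M) ?_ (ae_of_all _ fun x => hM _)
    exact (by fun_prop : Continuous fun x => h (x + T - c)).aestronglyMeasurable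
  have hgs : Integrable (fun x => g (x + (s - r))) := hg.comp_add_right (s - r)
  have e1 : ∫ x, g x * h (x + T - s) = ∫ x, g (x + (s - r)) * h (x + T - r) := by
    rw [← integral_add_right_eq_self (fun x => g x * h (x + T - s)) (s - r)]
    congr 1; ext x; congr 2; ring
  have e2 : ∫ x, g x * (h (x + T - r) - h (x + T - s))
      = ∫ x, (g x - g (x + (s - r))) * h (x + T - r) := by
    simp_rw [mul_sub, sub_mul]
    rw [integral_sub (hb r g hg) (hb s g hg), integral_sub (hb r g hg) (hb r _ hgs), e1]
  rw [e2]
  calc |∫ x, (g x - g (x + (s - r))) * h (x + T - r)|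
      ≤ ∫ x, |(g x - g (x + (s - r))) * h (x + T - r)| := abs_integral_le_integral_abs
    _ ≤ ∫ x, |g (x + (s - r)) - g x| * M := by
        refine integral_mono ((hb r _ (hg.sub hgs)).abs) ((hgs.sub hg).abs.mul_const M) fun x => ?_
        simp only [abs_mul]
        rw [abs_sub_comm]
        gcongr
        exact hM _
    _ = (∫ x, |g (x + (s - r)) - g x|) * M := integral_mul_const _ _
    _ ≤ K * (s - r) * M := by gcongr; exact hK _ (by linarith)
    _ = _ := by ring

/-- Convergence of the symmetric difference quotients, in approximate form. -/
lemma aux_forward_approx (T t : ℝ) (g η : ℝ → ℝ) (hg : Integrable g)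
    (hη : UniformContinuous η) (M K : ℝ) (hM : ∀ x, |η x| ≤ M)
    (hK0 : 0 ≤ K)
    (hK : ∀ ε > 0, ∫ x, |g (x + ε) - g x| ≤ K * ε) (e : ℝ) (he : 0 < e) :
    ∃ I : ℝ, ∀ (l : Filter ℝ) [l.IsCountablyGenerated] (r s : ℝ → ℝ) (G : ℝ → ℝ → ℝ),
      Tendsto r l (𝓝 t) → Tendsto s l (𝓝 t) → (∀ᶠ i in l, r i < s i) →
      (∀ᶠ i in l, Integrable (G i)) →
      (∀ᶠ i in l, ∀ ε > 0, ∫ x, |G i (x + ε) - G i x| ≤ K * ε) →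
      Tendsto (fun i => ∫ x, |G i x - g x|) l (𝓝 0) →
      ∀ᶠ i in l, |(∫ x, G i x * (η (x + T - r i) - η (x + T - s i))) / (s i - r i) - I| ≤ e := by
  have hcη : Continuous η := hη.continuous
  have hM0 : 0 ≤ M := (abs_nonneg _).trans (hM 0)
  -- mollification
  obtain ⟨δ, hδ, hδη⟩ := Metric.uniformContinuous_iff.mp hη (e / (4 * (K + 1))) (by positivity)
  set d := δ / 2 with hd
  have hd0 : 0 < d := by positivity
  have hIntg : ∀ a b, IntervalIntegrable η volume a b := fun a b => hcη.intervalIntegrable a b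
  set h : ℝ → ℝ := fun x => (∫ y in x..(x + d), η y) / d with hh
  set h' : ℝ → ℝ := fun x => (η (x + d) - η x) / d with hh'
  have hder : ∀ x, HasDerivAt h (h' x) x := by
    intro x
    have h1 : HasDerivAt (fun x => ∫ y in (0:ℝ)..x, η y) (η x) x :=
      (hcη.integral_hasStrictDerivAt 0 x).hasDerivAt
    have h2 : HasDerivAt (fun x => ∫ y in (0:ℝ)..(x + d), η y) (η (x + d)) x := by
      have := (hcη.integral_hasStrictDerivAt 0 (x + d)).hasDerivAt
      exact HasDerivAt.comp_add_const x d this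
    have h3 := (h2.sub h1).div_const d
    refine h3.congr_of_eventuallyEq (Eventually.of_forall fun y => ?_)
    simp only [hh, Pi.sub_apply]
    rw [intervalIntegral.integral_interval_sub_left (hIntg _ _) (hIntg _ _)]
  have hcont : Continuous h := continuous_iff_continuousAt.mpr fun x => (hder x).continuousAt
  have hch' : Continuous h' := by simp only [hh']; fun_prop
  set L := 2 * M / d with hL
  have hh'L : ∀ x, |h' x| ≤ L := by
    intro x
    simp only [hh', hL, abs_div, abs_of_pos hd0]
    gcongr
    have := abs_sub (η (x + d)) (η x)
    linarith [hM (x + d), hM x]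
  have hL0 : 0 ≤ L := by positivity
  have hlip : ∀ x y, |h y - h x| ≤ L * |y - x| := by
    intro x y
    have := Convex.norm_image_sub_le_of_norm_hasDerivWithin_le (s := univ) (C := L)
      (fun z _ => (hder z).hasDerivWithinAt) (fun z _ => hh'L z) convex_univ (mem_univ x)
      (mem_univ y)
    simpa using this
  have hclose : ∀ x, |η x - h x| ≤ e / (4 * (K + 1)) := by
    intro x
    have e1 : η x - h x = (∫ y in x..(x + d), (η x - η y)) / d := by
      rw [intervalIntegral.integral_sub (by simp) (hIntg _ _)]
      simp only [hh, intervalIntegral.integral_const, add_sub_cancel_left, smul_eq_mul]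
      field_simp
    rw [e1, abs_div, abs_of_pos hd0, div_le_iff₀ hd0]
    have := intervalIntegral.norm_integral_le_of_norm_le_const (a := x) (b := x + d)
      (f := fun y => η x - η y) (C := e / (4 * (K + 1))) (fun y hy => by
        rw [uIoc_of_le (by linarith)] at hy
        have : dist x y < δ := by
          rw [Real.dist_eq, abs_sub_comm, abs_of_nonneg (by linarith [hy.1])]
          linarith [hy.2]
        exact (hδη this).le)
    simpa [abs_of_pos hd0] using this
  refine ⟨∫ x, g x * h' (x + T - t), fun l _ r s G hr hs hrs hGi hGK hG => ?_⟩
  -- convergence of the mollified quotients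
  have hconv : Tendsto (fun i => ∫ x, g x * ((h (x + T - r i) - h (x + T - s i)) / (s i - r i))) l
      (𝓝 (∫ x, g x * h' (x + T - t))) := by
    refine tendsto_integral_filter_of_dominated_convergence (fun x => |g x| * L) ?_ ?_ ?_ ?_
    · refine Eventually.of_forall fun i => ?_
      refine hg.aestronglyMeasurable.mul ?_
      exact (by fun_prop : Continuous fun x =>
        (h (x + T - r i) - h (x + T - s i)) / (s i - r i)).aestronglyMeasurable
    · filter_upwards [hrs] with i hi
      refine ae_of_all _ fun x => ?_
      rw [Real.norm_eq_abs, abs_mul]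
      gcongr
      rw [abs_div, abs_of_pos (by linarith : 0 < s i - r i), div_le_iff₀ (by linarith)]
      refine (hlip _ _).trans (le_of_eq ?_)
      congr 1
      rw [show x + T - r i - (x + T - s i) = s i - r i by ring, abs_of_pos (by linarith)]
    · exact hg.abs.mul_const L
    · refine ae_of_all _ fun x => Tendsto.const_mul _ ?_
      -- strict derivative
      have hsd : HasStrictDerivAt h (h' (x + T - t)) (x + T - t) :=
        hasStrictDerivAt_of_hasDerivAt_of_continuousAt (Eventually.of_forall hder) hch'.continuousAt
      have h1 : Tendsto (fun i => (x + T - r i, x + T - s i)) l (𝓝 (x + T - t, x + T - t)) :=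
        (tendsto_const_nhds.sub hr).prodMk_nhds (tendsto_const_nhds.sub hs)
      have h2 := (hasStrictFDerivAt_iff_isLittleO.mp hsd.hasStrictFDerivAt).comp_tendsto h1
      have h3 := h2.tendsto_div_nhds_zero
      have h4 := h3.add_const (h' (x + T - t))
      rw [zero_add] at h4
      refine h4.congr' ?_
      filter_upwards [hrs] with i hi
      have : s i - r i ≠ 0 := (sub_pos.mpr hi).ne'
      simp only [Function.comp_apply]
      rw [show x + T - r i - (x + T - s i) = s i - r i by ring]
      simp only [ContinuousLinearMap.toSpanSingleton_apply, smul_eq_mul]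
      field_simp
      ring
  have hev := (Metric.tendsto_nhds.mp hconv) (e / 4) (by positivity)
  have hG' := (Metric.tendsto_nhds.mp (hG.const_mul L)) (e / 4) (by positivity)
  filter_upwards [hrs, hGi, hGK, hev, hG'] with i hi hGi hGK h1 h2
  have hpos : 0 < s i - r i := by linarith
  rw [Real.dist_eq] at h1
  rw [Real.dist_eq, mul_zero, sub_zero] at h2
  have hLg : ∀ (G : ℝ → ℝ) (k : ℝ → ℝ) (B : ℝ), Integrable G → Continuous k → (∀ x, |k x| ≤ B) →
      Integrable (fun x => G x * k x) := fun G k B hG hk hB =>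
    hG.mul_bdd (c := B) hk.aestronglyMeasurable (ae_of_all _ hB)
  have hhM : ∀ x, |h x| ≤ M + e / (4 * (K + 1)) := by
    intro x
    have e1 : h x = η x - (η x - h x) := by ring
    rw [e1]
    exact (abs_sub _ _).trans (add_le_add (hM x) (hclose x))
  -- term 1
  have t1 := aux_shift_bound T (G i) (fun x => η x - h x) hGi (by fun_prop) _ K hclose hGK _ _ hi
  -- decomposition
  have ia : Integrable (fun x => G i x * ((η (x + T - r i) - h (x + T - r i))
      - (η (x + T - s i) - h (x + T - s i)))) :=
    hLg _ _ (e / (4 * (K + 1)) + e / (4 * (K + 1))) hGi (by fun_prop) fun x =>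
      (abs_sub _ _).trans (add_le_add (hclose _) (hclose _))
  have hhd : ∀ x, |h (x + T - r i) - h (x + T - s i)| ≤ L * (s i - r i) := by
    intro x
    refine (hlip _ _).trans (le_of_eq ?_)
    congr 1
    rw [show x + T - r i - (x + T - s i) = s i - r i by ring, abs_of_pos (by linarith)]
  have ib : Integrable (fun x => (G i x - g x) * (h (x + T - r i) - h (x + T - s i))) :=
    hLg _ _ _ (hGi.sub hg) (by fun_prop) hhd
  have ic : Integrable (fun x => g x * (h (x + T - r i) - h (x + T - s i))) :=
    hLg _ _ _ hg (by fun_prop) hhd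
  have dec : ∫ x, G i x * (η (x + T - r i) - η (x + T - s i)) =
      (∫ x, G i x * ((η (x + T - r i) - h (x + T - r i)) - (η (x + T - s i) - h (x + T - s i)))) +
      (∫ x, (G i x - g x) * (h (x + T - r i) - h (x + T - s i))) +
      ∫ x, g x * (h (x + T - r i) - h (x + T - s i)) := by
    have iab := ia.add ib
    have e1 := integral_add ia ib
    have e2 := integral_add iab ic
    simp only [Pi.add_apply] at e1 e2
    rw [← e1, ← e2]
    congr 1; ext x
    ring
  have t2 : |∫ x, (G i x - g x) * (h (x + T - r i) - h (x + T - s i))| ≤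
      (L * ∫ x, |G i x - g x|) * (s i - r i) := by
    calc _ ≤ ∫ x, |(G i x - g x) * (h (x + T - r i) - h (x + T - s i))| :=
          abs_integral_le_integral_abs
      _ ≤ ∫ x, |G i x - g x| * (L * (s i - r i)) := by
          refine integral_mono ib.abs ((hGi.sub hg).abs.mul_const _) fun x => ?_
          simp only [abs_mul]
          gcongr
          exact hhd x
      _ = _ := by rw [integral_mul_const]; ring
  have t3 : (∫ x, g x * (h (x + T - r i) - h (x + T - s i))) / (s i - r i) =
      ∫ x, g x * ((h (x + T - r i) - h (x + T - s i)) / (s i - r i)) := by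
    rw [← integral_div]
    congr 1; ext x; ring
  have hK1 : K * (e / (4 * (K + 1))) ≤ e / 4 := by
    have : K * (e / (4 * (K + 1))) = e / 4 * (K / (K + 1)) := by field_simp
    rw [this]
    have : K / (K + 1) ≤ 1 := by rw [div_le_one (by linarith)]; linarith
    nlinarith
  rw [dec, add_div, add_div, t3]
  have b1 : |(∫ x, G i x * ((η (x + T - r i) - h (x + T - r i))
      - (η (x + T - s i) - h (x + T - s i)))) / (s i - r i)| ≤ e / 4 := by
    rw [abs_div, abs_of_pos hpos, div_le_iff₀ hpos]
    exact t1.trans (by gcongr)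
  have b2 : |(∫ x, (G i x - g x) * (h (x + T - r i) - h (x + T - s i))) / (s i - r i)| ≤ e / 4 := by
    rw [abs_div, abs_of_pos hpos, div_le_iff₀ hpos]
    refine t2.trans ?_
    gcongr
    exact (le_abs_self _).trans h2.le
  rw [add_sub_assoc]
  refine (abs_add_le _ _).trans ?_
  have := abs_add_le ((∫ x, G i x * ((η (x + T - r i) - h (x + T - r i))
      - (η (x + T - s i) - h (x + T - s i)))) / (s i - r i))
      ((∫ x, (G i x - g x) * (h (x + T - r i) - h (x + T - s i))) / (s i - r i))
  linarith

lemma aux_forward (T t : ℝ) (g η : ℝ → ℝ) (hg : Integrable g)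
    (hη : UniformContinuous η) (M K : ℝ) (hM : ∀ x, |η x| ≤ M)
    (hK0 : 0 ≤ K)
    (hK : ∀ ε > 0, ∫ x, |g (x + ε) - g x| ≤ K * ε) :
    ∃ J : ℝ, ∀ (l : Filter ℝ) [l.IsCountablyGenerated] (r s : ℝ → ℝ) (G : ℝ → ℝ → ℝ),
      Tendsto r l (𝓝 t) → Tendsto s l (𝓝 t) → (∀ᶠ i in l, r i < s i) →
      (∀ᶠ i in l, Integrable (G i)) →
      (∀ᶠ i in l, ∀ ε > 0, ∫ x, |G i (x + ε) - G i x| ≤ K * ε) →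
      Tendsto (fun i => ∫ x, |G i x - g x|) l (𝓝 0) →
      Tendsto (fun i => (∫ x, G i x * (η (x + T - r i) - η (x + T - s i))) / (s i - r i)) l
        (𝓝 J) := by
  have hA := aux_forward_approx T t g η hg hη M K hM hK0 hK
  choose! I hI using hA
  have hcomp : ∀ e e' : ℝ, 0 < e → 0 < e' → |I e - I e'| ≤ e + e' := by
    intro e e' he he'
    have hr : Tendsto (fun ε : ℝ => t - ε) (𝓝[>] 0) (𝓝 t) := by
      have : Tendsto (fun ε : ℝ => t - ε) (𝓝 0) (𝓝 (t - 0)) := by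
        exact tendsto_const_nhds.sub tendsto_id
      rw [sub_zero] at this
      exact this.mono_left nhdsWithin_le_nhds
    have h0 : ∀ᶠ ε : ℝ in 𝓝[>] 0, t - ε < t := by
      filter_upwards [self_mem_nhdsWithin] with ε hε
      have : 0 < ε := hε
      linarith
    have h1 := hI e he (𝓝[>] 0) (fun ε => t - ε) (fun _ => t) (fun _ => g) hr
      tendsto_const_nhds h0 (by simp [hg]) (by simpa using hK) (by simp)
    have h2 := hI e' he' (𝓝[>] 0) (fun ε => t - ε) (fun _ => t) (fun _ => g) hr
      tendsto_const_nhds h0 (by simp [hg]) (by simpa using hK) (by simp)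
    obtain ⟨ε, h1, h2⟩ := (h1.and h2).exists
    rw [abs_le] at *
    constructor <;> linarith [h1.1, h1.2, h2.1, h2.2]
  set a : ℕ → ℝ := fun n => I (1 / ((n:ℝ) + 1)) with ha
  have hpos : ∀ n : ℕ, 0 < 1 / ((n:ℝ) + 1) := fun n => by positivity
  have hlim : Tendsto (fun n : ℕ => 1 / ((n:ℝ) + 1)) atTop (𝓝 0) :=
    tendsto_one_div_add_atTop_nhds_zero_nat
  have hcau : CauchySeq a := by
    refine Metric.cauchySeq_iff.mpr fun e he => ?_
    obtain ⟨N, hN⟩ := (hlim.eventually (gt_mem_nhds (by positivity : 0 < e / 2))).exists_forall_of_atTop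
    refine ⟨N, fun m hm n hn => ?_⟩
    rw [Real.dist_eq]
    refine (hcomp _ _ (hpos m) (hpos n)).trans_lt ?_
    linarith [hN m hm, hN n hn]
  obtain ⟨J, hJ⟩ := cauchySeq_tendsto_of_complete hcau
  have hIJ : ∀ e > 0, |I e - J| ≤ e := by
    intro e he
    have h1 : Tendsto (fun n => |I e - a n|) atTop (𝓝 |I e - J|) :=
      (tendsto_const_nhds.sub hJ).abs
    have h2 : Tendsto (fun n : ℕ => e + 1 / ((n:ℝ) + 1)) atTop (𝓝 (e + 0)) := hlim.const_add e
    rw [add_zero] at h2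
    exact le_of_tendsto_of_tendsto' h1 h2 fun n => hcomp _ _ he (hpos n)
  refine ⟨J, fun l _ r s G h1 h2 h3 h4 h5 h6 => ?_⟩
  refine Metric.tendsto_nhds.mpr fun e he => ?_
  filter_upwards [hI (e / 4) (by positivity) l r s G h1 h2 h3 h4 h5 h6] with i hi
  rw [Real.dist_eq]
  have := hIJ (e / 4) (by positivity)
  rw [abs_le] at *
  rw [abs_lt]
  constructor <;> linarith [hi.1, hi.2, this.1, this.2]


lemma aux_gauss_int (v : NNReal) (n : ℕ) : Integrable (fun x : ℝ => x ^ n) (gaussianReal 0 v) := by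
  have h := (memLp_id_gaussianReal (μ := 0) (v := v) (n : NNReal)).integrable_norm_pow'
  refine h.mono' (by fun_prop) (ae_of_all _ fun x => ?_)
  simp

lemma aux_gauss_s18 (m : ℕ) : ∃ c : ℝ, 0 ≤ c ∧ ∀ d : ℝ, 0 ≤ d →
    ∫ x, x ^ (2 * m) ∂(gaussianReal 0 d.toNNReal) = c * d ^ m := by
  refine ⟨∫ x, x ^ (2 * m) ∂(gaussianReal 0 1), integral_nonneg fun x => ?_, fun d hd => ?_⟩
  · rw [pow_mul]; positivity
  have h := gaussianReal_map_const_mul (μ := 0) (v := 1) (Real.sqrt d)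
  have e : NNReal.mk (Real.sqrt d ^ 2) (sq_nonneg _) * 1 = d.toNNReal := by
    ext
    simp [Real.sq_sqrt hd, hd]
  rw [mul_zero, e] at h
  rw [← h, integral_map (by fun_prop) (by fun_prop)]
  simp_rw [mul_pow]
  rw [integral_const_mul, pow_mul (Real.sqrt d), Real.sq_sqrt hd, mul_comm]

lemma aux_chain_s18 (T : ℝ) (hT : 0 < T) (f : ℝ → ℝ) (hf : Continuous f) (h0 : f 0 = 0) (q : ℝ)
    (hq : 0 ≤ q)
    (h : ∀ j k : ℕ, k < 2 ^ j →
      |f (((k:ℝ) + 1) * T / 2 ^ j) - f ((k:ℝ) * T / 2 ^ j)| ≤ q * (3 / 4) ^ j) :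
    ∀ x ∈ Icc 0 T, |f x| ≤ 4 * q := by
  have hind : ∀ n : ℕ, ∀ k : ℕ, k ≤ 2 ^ n →
      |f ((k:ℝ) * T / 2 ^ n)| ≤ q * ((4 : ℝ) - 3 * (3 / 4) ^ n) := by
    intro n
    induction n with
    | zero =>
      intro k hk
      have : k = 0 ∨ k = 1 := by simp at hk; omega
      rcases this with rfl | rfl
      · simp [h0]; linarith
      · have := h 0 0 (by simp)
        simp [h0] at this
        simpa using (this.trans (by linarith))
    | succ n ih =>
      intro k hk
      rcases Nat.even_or_odd' k with ⟨c, rfl | rfl⟩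
      · have hc : c ≤ 2 ^ n := by rw [pow_succ] at hk; omega
        have e : ((2 * c : ℕ) : ℝ) * T / 2 ^ (n + 1) = (c:ℝ) * T / 2 ^ n := by
          push_cast; rw [pow_succ]; field_simp
        rw [e]
        refine (ih c hc).trans ?_
        gcongr q * (4 - 3 * ?_)
        rw [pow_succ]
        have : (0:ℝ) < (3 / 4) ^ n := by positivity
        linarith
      · have hc : c ≤ 2 ^ n := by rw [pow_succ] at hk; omega
        have e : ((2 * c : ℕ) : ℝ) * T / 2 ^ (n + 1) = (c:ℝ) * T / 2 ^ n := by
          push_cast; rw [pow_succ]; field_simp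
        have h1 := h (n + 1) (2 * c) (by omega)
        rw [e] at h1
        have h2 := ih c hc
        push_cast at h1 ⊢
        have h3 := abs_sub_abs_le_abs_sub (f ((2 * (c:ℝ) + 1) * T / 2 ^ (n + 1))) (f ((c:ℝ) * T / 2 ^ n))
        have h4 : q * (4 - 3 * (3 / 4) ^ n) + q * (3 / 4) ^ (n + 1)
            = q * ((4 : ℝ) - 3 * (3 / 4) ^ (n + 1)) := by
          rw [pow_succ]; ring
        linarith
  intro x hx
  have hlim : Tendsto (fun n : ℕ => ((⌊x / T * 2 ^ n⌋₊ : ℕ) : ℝ) * T / 2 ^ n) atTop (𝓝 x) := by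
    have h1 : Tendsto (fun n : ℕ => (2:ℝ) ^ n) atTop atTop :=
      tendsto_pow_atTop_atTop_of_one_lt (by norm_num)
    have h2 := (tendsto_nat_floor_mul_div_atTop (R := ℝ) (a := x / T)
      (div_nonneg hx.1 hT.le)).comp h1
    have h3 := h2.mul_const T
    rw [div_mul_cancel₀ _ hT.ne'] at h3
    refine h3.congr fun n => ?_
    simp only [Function.comp]
    ring
  have hl := (hf.abs.tendsto x).comp hlim
  refine le_of_tendsto hl (Eventually.of_forall fun n => ?_)
  have : ⌊x / T * 2 ^ n⌋₊ ≤ 2 ^ n := by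
    refine Nat.floor_le_of_le ?_
    push_cast
    have : x / T ≤ 1 := (div_le_one hT).mpr hx.2
    have h2 : (0:ℝ) < 2 ^ n := by positivity
    nlinarith
  refine (hind n _ this).trans ?_
  have : (0:ℝ) < (3 / 4) ^ n := by positivity
  nlinarith

lemma aux_moments_s18 (T : ℝ) (hT : 0 < T)
    {Ω : Type*} [MeasurableSpace Ω] (P : Measure Ω) [IsProbabilityMeasure P]
    (W : ℝ → Ω → ℝ)
    (hW_meas : ∀ s, Measurable (W s))
    (hW_cont : ∀ ω, Continuous fun s => W s ω)
    (hW_zero : ∀ ω, W 0 ω = 0)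
    (hW_incr : ∀ s t : ℝ, 0 ≤ s → s ≤ t →
      Measure.map (fun ω => W t ω - W s ω) P = gaussianReal 0 (Real.toNNReal (t - s)))
    (Wp : Ω → C(Set.Icc (-T) (0 : ℝ), ℝ)) (hWp : ∀ ω x, Wp ω x = W (T + x) ω) (n : ℕ) :
    Integrable (fun ω => (1 + ‖Wp ω‖) ^ n) P := by
  set m := n + 6 with hm
  obtain ⟨c, hc, hcd⟩ := aux_gauss_s18 m
  set D : ℕ → ℕ → Ω → ℝ := fun j k ω =>
    W (((k:ℝ) + 1) * T / 2 ^ j) ω - W ((k:ℝ) * T / 2 ^ j) ω with hD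
  have hDm : ∀ j k, Measurable (D j k) := fun j k => (hW_meas _).sub (hW_meas _)
  set F : ℕ → ℕ → Ω → ENNReal := fun j k ω => ENNReal.ofReal ((D j k ω / (3 / 4) ^ j) ^ (2 * m)) with hF
  set Q : Ω → ENNReal := fun ω => ∑' j, ∑ k ∈ Finset.range (2 ^ j), F j k ω with hQ
  have hFm : ∀ j k, Measurable (F j k) := fun j k =>
    (((hDm j k).div_const _).pow_const _).ennreal_ofReal
  have hQm : Measurable Q :=
    Measurable.ennreal_tsum fun j => Finset.measurable_sum _ fun k _ => hFm j k
  have hEF : ∀ j k, ∫⁻ ω, F j k ω ∂P = ENNReal.ofReal (c * (T ^ m) * ((8 / 9) ^ m) ^ j) := by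
    intro j k
    have hinc := hW_incr ((k:ℝ) * T / 2 ^ j) (((k:ℝ) + 1) * T / 2 ^ j) (by positivity)
      (by gcongr; linarith)
    have hd : ((k:ℝ) + 1) * T / 2 ^ j - (k:ℝ) * T / 2 ^ j = T / 2 ^ j := by ring
    rw [hd] at hinc
    have hIntg : Integrable (fun ω => (D j k ω) ^ (2 * m)) P := by
      have := aux_gauss_int (Real.toNNReal (T / 2 ^ j)) (2 * m)
      rw [← hinc] at this
      exact (integrable_map_measure (by fun_prop) (hDm j k).aemeasurable).mp this
    have hval : ∫ ω, (D j k ω) ^ (2 * m) ∂P = c * (T / 2 ^ j) ^ m := by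
      rw [← hcd (T / 2 ^ j) (by positivity), ← hinc, integral_map (hDm j k).aemeasurable (by fun_prop)]
    rw [← ofReal_integral_eq_lintegral_ofReal]
    · congr 1
      simp_rw [div_pow (D j k _)]
      rw [integral_div, hval]
      rw [div_pow, ← pow_mul, ← pow_mul, ← pow_mul, div_pow, div_pow]
      have e2 : (4:ℝ) ^ (j * (2 * m)) = 8 ^ (m * j) * 2 ^ (j * m) := by
        rw [mul_comm m j, ← mul_pow, show j * (2 * m) = 2 * (j * m) by ring, pow_mul]; norm_num
      have e3 : (9:ℝ) ^ (m * j) = 3 ^ (j * (2 * m)) := by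
        rw [show (9:ℝ) = 3 ^ 2 by norm_num, ← pow_mul]; congr 1; ring
      rw [e2, e3]
      field_simp
    · simp_rw [div_pow (D j k _)]
      exact hIntg.div_const _
    · refine ae_of_all _ fun ω => ?_
      simp only [Pi.zero_apply]
      rw [pow_mul]; positivity
  have hEQ : ∫⁻ ω, Q ω ∂P ≠ ⊤ := by
    rw [hQ, lintegral_tsum fun j => (Finset.measurable_sum _ fun k _ => hFm j k).aemeasurable]
    have : ∀ j, ∫⁻ ω, ∑ k ∈ Finset.range (2 ^ j), F j k ω ∂P
        = ENNReal.ofReal (c * T ^ m * (2 * (8 / 9) ^ m) ^ j) := by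
      intro j
      rw [lintegral_finsetSum _ fun k _ => hFm j k]
      simp_rw [hEF]
      rw [Finset.sum_const, Finset.card_range, ← ENNReal.ofReal_nsmul]
      congr 1
      rw [mul_pow]
      simp only [nsmul_eq_mul]
      push_cast
      ring
    simp_rw [this]
    have hlt : (2:ℝ) * (8 / 9) ^ m < 1 := by
      have : ((8:ℝ) / 9) ^ m ≤ (8 / 9) ^ 6 :=
        pow_le_pow_of_le_one (by norm_num) (by norm_num) (by omega)
      have h2 : (2:ℝ) * (8 / 9) ^ 6 < 1 := by norm_num
      linarith
    have hs : Summable fun j : ℕ => c * T ^ m * (2 * ((8:ℝ) / 9) ^ m) ^ j :=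
      (summable_geometric_of_lt_one (by positivity) hlt).mul_left _
    rw [← ENNReal.ofReal_tsum_of_nonneg (fun j => by positivity) hs]
    exact ENNReal.ofReal_ne_top
  have hQfin : ∀ᵐ ω ∂P, Q ω < ⊤ := ae_lt_top hQm hEQ
  have hQint : Integrable (fun ω => (Q ω).toReal) P :=
    integrable_toReal_of_lintegral_ne_top hQm.aemeasurable hEQ
  have hkey : ∀ᵐ ω ∂P, ‖Wp ω‖ ^ (2 * m) ≤ 4 ^ (2 * m) * (Q ω).toReal := by
    filter_upwards [hQfin] with ω hω
    have hm0 : (2 * m) ≠ 0 := by omega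
    set q := (Q ω).toReal ^ (((2 * m : ℕ) : ℝ)⁻¹) with hqd
    have hqp : q ^ (2 * m) = (Q ω).toReal := Real.rpow_inv_natCast_pow ENNReal.toReal_nonneg hm0
    have hq0 : 0 ≤ q := by positivity
    rw [← hqp, ← mul_pow]
    refine pow_le_pow_left₀ (norm_nonneg _) ?_ _
    rw [ContinuousMap.norm_le _ (by positivity)]
    intro x
    rw [hWp, Real.norm_eq_abs]
    refine aux_chain_s18 T hT (fun s => W s ω) (hW_cont ω) (hW_zero ω) q hq0 ?_ (T + x)
      ⟨by linarith [x.2.1], by linarith [x.2.2]⟩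
    intro j k hk
    have h1 : F j k ω ≤ Q ω :=
      (Finset.single_le_sum (f := fun k => F j k ω) (fun _ _ => zero_le) (Finset.mem_range.mpr hk)).trans
        (ENNReal.le_tsum j)
    have h2 := ENNReal.toReal_mono hω.ne h1
    rw [hF, ENNReal.toReal_ofReal (by rw [pow_mul]; positivity), ← hqp] at h2
    have h3 := abs_le_of_sq_le_sq' (a := (D j k ω / (3 / 4) ^ j)^m) (b := q^m) (by rw [← pow_mul, ← pow_mul, mul_comm m 2]; exact h2) (by positivity)
    have h4 : |D j k ω / (3 / 4) ^ j| ^ (2 * m) ≤ q ^ (2 * m) := by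
      rw [(even_two_mul m).pow_abs]; exact h2
    have h5 := le_of_pow_le_pow_left₀ hm0 hq0 h4
    rw [abs_div, abs_of_pos (by positivity : (0:ℝ) < (3 / 4) ^ j), div_le_iff₀ (by positivity)] at h5
    exact h5
  have hnm : Measurable fun ω => ‖Wp ω‖ := by
    letI : MeasurableSpace C(Set.Icc (-T) (0 : ℝ), ℝ) := borel _
    haveI : BorelSpace C(Set.Icc (-T) (0 : ℝ), ℝ) := ⟨rfl⟩
    have : Measurable Wp := aux_measurable_of_eval Wp fun x => by
      simp_rw [hWp]; exact hW_meas _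
    exact this.norm
  refine Integrable.mono' (g := fun ω => 2 ^ (2 * m - 1) * (1 + 4 ^ (2 * m) * (Q ω).toReal))
    (((integrable_const _).add (hQint.const_mul _)).const_mul _)
    ((hnm.const_add 1).pow_const n).aestronglyMeasurable ?_
  filter_upwards [hkey] with ω hω
  rw [Real.norm_of_nonneg (by positivity)]
  calc (1 + ‖Wp ω‖) ^ n ≤ (1 + ‖Wp ω‖) ^ (2 * m) :=
        pow_le_pow_right₀ (by linarith [norm_nonneg (Wp ω)]) (by omega)
    _ ≤ 2 ^ (2 * m - 1) * (1 ^ (2 * m) + ‖Wp ω‖ ^ (2 * m)) :=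
        add_pow_le zero_le_one (norm_nonneg _) _
    _ ≤ _ := by rw [one_pow]; gcongr


lemma aux_indep_sup {Ω : Type*} {mΩ : MeasurableSpace Ω} (P : Measure Ω) [IsProbabilityMeasure P]
    (m1 m2 m3 : MeasurableSpace Ω) (h1 : m1 ≤ mΩ) (h2 : m2 ≤ mΩ) (h3 : m3 ≤ mΩ)
    (h12 : Indep m1 m2 P) (h : Indep m3 (m1 ⊔ m2) P) : Indep m1 (m2 ⊔ m3) P := by
  set C : Set (Set Ω) := {s | ∃ a b, MeasurableSet[m2] a ∧ MeasurableSet[m3] b ∧ s = a ∩ b} with hC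
  have hgen : m2 ⊔ m3 = MeasurableSpace.generateFrom C := by
    refine le_antisymm (sup_le ?_ ?_) (MeasurableSpace.generateFrom_le ?_)
    · intro a ha
      exact MeasurableSpace.measurableSet_generateFrom ⟨a, univ, ha, @MeasurableSet.univ _ m3, by simp⟩
    · intro a ha
      exact MeasurableSpace.measurableSet_generateFrom ⟨univ, a, @MeasurableSet.univ _ m2, ha, by simp⟩
    · rintro _ ⟨a, b, ha, hb, rfl⟩
      exact @MeasurableSet.inter _ (m2 ⊔ m3) _ _ ((le_sup_left : m2 ≤ m2 ⊔ m3) a ha)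
        ((le_sup_right : m3 ≤ m2 ⊔ m3) b hb)
  have hpi : IsPiSystem C := by
    rintro _ ⟨a, b, ha, hb, rfl⟩ _ ⟨a', b', ha', hb', rfl⟩ _
    exact ⟨a ∩ a', b ∩ b', @MeasurableSet.inter _ m2 _ _ ha ha', @MeasurableSet.inter _ m3 _ _ hb hb',
      by ext; simp; tauto⟩
  refine IndepSets.indep h1 (sup_le h2 h3) (@MeasurableSpace.isPiSystem_measurableSet _ m1) hpi
    (@MeasurableSpace.generateFrom_measurableSet _ m1).symm hgen ?_
  rw [IndepSets_iff]
  rintro x _ hx ⟨a, b, ha, hb, rfl⟩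
  rw [Indep_iff] at h12 h
  have e1 := h12 x a hx ha
  have ha' : MeasurableSet[m1 ⊔ m2] a := (le_sup_right : m2 ≤ m1 ⊔ m2) a ha
  have hx' : MeasurableSet[m1 ⊔ m2] x := (le_sup_left : m1 ≤ m1 ⊔ m2) x hx
  have e2 := h b (x ∩ a) hb (@MeasurableSet.inter _ (m1 ⊔ m2) _ _ hx' ha')
  have e3 := h b a hb ha'
  rw [inter_comm a b, e3, show x ∩ (b ∩ a) = b ∩ (x ∩ a) by ext; simp; tauto, e2, e1]
  ring

lemma aux_indep {Ω : Type*} [mΩ : MeasurableSpace Ω] (P : Measure Ω) [IsProbabilityMeasure P]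
    (W : ℝ → Ω → ℝ) (hW_meas : ∀ s, Measurable (W s))
    (hW_indep : ∀ s t : ℝ, 0 ≤ s → s ≤ t →
      Indep (MeasurableSpace.comap (fun ω => W t ω - W s ω) inferInstance)
        (⨆ r ∈ Set.Icc (0 : ℝ) s, MeasurableSpace.comap (W r) inferInstance) P)
    (s : ℝ) (hs : 0 ≤ s) :
    Indep (⨆ r ∈ Set.Icc (0 : ℝ) s, MeasurableSpace.comap (W r) inferInstance)
      (⨆ F : Finset (Ici s), ⨆ v ∈ F,
        MeasurableSpace.comap (fun ω => W v ω - W s ω) inferInstance) P := by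
  set Fil : ℝ → MeasurableSpace Ω := fun s =>
    ⨆ r ∈ Set.Icc (0 : ℝ) s, MeasurableSpace.comap (W r) inferInstance with hFil
  have hFil_le : ∀ s, Fil s ≤ mΩ := fun s => iSup₂_le fun r _ => (hW_meas r).comap_le
  have hFil_mono : ∀ s t, s ≤ t → Fil s ≤ Fil t := fun s t hst =>
    biSup_mono fun r hr => ⟨hr.1, hr.2.trans hst⟩
  have hWF : ∀ r t, 0 ≤ r → r ≤ t → Measurable[Fil t] (W r) := by
    intro r t h0 hr
    refine Measurable.mono (comap_measurable (W r)) ?_ le_rfl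
    exact le_iSup₂ (f := fun r (_ : r ∈ Set.Icc (0 : ℝ) t) => MeasurableSpace.comap (W r) inferInstance)
      r ⟨h0, hr⟩
  set m : Finset (Ici s) → MeasurableSpace Ω := fun F => ⨆ v ∈ F,
        MeasurableSpace.comap (fun ω => W v ω - W s ω) inferInstance with hm
  have hcl : ∀ v, MeasurableSpace.comap (fun ω => W v ω - W s ω) inferInstance ≤ mΩ := fun v =>
    ((hW_meas v).sub (hW_meas s)).comap_le
  have hm_le : ∀ F, m F ≤ mΩ := fun F => iSup₂_le fun v _ => hcl _
  have hm_mono : Monotone m := fun F G hFG => biSup_mono fun v hv => hFG hv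
  refine (indep_iSup_of_directed_le (m := m) (m1 := Fil s) (fun F => ?_) hm_le (hFil_le s)
    hm_mono.directed_le).symm
  refine Indep.symm ?_
  induction F using Finset.induction_on_max with
  | empty => simp only [hm, Finset.notMem_empty, iSup_false, iSup_bot]; exact indep_bot_right _
  | insert a F ha ih =>
    obtain ⟨w, hw, hwmax⟩ := Finset.exists_max_image (insert (⟨s, self_mem_Ici⟩ : Ici s) F) id
      ⟨_, Finset.mem_insert_self _ _⟩
    have hsw : s ≤ w := w.2
    have hwa : (w : ℝ) ≤ a := by
      rcases Finset.mem_insert.mp hw with rfl | h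
      · exact a.2
      · exact (ha w h).le
    have hFle : m F ≤ Fil w := by
      refine iSup₂_le fun v hv => ?_
      have hvw : (v : ℝ) ≤ w := hwmax v (Finset.mem_insert_of_mem hv)
      have hsv : s ≤ v := v.2
      exact ((hWF v w (hs.trans hsv) hvw).sub (hWF s w hs hsw)).comap_le
    have hind := hW_indep w a (hs.trans hsw) hwa
    have h2 := aux_indep_sup P (Fil s) (m F) _ (hFil_le s) (hm_le F)
      ((hW_meas a).sub (hW_meas w)).comap_le ih
      (indep_of_indep_of_le_right hind (sup_le (hFil_mono _ _ hsw) hFle))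
    refine indep_of_indep_of_le_right h2 ?_
    refine iSup₂_le fun v hv => ?_
    rcases Finset.mem_insert.mp hv with rfl | hv
    · set mm : MeasurableSpace Ω := m F ⊔ MeasurableSpace.comap (fun ω => W v ω - W w ω) inferInstance
      have q1 : Measurable[mm] (fun ω => W v ω - W w ω) :=
        Measurable.mono (comap_measurable _) le_sup_right le_rfl
      have q2 : Measurable[mm] (fun ω => W w ω - W s ω) := by
        rcases Finset.mem_insert.mp hw with h | h
        · rw [h]; simp only [sub_self]; exact measurable_const
        · refine Measurable.mono (comap_measurable _) (le_trans ?_ le_sup_left) le_rfl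
          exact le_iSup₂ (f := fun (v : Ici s) (_ : v ∈ F) =>
            MeasurableSpace.comap (fun ω => W v ω - W s ω) inferInstance) w h
      have q3 : Measurable[mm] (fun ω => W v ω - W s ω) := by
        have := q1.add q2
        have e : (fun ω => W v ω - W s ω) = fun ω => (W v ω - W w ω) + (W w ω - W s ω) := by
          ext; ring
        rw [e]; exact this
      exact q3.comap_le
    · refine le_trans ?_ le_sup_left
      exact le_iSup₂ (f := fun (v : Ici s) (_ : v ∈ F) =>
            MeasurableSpace.comap (fun ω => W v ω - W s ω) inferInstance) v hv

lemma aux_indep_Y {Ω : Type*} [mΩ : MeasurableSpace Ω] (P : Measure Ω) [IsProbabilityMeasure P]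
    (W : ℝ → Ω → ℝ) (hW_meas : ∀ s, Measurable (W s))
    (hW_indep : ∀ s t : ℝ, 0 ≤ s → s ≤ t →
      Indep (MeasurableSpace.comap (fun ω => W t ω - W s ω) inferInstance)
        (⨆ r ∈ Set.Icc (0 : ℝ) s, MeasurableSpace.comap (W r) inferInstance) P)
    (r s : ℝ) (hr : 0 ≤ r) (hrs : r ≤ s)
    {X : Type*} [TopologicalSpace X] [CompactSpace X] [T2Space X] [SecondCountableTopology X]
    [MeasurableSpace C(X, ℝ)] [BorelSpace C(X, ℝ)] (Yf : Ω → C(X, ℝ))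
    (hY : ∀ x, ∃ c d v : ℝ, s ≤ v ∧ ∀ ω, Yf ω x = c + d * (W v ω - W s ω)) :
    IndepFun (fun ω => W s ω - W r ω) Yf P := by
  have h := aux_indep P W hW_meas hW_indep s (hr.trans hrs)
  rw [IndepFun_iff_Indep]
  refine indep_of_indep_of_le h ?_ ?_
  · set mm : MeasurableSpace Ω := ⨆ r ∈ Set.Icc (0 : ℝ) s, MeasurableSpace.comap (W r) inferInstance
      with hmm
    have q : ∀ r, 0 ≤ r → r ≤ s → Measurable[mm] (W r) := by
      intro r h0 hr
      refine Measurable.mono (comap_measurable (W r)) ?_ le_rfl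
      exact le_iSup₂ (f := fun r (_ : r ∈ Set.Icc (0 : ℝ) s) => MeasurableSpace.comap (W r) inferInstance)
        r ⟨h0, hr⟩
    exact ((q s (hr.trans hrs) le_rfl).sub (q r hr hrs)).comap_le
  · refine Measurable.comap_le ?_
    refine aux_measurable_of_eval Yf fun x => ?_
    obtain ⟨c, d, v, hv, he⟩ := hY x
    simp_rw [he]
    refine Measurable.const_add (Measurable.const_mul ?_ d) c
    refine Measurable.mono (comap_measurable _) ?_ le_rfl
    refine le_trans ?_ (le_iSup _ ({⟨v, hv⟩} : Finset (Ici s)))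
    simp


/-- Extension by constants of a function on `[-T,0]`. -/
noncomputable def auxExt (T : ℝ) (hT : 0 < T) (h : C(Set.Icc (-T) (0 : ℝ), ℝ)) (y : ℝ) : ℝ :=
  h (Set.projIcc (-T) 0 (neg_nonpos.mpr hT.le) y)

lemma auxExt_cont (T : ℝ) (hT : 0 < T) (h : C(Set.Icc (-T) (0 : ℝ), ℝ)) :
    Continuous (auxExt T hT h) := h.continuous.comp continuous_projIcc

lemma auxExt_bd (T : ℝ) (hT : 0 < T) (h : C(Set.Icc (-T) (0 : ℝ), ℝ)) (y : ℝ) :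
    |auxExt T hT h y| ≤ ‖h‖ := h.norm_coe_le_norm _

lemma auxExt_unif (T : ℝ) (hT : 0 < T) (h : C(Set.Icc (-T) (0 : ℝ), ℝ)) :
    UniformContinuous (auxExt T hT h) :=
  (CompactSpace.uniformContinuous_of_continuous h.continuous).comp
    (LipschitzWith.projIcc (neg_nonpos.mpr hT.le)).uniformContinuous

lemma auxExt_of_mem (T : ℝ) (hT : 0 < T) (h : C(Set.Icc (-T) (0 : ℝ), ℝ)) (y : ℝ)
    (hy : y ∈ Icc (-T) 0) : auxExt T hT h y = h ⟨y, hy⟩ := by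
  simp only [auxExt, projIcc_of_mem _ hy]

lemma auxExt_zero_le (T : ℝ) (hT : 0 < T) (h : C(Set.Icc (-T) (0 : ℝ), ℝ)) (y : ℝ)
    (hy : 0 ≤ y) : auxExt T hT h y = auxExt T hT h 0 := by
  simp only [auxExt]
  rw [projIcc_of_right_le _ hy, projIcc_of_right_le _ le_rfl]

/-- the flow, as a continuous curve -/
noncomputable def auxPath (T : ℝ) (hT : 0 < T) (σ : ℝ) (w : C(ℝ, ℝ))
    (η : C(Set.Icc (-T) (0 : ℝ), ℝ)) : C(ℝ, C(Set.Icc (-T) (0 : ℝ), ℝ)) :=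
  ContinuousMap.curry ⟨fun p : ℝ × Set.Icc (-T) (0 : ℝ) =>
    auxExt T hT η (p.2 + T - p.1) + σ * (w (max (T + p.2) p.1) - w p.1), by
      have := auxExt_cont T hT η
      fun_prop⟩

lemma auxPath_apply (T : ℝ) (hT : 0 < T) (σ : ℝ) (w : C(ℝ, ℝ))
    (η : C(Set.Icc (-T) (0 : ℝ), ℝ)) (r : ℝ) (x : Set.Icc (-T) (0 : ℝ)) :
    auxPath T hT σ w η r x =
      auxExt T hT η (x + T - r) + σ * (w (max (T + x) r) - w r) := rfl

/-- the ramp function -/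
noncomputable def auxPhi (T : ℝ) (r s : ℝ) : C(Set.Icc (-T) (0 : ℝ), ℝ) :=
  ⟨fun x => max 0 (min 1 ((x + T - s) / (s - r))), by fun_prop⟩

lemma auxPhi_apply (T : ℝ) (r s : ℝ) (x : Set.Icc (-T) (0 : ℝ)) :
    auxPhi T r s x = max 0 (min 1 ((x + T - s) / (s - r))) := rfl

lemma auxPhi_norm (T : ℝ) (r s : ℝ) : ‖auxPhi T r s‖ ≤ 1 := by
  rw [ContinuousMap.norm_le _ zero_le_one]
  intro x
  rw [auxPhi_apply, Real.norm_eq_abs, abs_of_nonneg (le_max_left _ _)]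
  exact max_le zero_le_one (min_le_left _ _)

noncomputable def auxV (T : ℝ) (hT : 0 < T) (σ : ℝ) (w : C(ℝ, ℝ))
    (η : C(Set.Icc (-T) (0 : ℝ), ℝ)) (r s : ℝ) : C(Set.Icc (-T) (0 : ℝ), ℝ) :=
  auxPath T hT σ w η s + (σ * (w s - w r)) • auxPhi T r s

lemma auxPath_norm (T : ℝ) (hT : 0 < T) (σ : ℝ) (w : C(ℝ, ℝ))
    (η : C(Set.Icc (-T) (0 : ℝ), ℝ)) (r : ℝ) (hr : r ∈ Icc 0 T) (S : ℝ)
    (hS : ∀ q ∈ Icc 0 T, |w q| ≤ S) : ‖auxPath T hT σ w η r‖ ≤ ‖η‖ + 2 * |σ| * S := by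
  have hS0 : 0 ≤ S := (abs_nonneg _).trans (hS r hr)
  rw [ContinuousMap.norm_le _ (by positivity)]
  intro x
  rw [auxPath_apply, Real.norm_eq_abs]
  refine (abs_add_le _ _).trans (add_le_add (auxExt_bd _ _ _ _) ?_)
  rw [abs_mul]
  have h1 := hS r hr
  have h2 := hS (max (T + x) r) ⟨hr.1.trans (le_max_right _ _), max_le (by linarith [x.2.2]) hr.2⟩
  have h3 := abs_sub (w (max (T + x) r)) (w r)
  calc |σ| * |w (max (T + x) r) - w r| ≤ |σ| * (S + S) := by gcongr; linarith
    _ = _ := by ring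

lemma auxV_norm (T : ℝ) (hT : 0 < T) (σ : ℝ) (w : C(ℝ, ℝ))
    (η : C(Set.Icc (-T) (0 : ℝ), ℝ)) (r s : ℝ) (hr : r ∈ Icc 0 T) (hs : s ∈ Icc 0 T) (S : ℝ)
    (hS : ∀ q ∈ Icc 0 T, |w q| ≤ S) : ‖auxV T hT σ w η r s‖ ≤ ‖η‖ + 4 * |σ| * S := by
  refine (norm_add_le _ _).trans ?_
  have h1 := auxPath_norm T hT σ w η s hs S hS
  have h2 : ‖(σ * (w s - w r)) • auxPhi T r s‖ ≤ 2 * |σ| * S := by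
    rw [norm_smul, Real.norm_eq_abs, abs_mul]
    have h3 := abs_sub (w s) (w r)
    have h4 : |w s - w r| ≤ 2 * S := by linarith [hS r hr, hS s hs]
    have hS0 : 0 ≤ S := (abs_nonneg _).trans (hS r hr)
    calc |σ| * |w s - w r| * ‖auxPhi T r s‖ ≤ |σ| * (2 * S) * 1 := by
          gcongr; exact auxPhi_norm T r s
      _ = _ := by ring
  linarith

/-- The localized part of the difference. -/
noncomputable def auxB (T σ : ℝ) (w : C(ℝ, ℝ)) (r s x : ℝ) : ℝ :=
  σ * (w (max (T + x) r) - w r - w (max (T + x) s) + w s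
    - (w s - w r) * max 0 (min 1 ((x + T - s) / (s - r))))

lemma auxB_cont (T σ : ℝ) (w : C(ℝ, ℝ)) (r s : ℝ) : Continuous (auxB T σ w r s) := by
  unfold auxB; fun_prop

lemma auxB_supp (T σ : ℝ) (w : C(ℝ, ℝ)) (r s x : ℝ) (hrs : r < s)
    (hx : x ∉ Icc (r - T) (s - T + (s - r))) : auxB T σ w r s x = 0 := by
  unfold auxB
  have hd : 0 < s - r := by linarith
  by_cases h : x < r - T
  · rw [max_eq_right (by linarith : T + x ≤ r), max_eq_right (by linarith : T + x ≤ s),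
      max_eq_left (a := (0:ℝ))]
    · ring
    · exact (min_le_right _ _).trans (div_nonpos_of_nonpos_of_nonneg (by linarith) hd.le)
  · have h2 : s - T + (s - r) < x := by
      by_contra h3; exact hx ⟨not_lt.mp h, not_lt.mp h3⟩
    rw [max_eq_left (by linarith : r ≤ T + x), max_eq_left (by linarith : s ≤ T + x),
      min_eq_left, max_eq_right zero_le_one]
    · ring
    · rw [le_div_iff₀ hd]; linarith

lemma auxB_bd (T σ : ℝ) (w : C(ℝ, ℝ)) (r s x b : ℝ) (hrs : r < s)
    (hr : r ∈ Icc 0 T) (hs : s ∈ Icc 0 T) (hx : x ≤ 0)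
    (hb : ∀ a ∈ Icc 0 T, ∀ c ∈ Icc 0 T, |a - c| ≤ s - r → |w a - w c| ≤ b) :
    |auxB T σ w r s x| ≤ 3 * |σ| * b := by
  unfold auxB
  have h1 := hb (max (T + x) r) ⟨hr.1.trans (le_max_right _ _), max_le (by linarith) hr.2⟩
    (max (T + x) s) ⟨hs.1.trans (le_max_right _ _), max_le (by linarith) hs.2⟩ (by
      rw [max_comm _ r, max_comm _ s]
      refine (abs_max_sub_max_le_abs r s (T + x)).trans ?_
      rw [abs_sub_comm, abs_of_pos (by linarith)])
  have h2 := hb s hs r hr (by rw [abs_of_pos (by linarith)])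
  have h3 : |(w s - w r) * max 0 (min 1 ((x + T - s) / (s - r)))| ≤ b := by
    rw [abs_mul, abs_of_nonneg (le_max_left (0:ℝ) _)]
    have : max 0 (min 1 ((x + T - s) / (s - r))) ≤ 1 := max_le zero_le_one (min_le_left _ _)
    have h0 : 0 ≤ max 0 (min 1 ((x + T - s) / (s - r))) := le_max_left _ _
    nlinarith [abs_nonneg (w s - w r)]
  rw [abs_mul]
  have : |w (max (T + x) r) - w r - w (max (T + x) s) + w s
    - (w s - w r) * max 0 (min 1 ((x + T - s) / (s - r)))| ≤ 3 * b := by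
    rw [abs_le] at *
    constructor <;> linarith [h1.1, h1.2, h2.1, h2.2, h3.1, h3.2]
  calc _ ≤ |σ| * (3 * b) := by gcongr
    _ = _ := by ring

lemma auxDiff (T : ℝ) (hT : 0 < T) (σ : ℝ) (w : C(ℝ, ℝ))
    (η : C(Set.Icc (-T) (0 : ℝ), ℝ)) (r s x : ℝ) (hx : x ∈ Icc (-T) 0) :
    auxExt T hT (auxPath T hT σ w η r - auxV T hT σ w η r s) x =
      (auxExt T hT η (x + T - r) - auxExt T hT η (x + T - s)) + auxB T σ w r s x := by
  rw [auxExt_of_mem T hT _ x hx]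
  simp only [auxV, ContinuousMap.sub_apply, ContinuousMap.add_apply, ContinuousMap.smul_apply,
    auxPath_apply, auxPhi_apply, auxB, smul_eq_mul]
  ring

lemma auxPart1_key (T : ℝ) (hT : 0 < T) (σ : ℝ) (w : C(ℝ, ℝ))
    (η : C(Set.Icc (-T) (0 : ℝ), ℝ)) (H : C(Set.Icc (-T) (0 : ℝ), ℝ) → ℝ)
    (hH : Differentiable ℝ H) (g : C(Set.Icc (-T) (0 : ℝ), ℝ) → ℝ → ℝ)
    (K : C(Set.Icc (-T) (0 : ℝ), ℝ) → ℝ)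
    (hg_int : ∀ ζ, Integrable (g ζ)) (hg_supp : ∀ ζ x, x ∉ Icc (-T) 0 → g ζ x = 0)
    (hg_bd : ∀ ζ x, |g ζ x| ≤ K ζ)
    (hg_repr : ∀ ζ h, fderiv ℝ H ζ h = ∫ x, g ζ x * auxExt T hT h x)
    (r s S : ℝ) (hr : r ∈ Icc 0 T) (hs : s ∈ Icc 0 T) (hrs : r < s)
    (hS : ∀ q ∈ Icc 0 T, |w q| ≤ S) :
    ∃ ζ : C(Set.Icc (-T) (0 : ℝ), ℝ), ‖ζ - auxV T hT σ w η r s‖ ≤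
        ‖auxPath T hT σ w η r - auxV T hT σ w η r s‖ ∧ ‖ζ‖ ≤ ‖η‖ + 4 * |σ| * S ∧ ∀ b,
      (∀ a ∈ Icc 0 T, ∀ c ∈ Icc 0 T, |a - c| ≤ s - r → |w a - w c| ≤ b) →
      |H (auxPath T hT σ w η r) - H (auxV T hT σ w η r s) -
        ∫ x, g ζ x * (auxExt T hT η (x + T - r) - auxExt T hT η (x + T - s))| ≤
          K ζ * (3 * |σ| * b) * (2 * (s - r)) := by
  have hS0 : 0 ≤ S := (abs_nonneg _).trans (hS r hr)
  obtain ⟨ζ, h1, h2, h3⟩ := aux_mvt H hH (auxV T hT σ w η r s)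
    (auxPath T hT σ w η r - auxV T hT σ w η r s)
  have hV := auxV_norm T hT σ w η r s hr hs S hS
  have hP := auxPath_norm T hT σ w η r hr S hS
  rw [add_sub_cancel] at h2 h3
  have hP' : ‖auxPath T hT σ w η r‖ ≤ ‖η‖ + 4 * |σ| * S := by
    have : 0 ≤ |σ| * S := by positivity
    linarith
  refine ⟨ζ, h1, h2 _ hV hP', fun b hb => ?_⟩
  rw [h3, hg_repr]
  have hη := auxExt_cont T hT η
  have i1 : Integrable (fun x => g ζ x * (auxExt T hT η (x + T - r) - auxExt T hT η (x + T - s))) := by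
    refine (hg_int ζ).mul_bdd (c := ‖η‖ + ‖η‖) (by fun_prop) (ae_of_all _ fun x => ?_)
    exact (abs_sub _ _).trans (add_le_add (auxExt_bd _ _ _ _) (auxExt_bd _ _ _ _))
  have i2 : Integrable (fun x => g ζ x * auxExt T hT (auxPath T hT σ w η r - auxV T hT σ w η r s) x) := by
    refine (hg_int ζ).mul_bdd (c := ‖auxPath T hT σ w η r - auxV T hT σ w η r s‖)
      (auxExt_cont _ _ _).aestronglyMeasurable (ae_of_all _ fun x => ?_)
    exact auxExt_bd _ _ _ _
  rw [← integral_sub i2 i1]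
  have hK0 : 0 ≤ K ζ := (abs_nonneg _).trans (hg_bd ζ 0)
  have hpt : ∀ x, g ζ x * auxExt T hT (auxPath T hT σ w η r - auxV T hT σ w η r s) x
      - g ζ x * (auxExt T hT η (x + T - r) - auxExt T hT η (x + T - s)) = g ζ x * auxB T σ w r s x := by
    intro x
    by_cases hx : x ∈ Icc (-T) 0
    · rw [auxDiff T hT σ w η r s x hx]; ring
    · rw [hg_supp ζ x hx]; ring
  simp_rw [hpt]
  have hle : ∀ x, |g ζ x * auxB T σ w r s x| ≤
      (Icc (r - T) (s - T + (s - r))).indicator (fun _ => K ζ * (3 * |σ| * b)) x := by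
    intro x
    by_cases hx : x ∈ Icc (r - T) (s - T + (s - r))
    · rw [indicator_of_mem hx]
      have hb0 : 0 ≤ b := (abs_nonneg _).trans (hb r hr r hr (by simp; linarith))
      by_cases hx2 : x ∈ Icc (-T) 0
      · rw [abs_mul]
        exact mul_le_mul (hg_bd ζ x) (auxB_bd T σ w r s x b hrs hr hs hx2.2 hb) (abs_nonneg _) hK0
      · rw [hg_supp ζ x hx2]; simp; positivity
    · rw [auxB_supp T σ w r s x hrs hx, indicator_of_notMem hx]; simp
  calc |∫ x, g ζ x * auxB T σ w r s x| ≤ ∫ x, |g ζ x * auxB T σ w r s x| :=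
        abs_integral_le_integral_abs
    _ ≤ ∫ x, (Icc (r - T) (s - T + (s - r))).indicator (fun _ => K ζ * (3 * |σ| * b)) x := by
        refine integral_mono_of_nonneg (ae_of_all _ fun x => abs_nonneg _) ?_ (ae_of_all _ hle)
        rw [integrable_indicator_iff measurableSet_Icc]
        exact integrableOn_const (by simp)
    _ = _ := by
        rw [integral_indicator measurableSet_Icc, setIntegral_const, Measure.real, Real.volume_Icc,
          ENNReal.toReal_ofReal (by linarith), smul_eq_mul]
        ring


lemma auxPart1_bound (T : ℝ) (hT : 0 < T) (σ : ℝ) (w : C(ℝ, ℝ))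
    (η : C(Set.Icc (-T) (0 : ℝ), ℝ)) (H : C(Set.Icc (-T) (0 : ℝ), ℝ) → ℝ)
    (hH : Differentiable ℝ H) (g : C(Set.Icc (-T) (0 : ℝ), ℝ) → ℝ → ℝ)
    (C : ℝ) (hC : 0 ≤ C) (n : ℕ)
    (hg_int : ∀ ζ, Integrable (g ζ)) (hg_supp : ∀ ζ x, x ∉ Icc (-T) 0 → g ζ x = 0)
    (hg_bd : ∀ ζ x, |g ζ x| ≤ C * (1 + ‖ζ‖) ^ n)
    (hg_shift : ∀ ζ, ∀ ε > 0, ∫ x, |g ζ (x + ε) - g ζ x| ≤ C * (1 + ‖ζ‖) ^ n * ε)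
    (hg_repr : ∀ ζ h, fderiv ℝ H ζ h = ∫ x, g ζ x * auxExt T hT h x)
    (r s S : ℝ) (hr : r ∈ Icc 0 T) (hs : s ∈ Icc 0 T) (hrs : r < s)
    (hS : ∀ q ∈ Icc 0 T, |w q| ≤ S) :
    |(H (auxPath T hT σ w η r) - H (auxV T hT σ w η r s)) / (s - r)| ≤
      3 * C * (1 + (‖η‖ + 4 * |σ| * S)) ^ (n + 1) := by
  have hS0 : 0 ≤ S := (abs_nonneg _).trans (hS r hr)
  have hd : 0 < s - r := by linarith
  obtain ⟨ζ, _, h2, h3⟩ := auxPart1_key T hT σ w η H hH g (fun ζ => C * (1 + ‖ζ‖) ^ n) hg_int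
    hg_supp hg_bd hg_repr r s S hr hs hrs hS
  have h4 := h3 (2 * S) (fun a ha c hc _ => by
    linarith [abs_sub (w a) (w c), hS a ha, hS c hc])
  have h5 := aux_shift_bound T (g ζ) (auxExt T hT η) (hg_int ζ) (auxExt_cont T hT η) ‖η‖ _
    (auxExt_bd T hT η) (hg_shift ζ) r s hrs
  rw [abs_div, abs_of_pos hd, div_le_iff₀ hd]
  set I := ∫ x, g ζ x * (auxExt T hT η (x + T - r) - auxExt T hT η (x + T - s))
  set A := H (auxPath T hT σ w η r) - H (auxV T hT σ w η r s)
  set ρ := ‖η‖ + 4 * |σ| * S with hρ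
  have e1 : |A| ≤ |A - I| + |I| := by
    have := abs_add_le (A - I) I; simpa using this
  have hKK : C * (1 + ‖ζ‖) ^ n ≤ C * (1 + ρ) ^ n := by gcongr
  set k := C * (1 + ‖ζ‖) ^ n with hk
  have hk0 : 0 ≤ k := by positivity
  have hσS : 0 ≤ |σ| * S := by positivity
  have e2 : |A| ≤ k * (3 * ρ) * (s - r) := by
    have h6 : k * (3 * |σ| * (2 * S)) * (2 * (s - r)) + k * ‖η‖ * (s - r)
        ≤ k * (3 * ρ) * (s - r) := by
      have : k * (3 * ρ) * (s - r) - (k * (3 * |σ| * (2 * S)) * (2 * (s - r)) + k * ‖η‖ * (s - r))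
        = k * (s - r) * (2 * ‖η‖) := by rw [hρ]; ring
      have : 0 ≤ k * (s - r) * (2 * ‖η‖) := by positivity
      linarith
    linarith
  have hρ0 : 0 ≤ ρ := by positivity
  calc |A| ≤ k * (3 * ρ) * (s - r) := e2
    _ ≤ (C * (1 + ρ) ^ n) * (3 * (1 + ρ)) * (s - r) := by gcongr; linarith
    _ = _ := by ring

lemma auxPart1_lim (T : ℝ) (hT : 0 < T) (σ : ℝ) (w : C(ℝ, ℝ))
    (η : C(Set.Icc (-T) (0 : ℝ), ℝ)) (H : C(Set.Icc (-T) (0 : ℝ), ℝ) → ℝ)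
    (hH : Differentiable ℝ H) (g : C(Set.Icc (-T) (0 : ℝ), ℝ) → ℝ → ℝ)
    (C : ℝ) (hC : 0 ≤ C) (n : ℕ)
    (hg_int : ∀ ζ, Integrable (g ζ)) (hg_supp : ∀ ζ x, x ∉ Icc (-T) 0 → g ζ x = 0)
    (hg_bd : ∀ ζ x, |g ζ x| ≤ C * (1 + ‖ζ‖) ^ n)
    (hg_shift : ∀ ζ, ∀ ε > 0, ∫ x, |g ζ (x + ε) - g ζ x| ≤ C * (1 + ‖ζ‖) ^ n * ε)
    (hg_repr : ∀ ζ h, fderiv ℝ H ζ h = ∫ x, g ζ x * auxExt T hT h x)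
    (hg_L1 : ∀ ζ₀, Tendsto (fun ζ => ∫ x, |g ζ x - g ζ₀ x|) (𝓝 ζ₀) (𝓝 0))
    (t : ℝ) (ht : t ∈ Icc 0 T) :
    ∃ J : ℝ,
      Tendsto (fun ε => (∫ x, g (auxPath T hT σ w η t) x *
        (auxExt T hT η (x + T - (t - ε)) - auxExt T hT η (x + T - t))) / ε) (𝓝[>] 0) (𝓝 J) ∧
      ∀ (l : Filter ℝ) [l.IsCountablyGenerated] (r s : ℝ → ℝ),
        Tendsto r l (𝓝 t) → Tendsto s l (𝓝 t) →
        (∀ᶠ i in l, r i ∈ Icc 0 T ∧ s i ∈ Icc 0 T ∧ r i < s i) →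
        Tendsto (fun i => (H (auxPath T hT σ w η (r i)) - H (auxV T hT σ w η (r i) (s i)))
          / (s i - r i)) l (𝓝 J) := by
  obtain ⟨S, hS⟩ := (isCompact_Icc (a := (0:ℝ)) (b := T)).exists_bound_of_continuousOn
    w.continuous.continuousOn
  simp only [Real.norm_eq_abs] at hS
  have hS0 : 0 ≤ S := (abs_nonneg _).trans (hS t ht)
  set ρ := ‖η‖ + 4 * |σ| * S with hρ
  have hσS : 0 ≤ |σ| * S := by positivity
  have hρ0 : 0 ≤ ρ := by positivity
  set k := C * (1 + ρ) ^ n with hk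
  have hk0 : 0 ≤ k := by positivity
  have hle : ∀ ζ : C(Set.Icc (-T) (0 : ℝ), ℝ), ‖ζ‖ ≤ ρ → C * (1 + ‖ζ‖) ^ n ≤ k := by
    intro ζ hζ; rw [hk]; gcongr
  have hPt : ‖auxPath T hT σ w η t‖ ≤ ρ := by
    have := auxPath_norm T hT σ w η t ht S hS
    linarith
  have hshift : ∀ ζ : C(Set.Icc (-T) (0 : ℝ), ℝ), ‖ζ‖ ≤ ρ → ∀ ε > 0,
      ∫ x, |g ζ (x + ε) - g ζ x| ≤ k * ε := by
    intro ζ hζ ε hε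
    refine (hg_shift ζ ε hε).trans ?_
    have := hle ζ hζ
    gcongr
  obtain ⟨J, hJ⟩ := aux_forward T t (g (auxPath T hT σ w η t)) (auxExt T hT η) (hg_int _)
    (auxExt_unif T hT η) ‖η‖ k (auxExt_bd T hT η) hk0 (hshift _ hPt)
  refine ⟨J, ?_, ?_⟩
  · have hr : Tendsto (fun ε : ℝ => t - ε) (𝓝[>] 0) (𝓝 t) := by
      have : Tendsto (fun ε : ℝ => t - ε) (𝓝 0) (𝓝 (t - 0)) := by
        exact tendsto_const_nhds.sub tendsto_id
      rw [sub_zero] at this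
      exact this.mono_left nhdsWithin_le_nhds
    have h0 : ∀ᶠ ε : ℝ in 𝓝[>] 0, t - ε < t := by
      filter_upwards [self_mem_nhdsWithin] with ε hε
      have : 0 < ε := hε
      linarith
    have := hJ (𝓝[>] 0) (fun ε => t - ε) (fun _ => t) (fun _ => g (auxPath T hT σ w η t)) hr
      tendsto_const_nhds h0 (Eventually.of_forall fun _ => hg_int _)
      (Eventually.of_forall fun _ => hshift _ hPt) (by simp)
    simpa using this
  intro l _ r s hr hs hev
  have hex : ∀ i, ∃ ζ : C(Set.Icc (-T) (0 : ℝ), ℝ), r i ∈ Icc 0 T ∧ s i ∈ Icc 0 T ∧ r i < s i →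
      ‖ζ - auxV T hT σ w η (r i) (s i)‖ ≤
        ‖auxPath T hT σ w η (r i) - auxV T hT σ w η (r i) (s i)‖ ∧ ‖ζ‖ ≤ ρ ∧ ∀ b,
      (∀ a ∈ Icc 0 T, ∀ c ∈ Icc 0 T, |a - c| ≤ s i - r i → |w a - w c| ≤ b) →
      |H (auxPath T hT σ w η (r i)) - H (auxV T hT σ w η (r i) (s i)) -
        ∫ x, g ζ x * (auxExt T hT η (x + T - r i) - auxExt T hT η (x + T - s i))| ≤
          C * (1 + ‖ζ‖) ^ n * (3 * |σ| * b) * (2 * (s i - r i)) := by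
    intro i
    by_cases h : r i ∈ Icc 0 T ∧ s i ∈ Icc 0 T ∧ r i < s i
    · obtain ⟨ζ, hζ⟩ := auxPart1_key T hT σ w η H hH g (fun ζ => C * (1 + ‖ζ‖) ^ n) hg_int
        hg_supp hg_bd hg_repr (r i) (s i) S h.1 h.2.1 h.2.2 hS
      exact ⟨ζ, fun _ => hζ⟩
    · exact ⟨0, fun h' => absurd h' h⟩
  choose ζ hζ using hex
  -- convergence of the paths
  have hPr : Tendsto (fun i => auxPath T hT σ w η (r i)) l (𝓝 (auxPath T hT σ w η t)) :=
    ((auxPath T hT σ w η).continuous.tendsto t).comp hr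
  have hPs : Tendsto (fun i => auxPath T hT σ w η (s i)) l (𝓝 (auxPath T hT σ w η t)) :=
    ((auxPath T hT σ w η).continuous.tendsto t).comp hs
  have hwd : Tendsto (fun i => σ * (w (s i) - w (r i))) l (𝓝 0) := by
    have h1 := (w.continuous.tendsto t).comp hr
    have h2 := (w.continuous.tendsto t).comp hs
    have := (h2.sub h1).const_mul σ
    simpa using this
  have hphi : Tendsto (fun i => (σ * (w (s i) - w (r i))) • auxPhi T (r i) (s i)) l (𝓝 0) := by
    refine squeeze_zero_norm (a := fun i => |σ * (w (s i) - w (r i))|) (fun i => ?_)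
      (by simpa using hwd.abs)
    rw [norm_smul, Real.norm_eq_abs]
    exact mul_le_of_le_one_right (abs_nonneg _) (auxPhi_norm _ _ _)
  have hV : Tendsto (fun i => auxV T hT σ w η (r i) (s i)) l (𝓝 (auxPath T hT σ w η t)) := by
    have := hPs.add hphi
    rw [add_zero] at this
    exact this
  have hζV : Tendsto (fun i => ζ i - auxV T hT σ w η (r i) (s i)) l (𝓝 0) := by
    have h1 := (hPr.sub hV).norm
    rw [sub_self, norm_zero] at h1
    refine squeeze_zero_norm' ?_ h1
    filter_upwards [hev] with i hi using (hζ i hi).1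
  have hζt : Tendsto ζ l (𝓝 (auxPath T hT σ w η t)) := by
    have := hζV.add hV
    simpa using this
  have main := hJ l r s (fun i => g (ζ i)) hr hs (hev.mono fun i hi => hi.2.2)
    (Eventually.of_forall fun i => hg_int _)
    (hev.mono fun i hi => hshift _ (hζ i hi).2.1) ((hg_L1 _).comp hζt)
  -- error term
  have herr : Tendsto (fun i => (H (auxPath T hT σ w η (r i)) - H (auxV T hT σ w η (r i) (s i)) -
        ∫ x, g (ζ i) x * (auxExt T hT η (x + T - r i) - auxExt T hT η (x + T - s i)))
          / (s i - r i)) l (𝓝 0) := by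
    refine Metric.tendsto_nhds.mpr fun e he => ?_
    set b := e / (k * (3 * |σ|) * 2 + 1) / 2 with hb
    have hb0 : 0 < b := by positivity
    have huc := (isCompact_Icc (a := (0:ℝ)) (b := T)).uniformContinuousOn_of_continuous
      w.continuous.continuousOn
    obtain ⟨δ, hδ, hδw⟩ := Metric.uniformContinuousOn_iff.mp huc b hb0
    have hsr : Tendsto (fun i => s i - r i) l (𝓝 0) := by simpa using hs.sub hr
    filter_upwards [hev, hsr.eventually (gt_mem_nhds hδ)] with i hi hid
    have h1 := (hζ i hi).2.2 b (fun a ha c hc hac =>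
      (hδw a ha c hc (by rw [Real.dist_eq]; linarith)).le)
    have hd : 0 < s i - r i := by linarith [hi.2.2]
    rw [Real.dist_eq, sub_zero, abs_div, abs_of_pos hd, div_lt_iff₀ hd]
    refine h1.trans_lt ?_
    have h2 := hle _ (hζ i hi).2.1
    calc C * (1 + ‖ζ i‖) ^ n * (3 * |σ| * b) * (2 * (s i - r i))
        ≤ k * (3 * |σ| * b) * (2 * (s i - r i)) := by gcongr
      _ = ((k * (3 * |σ|) * 2) * b) * (s i - r i) := by ring
      _ < e * (s i - r i) := by
        gcongr
        have hq : 0 ≤ k * (3 * |σ|) * 2 := by positivity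
        have : (k * (3 * |σ|) * 2 + 1) * b = e / 2 := by
          rw [hb]; field_simp
        nlinarith
  have := main.add herr
  rw [add_zero] at this
  refine this.congr fun i => ?_
  rw [← add_div]
  congr 1
  ring


lemma aux_phi_lim (T : ℝ) (hT : 0 < T) (t : ℝ) (l : Filter ℝ) (r s : ℝ → ℝ)
    (hr : Tendsto r l (𝓝 t)) (hs : Tendsto s l (𝓝 t))
    (hev : ∀ᶠ i in l, r i < s i ∧ t ≤ s i) (x : ℝ) (hx : x ∈ Icc (-T) 0) :
    Tendsto (fun i => auxExt T hT (auxPhi T (r i) (s i)) x) l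
      (𝓝 ((Ioc (t - T) 0).indicator (fun _ => (1:ℝ)) x)) := by
  simp_rw [auxExt_of_mem T hT _ x hx, auxPhi_apply]
  by_cases h : t - T < x
  · rw [indicator_of_mem (show x ∈ Ioc (t - T) 0 from ⟨h, hx.2⟩)]
    refine tendsto_const_nhds.congr' ?_
    have h1 : Tendsto (fun i => x + T - s i - (s i - r i)) l (𝓝 (x + T - t - (t - t))) :=
      (tendsto_const_nhds.sub hs).sub (hs.sub hr)
    filter_upwards [hev, h1.eventually (lt_mem_nhds (by linarith : 0 < x + T - t - (t - t)))]
      with i hi hi2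
    have hd : 0 < s i - r i := by linarith [hi.1]
    rw [min_eq_left, max_eq_right zero_le_one]
    rw [le_div_iff₀ hd]; linarith
  · rw [indicator_of_notMem (fun h2 => h h2.1)]
    refine tendsto_const_nhds.congr' ?_
    filter_upwards [hev] with i hi
    have hd : 0 < s i - r i := by linarith [hi.1]
    rw [max_eq_left]
    refine (min_le_right _ _).trans (div_nonpos_of_nonpos_of_nonneg ?_ hd.le)
    linarith [hi.2]

lemma aux_m_lim (T : ℝ) (hT : 0 < T) (t : ℝ) (l : Filter ℝ) [l.IsCountablyGenerated] (r s : ℝ → ℝ)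
    (hr : Tendsto r l (𝓝 t)) (hs : Tendsto s l (𝓝 t))
    (hev : ∀ᶠ i in l, r i < s i ∧ t ≤ s i) (m : Measure (ℝ × ℝ)) [IsFiniteMeasure m]
    (hm : m ((Set.Icc (-T) 0 ×ˢ Set.Icc (-T) 0)ᶜ) = 0) :
    Tendsto (fun i => ∫ q : ℝ × ℝ, auxExt T hT (auxPhi T (r i) (s i)) q.1 *
      auxExt T hT (auxPhi T (r i) (s i)) q.2 ∂m) l
      (𝓝 (m (Set.Ioc (t - T) 0 ×ˢ Set.Ioc (t - T) 0)).toReal) := by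
  have hms : MeasurableSet (Set.Ioc (t - T) 0 ×ˢ Set.Ioc (t - T) 0) :=
    measurableSet_Ioc.prod measurableSet_Ioc
  have e : (m (Set.Ioc (t - T) 0 ×ˢ Set.Ioc (t - T) 0)).toReal =
      ∫ q : ℝ × ℝ, (Ioc (t - T) 0).indicator (fun _ => (1:ℝ)) q.1 *
        (Ioc (t - T) 0).indicator (fun _ => (1:ℝ)) q.2 ∂m := by
    have : (fun q : ℝ × ℝ => (Ioc (t - T) 0).indicator (fun _ => (1:ℝ)) q.1 *
        (Ioc (t - T) 0).indicator (fun _ => (1:ℝ)) q.2) =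
        (Set.Ioc (t - T) 0 ×ˢ Set.Ioc (t - T) 0).indicator 1 := by
      ext q
      simp only [indicator_apply, mem_prod, Pi.one_apply]
      by_cases h1 : q.1 ∈ Ioc (t - T) 0 <;> by_cases h2 : q.2 ∈ Ioc (t - T) 0 <;> simp [h1, h2]
    rw [this, integral_indicator_one hms]; rfl
  rw [e]
  have hb : ∀ i x, |auxExt T hT (auxPhi T (r i) (s i)) x| ≤ 1 := fun i x =>
    (auxExt_bd _ _ _ _).trans (auxPhi_norm _ _ _)
  refine tendsto_integral_filter_of_dominated_convergence (fun _ => 1) ?_ ?_ (integrable_const _) ?_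
  · refine Eventually.of_forall fun i => ?_
    have := auxExt_cont T hT (auxPhi T (r i) (s i))
    exact (by fun_prop : Continuous fun q : ℝ × ℝ => auxExt T hT (auxPhi T (r i) (s i)) q.1 *
      auxExt T hT (auxPhi T (r i) (s i)) q.2).aestronglyMeasurable
  · refine Eventually.of_forall fun i => ae_of_all _ fun q => ?_
    rw [Real.norm_eq_abs, abs_mul]
    exact mul_le_one₀ (hb i _) (abs_nonneg _) (hb i _)
  · have : ∀ᵐ q ∂m, q ∈ (Set.Icc (-T) 0 ×ˢ Set.Icc (-T) (0:ℝ)) := by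
      rw [ae_iff]; exact hm
    filter_upwards [this] with q hq
    exact (aux_phi_lim T hT t l r s hr hs hev _ hq.1).mul
      (aux_phi_lim T hT t l r s hr hs hev _ hq.2)

lemma aux_norm_lim {E F : Type*} [NormedAddCommGroup E] [NormedAddCommGroup F] (l : Filter ℝ)
    (B : E → F) (hB : Continuous B) (Z : ℝ → E) (z : E)
    (hZ : Tendsto Z l (𝓝 z)) : Tendsto (fun i => ‖B (Z i) - B z‖) l (𝓝 0) :=
  tendsto_iff_norm_sub_tendsto_zero.mp ((hB.tendsto z).comp hZ)

lemma aux_bil_bd {E : Type*} [NormedAddCommGroup E] [NormedSpace ℝ E] 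
    (B B' : E →L[ℝ] E →L[ℝ] ℝ) (φ : E) (hφ : ‖φ‖ ≤ 1) : ‖B φ φ - B' φ φ‖ ≤ ‖B - B'‖ := by
  have h0 : B φ φ - B' φ φ = (B - B') φ φ := rfl
  rw [h0]
  refine ((B - B').le_opNorm₂ _ _).trans ?_
  have h1 := norm_nonneg (B - B')
  have h2 := norm_nonneg φ
  calc _ ≤ ‖B - B'‖ * 1 * 1 := by gcongr
    _ = _ := by ring

lemma aux_bil_lim {E : Type*} [NormedAddCommGroup E] [NormedSpace ℝ E] (l : Filter ℝ)
    (B : E → (E →L[ℝ] E →L[ℝ] ℝ)) (hB : Continuous B) (Z φ : ℝ → E) (z : E)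
    (hZ : Tendsto Z l (𝓝 z)) (hφ : ∀ i, ‖φ i‖ ≤ 1) (a : ℝ)
    (h1 : Tendsto (fun i => B z (φ i) (φ i)) l (𝓝 a)) :
    Tendsto (fun i => B (Z i) (φ i) (φ i)) l (𝓝 a) := by
  have h2 : Tendsto (fun i => B (Z i) (φ i) (φ i) - B z (φ i) (φ i)) l (𝓝 0) :=
    squeeze_zero_norm (fun i => aux_bil_bd _ _ _ (hφ i)) (aux_norm_lim l B hB Z z hZ)
  have := h2.add h1
  rw [zero_add] at this
  exact this.congr fun i => by ring

lemma aux_D2_lim (T : ℝ) (hT : 0 < T) (t : ℝ) (l : Filter ℝ) [l.IsCountablyGenerated] (r s : ℝ → ℝ)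
    (hr : Tendsto r l (𝓝 t)) (hs : Tendsto s l (𝓝 t))
    (hev : ∀ᶠ i in l, r i < s i ∧ t ≤ s i)
    (H : C(Set.Icc (-T) (0 : ℝ), ℝ) → ℝ)
    (hB : Continuous (fderiv ℝ (fderiv ℝ H))) (Z : ℝ → C(Set.Icc (-T) (0 : ℝ), ℝ))
    (z : C(Set.Icc (-T) (0 : ℝ), ℝ))
    (hZ : Tendsto Z l (𝓝 z)) (mp mm : Measure (ℝ × ℝ)) [IsFiniteMeasure mp] [IsFiniteMeasure mm]
    (hmp : mp ((Set.Icc (-T) 0 ×ˢ Set.Icc (-T) 0)ᶜ) = 0)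
    (hmm : mm ((Set.Icc (-T) 0 ×ˢ Set.Icc (-T) 0)ᶜ) = 0)
    (hrepr : ∀ g h : C(Set.Icc (-T) (0 : ℝ), ℝ), fderiv ℝ (fderiv ℝ H) z g h =
        (∫ q : ℝ × ℝ, auxExt T hT g q.1 * auxExt T hT h q.2 ∂mp) -
        ∫ q : ℝ × ℝ, auxExt T hT g q.1 * auxExt T hT h q.2 ∂mm) :
    Tendsto (fun i => fderiv ℝ (fderiv ℝ H) (Z i) (auxPhi T (r i) (s i)) (auxPhi T (r i) (s i))) l
      (𝓝 ((mp (Set.Ioc (t - T) 0 ×ˢ Set.Ioc (t - T) 0)).toReal -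
        (mm (Set.Ioc (t - T) 0 ×ˢ Set.Ioc (t - T) 0)).toReal)) := by
  refine aux_bil_lim l _ hB Z (fun i => auxPhi T (r i) (s i)) z hZ (fun i => auxPhi_norm _ _ _) _ ?_
  simp_rw [hrepr]
  exact (aux_m_lim T hT t l r s hr hs hev mp hmp).sub (aux_m_lim T hT t l r s hr hs hev mm hmm)


set_option maxSynthPendingDepth 3 in
lemma aux_d3_norm {E : Type*} [NormedAddCommGroup E] [NormedSpace ℝ E] (H : E → ℝ) (ζ : E) :
    ‖fderiv ℝ (fderiv ℝ (fderiv ℝ H)) ζ‖ = ‖iteratedFDeriv ℝ 3 H ζ‖ := by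
  rw [← norm_iteratedFDeriv_fderiv, ← norm_iteratedFDeriv_fderiv, norm_iteratedFDeriv_one]

lemma aux_bil_op {E : Type*} [NormedAddCommGroup E] [NormedSpace ℝ E]
    (B : E →L[ℝ] E →L[ℝ] ℝ) (φ : E) (hφ : ‖φ‖ ≤ 1) : |B φ φ| ≤ ‖B‖ := by
  refine (B.le_opNorm₂ φ φ).trans ?_
  have h1 := norm_nonneg B
  have h2 := norm_nonneg φ
  calc _ ≤ ‖B‖ * 1 * 1 := by gcongr
    _ = _ := by ring

set_option maxSynthPendingDepth 3 in
lemma aux_growths {E : Type*} [NormedAddCommGroup E] [NormedSpace ℝ E] (H : E → ℝ)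
    (hH : ContDiff ℝ 3 H)
    (hg : ∃ C > (0 : ℝ), ∃ p : ℝ, 1 ≤ p ∧
      ∀ ζ : E, ‖iteratedFDeriv ℝ 3 H ζ‖ ≤ C * (1 + ‖ζ‖ ^ p)) :
    ∃ (C : ℝ) (n : ℕ), 0 ≤ C ∧ (∀ ζ, |H ζ| ≤ C * (1 + ‖ζ‖) ^ n) ∧
      (∀ ζ φ : E, ‖φ‖ ≤ 1 → |fderiv ℝ H ζ φ| ≤ C * (1 + ‖ζ‖) ^ n) ∧
      (∀ ζ φ : E, ‖φ‖ ≤ 1 → |fderiv ℝ (fderiv ℝ H) ζ φ φ| ≤ C * (1 + ‖ζ‖) ^ n) ∧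
      (∀ (v h : E) (R : ℝ), ‖v‖ ≤ R → ‖v + h‖ ≤ R →
        |H (v + h) - H v - fderiv ℝ H v h - fderiv ℝ (fderiv ℝ H) v h h / 2| ≤
          C * (1 + R) ^ n * ‖h‖ ^ 3) := by
  obtain ⟨C, hC, p, hp, hb⟩ := hg
  have hd1 : Differentiable ℝ H := hH.differentiable (by norm_num)
  have hc2 : ContDiff ℝ 2 (fderiv ℝ H) := hH.fderiv_right (by norm_num)
  have hd2 : Differentiable ℝ (fderiv ℝ H) := hc2.differentiable (by norm_num)
  have hc3 : ContDiff ℝ 1 (fderiv ℝ (fderiv ℝ H)) := hc2.fderiv_right (by norm_num)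
  have hd3 : Differentiable ℝ (fderiv ℝ (fderiv ℝ H)) := hc3.differentiable (by norm_num)
  have h3 : ∀ ζ, ‖fderiv ℝ (fderiv ℝ (fderiv ℝ H)) ζ‖ ≤ 2 * C * (1 + ‖ζ‖) ^ ⌈p⌉₊ := fun ζ => by
    rw [aux_d3_norm]
    exact (hb ζ).trans (aux_rpow_le C p ‖ζ‖ hC (norm_nonneg _) hp)
  have h2 := aux_growth_of_deriv _ hd3 ⟨2 * C, ⌈p⌉₊, by positivity, h3⟩
  have h1 := aux_growth_of_deriv _ hd2 h2
  have h0 := aux_growth_of_deriv _ hd1 h1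
  obtain ⟨C2, n2, hC2, h2⟩ := h2
  obtain ⟨C1, n1, hC1, h1⟩ := h1
  obtain ⟨C0, n0, hC0, h0⟩ := h0
  have key : ∀ (a : ℝ), 0 ≤ a → ∀ (c : ℝ) (n : ℕ), 0 ≤ c → c ≤ C0 + C1 + C2 + 2 * C →
      n ≤ n0 + n1 + n2 + ⌈p⌉₊ → c * (1 + a) ^ n ≤
        (C0 + C1 + C2 + 2 * C) * (1 + a) ^ (n0 + n1 + n2 + ⌈p⌉₊) := by
    intro a ha c n hc hc' hn
    gcongr
    linarith
  refine ⟨C0 + C1 + C2 + 2 * C, n0 + n1 + n2 + ⌈p⌉₊, by positivity, fun ζ => ?_, fun ζ φ hφ => ?_,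
    fun ζ φ hφ => ?_, fun v h R hv hvh => ?_⟩
  · exact (h0 ζ).trans (key _ (norm_nonneg _) _ _ hC0 (by linarith) (by omega))
  · refine (((fderiv ℝ H ζ).le_opNorm φ).trans ?_).trans
      ((h1 ζ).trans (key _ (norm_nonneg _) _ _ hC1 (by linarith) (by omega)))
    exact mul_le_of_le_one_right (norm_nonneg _) hφ
  · exact (aux_bil_op _ _ hφ).trans
      ((h2 ζ).trans (key _ (norm_nonneg _) _ _ hC2 (by linarith) (by omega)))
  · have hR : 0 ≤ R := (norm_nonneg _).trans hv
    have ht := aux_taylor H hH (2 * C * (1 + R) ^ ⌈p⌉₊) v h ?_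
    · refine ht.trans ?_
      have := key R hR (2 * C) ⌈p⌉₊ (by positivity) (by linarith) (by omega)
      gcongr
    · intro τ hτ
      have hz : ‖v + τ • h‖ ≤ R := by
        have : v + τ • h = (1 - τ) • v + τ • (v + h) := by module
        rw [this]
        refine (norm_add_le _ _).trans ?_
        rw [norm_smul, norm_smul, Real.norm_eq_abs, Real.norm_eq_abs, abs_of_nonneg hτ.1,
          abs_of_nonneg (by linarith [hτ.2] : 0 ≤ 1 - τ)]
        nlinarith [hτ.1, hτ.2]
      have := aux_lip_growth _ hd3 (2 * C) (by positivity) _ h3 R v (v + τ • h) hv hz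
      refine this.trans ?_
      have h5 : ‖v + τ • h - v‖ ≤ ‖h‖ := by
        rw [add_sub_cancel_left, norm_smul, Real.norm_eq_abs, abs_of_nonneg hτ.1]
        exact mul_le_of_le_one_left (norm_nonneg _) hτ.2
      gcongr

lemma aux_dom {Ω : Type*} [MeasurableSpace Ω] (P : Measure Ω) (ρ f : Ω → ℝ)
    (hρ : ∀ n : ℕ, Integrable (fun ω => (1 + ρ ω) ^ n) P) (hf : Measurable f) (C : ℝ) (n : ℕ)
    (hb : ∀ ω, |f ω| ≤ C * (1 + ρ ω) ^ n) : Integrable f P :=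
  ((hρ n).const_mul C).mono' hf.aestronglyMeasurable (ae_of_all _ hb)

set_option maxSynthPendingDepth 3 in
lemma aux_part2 {E : Type*} [NormedAddCommGroup E] [NormedSpace ℝ E] [MeasurableSpace E]
    [BorelSpace E] (H : E → ℝ)
    (hH : ContDiff ℝ 3 H) (C : ℝ) (n : ℕ) (hC : 0 ≤ C)
    (h0 : ∀ ζ, |H ζ| ≤ C * (1 + ‖ζ‖) ^ n)
    (h1 : ∀ ζ φ : E, ‖φ‖ ≤ 1 → |fderiv ℝ H ζ φ| ≤ C * (1 + ‖ζ‖) ^ n)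
    (h2 : ∀ ζ φ : E, ‖φ‖ ≤ 1 → |fderiv ℝ (fderiv ℝ H) ζ φ φ| ≤ C * (1 + ‖ζ‖) ^ n)
    (h3 : ∀ (v h : E) (R : ℝ), ‖v‖ ≤ R → ‖v + h‖ ≤ R →
        |H (v + h) - H v - fderiv ℝ H v h - fderiv ℝ (fderiv ℝ H) v h h / 2| ≤
          C * (1 + R) ^ n * ‖h‖ ^ 3)
    {Ω : Type*} [MeasurableSpace Ω] (P : Measure Ω) [IsProbabilityMeasure P]
    (ρ : Ω → ℝ) (hρ0 : ∀ ω, 0 ≤ ρ ω) (hρ : ∀ n : ℕ, Integrable (fun ω => (1 + ρ ω) ^ n) P)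
    (σ : ℝ) (φ : E) (hφ : ‖φ‖ ≤ 1) (Z : Ω → E) (D : Ω → ℝ) (hZ : Measurable Z) (hD : Measurable D)
    (hV : Measurable fun ω => Z ω + (σ * D ω) • φ) (hind : IndepFun D Z P)
    (hZb : ∀ ω, ‖Z ω‖ ≤ ρ ω) (hDb : ∀ ω, |D ω| ≤ ρ ω)
    (hVb : ∀ ω, ‖Z ω + (σ * D ω) • φ‖ ≤ ρ ω)
    (ε c : ℝ) (hε : 0 < ε) (e1 : ∫ ω, D ω ∂P = 0) (e2 : ∫ ω, D ω ^ 2 ∂P = ε)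
    (e6 : ∫ ω, D ω ^ 6 ∂P = c * ε ^ 3) :
    |(∫ ω, (H (Z ω + (σ * D ω) • φ) - H (Z ω)) ∂P) / ε -
      σ ^ 2 / 2 * ∫ ω, fderiv ℝ (fderiv ℝ H) (Z ω) φ φ ∂P| ≤
      |σ| ^ 3 * ((c + C ^ 2 * ∫ ω, (1 + ρ ω) ^ (2 * n) ∂P) / 2) * √ε := by
  have hd1 : Differentiable ℝ H := hH.differentiable (by norm_num)
  have hc2 : ContDiff ℝ 2 (fderiv ℝ H) := hH.fderiv_right (by norm_num)
  have hc3 : ContDiff ℝ 1 (fderiv ℝ (fderiv ℝ H)) := hc2.fderiv_right (by norm_num)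
  set a : E → ℝ := fun z => fderiv ℝ H z φ with ha
  set b : E → ℝ := fun z => fderiv ℝ (fderiv ℝ H) z φ φ with hb
  have hac : Continuous a := hc2.continuous.clm_apply continuous_const
  have hbc : Continuous b := (hc3.continuous.clm_apply continuous_const).clm_apply continuous_const
  have mono : ∀ ω (x : ℝ), x ≤ ρ ω → 0 ≤ x → C * (1 + x) ^ n ≤ C * (1 + ρ ω) ^ n := by
    intro ω x hx hx0
    gcongr
  have ia : ∀ ω, |a (Z ω)| ≤ C * (1 + ρ ω) ^ n := fun ω =>
    (h1 _ _ hφ).trans (mono ω _ (hZb ω) (norm_nonneg _))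
  have ib : ∀ ω, |b (Z ω)| ≤ C * (1 + ρ ω) ^ n := fun ω =>
    (h2 _ _ hφ).trans (mono ω _ (hZb ω) (norm_nonneg _))
  have hρ1 : ∀ ω, ρ ω ≤ 1 + ρ ω := fun ω => by linarith
  have iHV : Integrable (fun ω => H (Z ω + (σ * D ω) • φ)) P :=
    aux_dom P ρ _ hρ (hd1.continuous.measurable.comp hV) C n
      fun ω => (h0 _).trans (mono ω _ (hVb ω) (norm_nonneg _))
  have iHZ : Integrable (fun ω => H (Z ω)) P :=
    aux_dom P ρ _ hρ (hd1.continuous.measurable.comp hZ) C n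
      fun ω => (h0 _).trans (mono ω _ (hZb ω) (norm_nonneg _))
  have i1 : Integrable (fun ω => D ω * a (Z ω)) P := by
    refine aux_dom P ρ _ hρ (hD.mul (hac.measurable.comp hZ)) C (n + 1) fun ω => ?_
    rw [abs_mul, pow_succ]
    calc |D ω| * |a (Z ω)| ≤ (1 + ρ ω) * (C * (1 + ρ ω) ^ n) := by
          have := hρ0 ω
          exact mul_le_mul ((hDb ω).trans (hρ1 ω)) (ia ω) (abs_nonneg _) (by linarith)
      _ = _ := by ring
  have i2 : Integrable (fun ω => D ω ^ 2 * b (Z ω)) P := by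
    refine aux_dom P ρ _ hρ ((hD.pow_const 2).mul (hbc.measurable.comp hZ)) C (n + 2) fun ω => ?_
    rw [abs_mul, pow_add, abs_pow]
    calc |D ω| ^ 2 * |b (Z ω)| ≤ (1 + ρ ω) ^ 2 * (C * (1 + ρ ω) ^ n) := by
          have := hρ0 ω
          have := (hDb ω).trans (hρ1 ω)
          exact mul_le_mul (by gcongr) (ib ω) (abs_nonneg _) (by positivity)
      _ = _ := by ring
  have i6 : Integrable (fun ω => D ω ^ 6) P := by
    refine aux_dom P ρ _ hρ (hD.pow_const 6) 1 6 fun ω => ?_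
    rw [abs_pow, one_mul]
    have := (hDb ω).trans (hρ1 ω)
    gcongr
  have f1 : ∫ ω, D ω * a (Z ω) ∂P = 0 := by
    have := hind.integral_fun_comp_mul_comp (f := fun x : ℝ => x) (g := a) hD.aemeasurable
      hZ.aemeasurable measurable_id.aestronglyMeasurable hac.measurable.aestronglyMeasurable
    rw [this, e1, zero_mul]
  have f2 : ∫ ω, D ω ^ 2 * b (Z ω) ∂P = ε * ∫ ω, b (Z ω) ∂P := by
    have := hind.integral_fun_comp_mul_comp (f := fun x : ℝ => x ^ 2) (g := b) hD.aemeasurable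
      hZ.aemeasurable (measurable_id.pow_const 2).aestronglyMeasurable
      hbc.measurable.aestronglyMeasurable
    rw [this, e2]
  set R : Ω → ℝ := fun ω => H (Z ω + (σ * D ω) • φ) - H (Z ω) - σ * (D ω * a (Z ω)) -
    σ ^ 2 / 2 * (D ω ^ 2 * b (Z ω)) with hR
  have eR : ∫ ω, R ω ∂P = (∫ ω, (H (Z ω + (σ * D ω) • φ) - H (Z ω)) ∂P) -
      σ ^ 2 / 2 * (ε * ∫ ω, b (Z ω) ∂P) := by
    have j1 := (iHV.sub iHZ).sub (i1.const_mul σ)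
    have := integral_sub j1 (i2.const_mul (σ ^ 2 / 2))
    have k := integral_sub (iHV.sub iHZ) (i1.const_mul σ)
    simp only [Pi.sub_apply] at this k
    rw [hR, this, k, integral_const_mul, integral_const_mul, f1, f2]
    ring
  set l := ε * √ε with hl
  have hsq : √ε ^ 2 = ε := Real.sq_sqrt hε.le
  have hl0 : 0 < l := mul_pos hε (Real.sqrt_pos.mpr hε)
  have hl2 : l ^ 2 = ε ^ 3 := by rw [hl, mul_pow, hsq]; ring
  have bR : ∀ ω, ‖R ω‖ ≤ |σ| ^ 3 * ((l⁻¹ * D ω ^ 6 + l * (C ^ 2 * (1 + ρ ω) ^ (2 * n))) / 2) := by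
    intro ω
    have t := h3 (Z ω) ((σ * D ω) • φ) (ρ ω) (hZb ω) (hVb ω)
    have e : R ω = H (Z ω + (σ * D ω) • φ) - H (Z ω) - fderiv ℝ H (Z ω) ((σ * D ω) • φ) -
        fderiv ℝ (fderiv ℝ H) (Z ω) ((σ * D ω) • φ) ((σ * D ω) • φ) / 2 := by
      rw [hR, ha, hb]
      simp only [map_smul, smul_eq_mul]
      simp only [ContinuousLinearMap.smul_apply, smul_eq_mul]
      ring
    rw [Real.norm_eq_abs, e]
    refine t.trans ?_
    have hn : ‖(σ * D ω) • φ‖ ≤ |σ| * |D ω| := by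
      rw [norm_smul, Real.norm_eq_abs, abs_mul]
      exact mul_le_of_le_one_right (by positivity) hφ
    set q := C * (1 + ρ ω) ^ n with hq
    have hq0 : 0 ≤ q := by have := hρ0 ω; positivity
    have hq2 : C ^ 2 * (1 + ρ ω) ^ (2 * n) = q ^ 2 := by rw [hq]; ring
    have hd6 : D ω ^ 6 = (|D ω| ^ 3) ^ 2 := by
      rw [← pow_mul]; exact ((by decide : Even 6).pow_abs _).symm
    rw [hq2, hd6]
    set d := |D ω| ^ 3 with hd
    have hy : q * d ≤ (l⁻¹ * d ^ 2 + l * q ^ 2) / 2 := by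
      have : (l⁻¹ * d ^ 2 + l * q ^ 2) / 2 - q * d = l⁻¹ * (d - l * q) ^ 2 / 2 := by
        field_simp; ring
      have : 0 ≤ l⁻¹ * (d - l * q) ^ 2 / 2 := by positivity
      linarith
    calc q * ‖(σ * D ω) • φ‖ ^ 3 ≤ q * (|σ| * |D ω|) ^ 3 := by gcongr
      _ = |σ| ^ 3 * (q * d) := by rw [hd]; ring
      _ ≤ _ := by gcongr
  have iB : Integrable (fun ω => |σ| ^ 3 *
      ((l⁻¹ * D ω ^ 6 + l * (C ^ 2 * (1 + ρ ω) ^ (2 * n))) / 2)) P :=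
    (((i6.const_mul _).add (((hρ (2 * n)).const_mul _).const_mul _)).div_const 2).const_mul _
  have bI := norm_integral_le_of_norm_le iB (ae_of_all P bR)
  have eB : ∫ ω, |σ| ^ 3 * ((l⁻¹ * D ω ^ 6 + l * (C ^ 2 * (1 + ρ ω) ^ (2 * n))) / 2) ∂P =
      |σ| ^ 3 * ((c + C ^ 2 * ∫ ω, (1 + ρ ω) ^ (2 * n) ∂P) / 2) * l := by
    rw [integral_const_mul, integral_div, integral_add (i6.const_mul _)
      (((hρ (2 * n)).const_mul _).const_mul _), integral_const_mul, integral_const_mul,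
      integral_const_mul, e6, ← hl2]
    field_simp
  rw [eB, eR, Real.norm_eq_abs] at bI
  have : (∫ ω, (H (Z ω + (σ * D ω) • φ) - H (Z ω)) ∂P) / ε - σ ^ 2 / 2 * ∫ ω, b (Z ω) ∂P =
    ((∫ ω, (H (Z ω + (σ * D ω) • φ) - H (Z ω)) ∂P) -
      σ ^ 2 / 2 * (ε * ∫ ω, b (Z ω) ∂P)) / ε := by field_simp
  rw [this, abs_div, abs_of_pos hε, div_le_iff₀ hε]
  refine bI.trans (le_of_eq ?_)
  rw [hl]; ring


lemma aux_g (T : ℝ) (hT : 0 < T) (H : C(Set.Icc (-T) (0 : ℝ), ℝ) → ℝ)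
    (Dd Dd' : C(Set.Icc (-T) (0 : ℝ), ℝ) → ℝ → ℝ)
    (hDd_repr : ∀ (η h : C(Set.Icc (-T) (0 : ℝ), ℝ)),
      fderiv ℝ H η h =
        ∫ x in Set.Icc (-T) (0 : ℝ),
          Dd η x * h (Set.projIcc (-T) 0 (neg_nonpos.mpr hT.le) x))
    (hDd_L2 : ∀ η, IntegrableOn (fun x => (Dd η x) ^ 2) (Set.Icc (-T) 0))
    (hDd'_L2 : ∀ η, IntegrableOn (fun x => (Dd' η x) ^ 2) (Set.Icc (-T) 0))
    (hDd_ac : ∀ η, ∀ x ∈ Set.Icc (-T) (0 : ℝ),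
      Dd η x = Dd η (-T) + ∫ y in (-T)..x, Dd' η y)
    (hH1_growth : ∃ C > (0 : ℝ), ∃ p : ℝ, 1 ≤ p ∧
      ∀ η : C(Set.Icc (-T) (0 : ℝ), ℝ),
        Real.sqrt ((∫ x in Set.Icc (-T) (0 : ℝ), (Dd η x) ^ 2) +
            ∫ x in Set.Icc (-T) (0 : ℝ), (Dd' η x) ^ 2) ≤ C * (1 + ‖η‖ ^ p))
    (hH1_cont : ∀ η₀ : C(Set.Icc (-T) (0 : ℝ), ℝ), ∀ ε > (0 : ℝ), ∃ δ > (0 : ℝ),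
      ∀ η : C(Set.Icc (-T) (0 : ℝ), ℝ), ‖η - η₀‖ < δ →
        (∫ x in Set.Icc (-T) (0 : ℝ), (Dd η x - Dd η₀ x) ^ 2) +
          (∫ x in Set.Icc (-T) (0 : ℝ), (Dd' η x - Dd' η₀ x) ^ 2) < ε ^ 2)
    (g : C(Set.Icc (-T) (0 : ℝ), ℝ) → ℝ → ℝ)
    (hgdef : g = fun ζ => (Icc (-T) (0:ℝ)).indicator (Dd ζ)) :
    ∃ (C : ℝ) (n : ℕ), 0 ≤ C ∧ (∀ ζ, Integrable (g ζ)) ∧ (∀ ζ x, x ∉ Icc (-T) 0 → g ζ x = 0) ∧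
      (∀ ζ x, |g ζ x| ≤ C * (1 + ‖ζ‖) ^ n) ∧
      (∀ ζ, ∀ ε > 0, ∫ x, |g ζ (x + ε) - g ζ x| ≤ C * (1 + ‖ζ‖) ^ n * ε) ∧
      (∀ ζ h, fderiv ℝ H ζ h = ∫ x, g ζ x * auxExt T hT h x) ∧
      (∀ ζ₀, Tendsto (fun ζ => ∫ x, |g ζ x - g ζ₀ x|) (𝓝 ζ₀) (𝓝 0)) := by
  obtain ⟨C, hC, p, hp, hgr⟩ := hH1_growth
  set m := ⌈p⌉₊ with hm
  have hmI : MeasurableSet (Icc (-T) (0:ℝ)) := measurableSet_Icc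
  have hQ : ∀ ζ, (∫ x in Set.Icc (-T) (0 : ℝ), (Dd ζ x) ^ 2) +
            ∫ x in Set.Icc (-T) (0 : ℝ), (Dd' ζ x) ^ 2 ≤ (2 * C * (1 + ‖ζ‖) ^ m) ^ 2 := by
    intro ζ
    refine (Real.sqrt_le_left (by positivity)).mp ?_
    exact (hgr ζ).trans (aux_rpow_le C p ‖ζ‖ hC (norm_nonneg _) hp)
  have hbv := fun ζ => aux_bv T hT (Dd ζ) (Dd' ζ) (hDd_L2 ζ) (hDd'_L2 ζ) (hDd_ac ζ) _ (hQ ζ)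
  simp only at hbv
  set K : ℝ := (6 + 2 / T) * (T + (2 * C) ^ 2) with hK
  have hK0 : 0 ≤ K := by positivity
  have hKle : ∀ ζ : C(Set.Icc (-T) (0 : ℝ), ℝ), 6 * (T + (2 * C * (1 + ‖ζ‖) ^ m) ^ 2) +
      2 * ((T + (2 * C * (1 + ‖ζ‖) ^ m) ^ 2) / T) ≤ K * (1 + ‖ζ‖) ^ (2 * m) := by
    intro ζ
    have h1 : 1 ≤ (1 + ‖ζ‖) ^ (2 * m) := one_le_pow₀ (by linarith [norm_nonneg ζ])
    have h2 : (2 * C * (1 + ‖ζ‖) ^ m) ^ 2 = (2 * C) ^ 2 * (1 + ‖ζ‖) ^ (2 * m) := by ring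
    rw [h2]
    set q := (1 + ‖ζ‖) ^ (2 * m)
    have h3 : T + (2 * C) ^ 2 * q ≤ (T + (2 * C) ^ 2) * q := by nlinarith
    calc _ = (6 + 2 / T) * (T + (2 * C) ^ 2 * q) := by ring
      _ ≤ (6 + 2 / T) * ((T + (2 * C) ^ 2) * q) := by gcongr
      _ = _ := by rw [hK]; ring
  have hgm : ∀ ζ, Measurable (g ζ) := fun ζ => by rw [hgdef]; exact (hbv ζ).1
  have hgb : ∀ ζ x, |g ζ x| ≤ K * (1 + ‖ζ‖) ^ (2 * m) := fun ζ x => by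
    rw [hgdef]; exact ((hbv ζ).2.1 x).trans (hKle ζ)
  have hgs : ∀ ζ x, x ∉ Icc (-T) 0 → g ζ x = 0 := fun ζ x hx => by
    rw [hgdef]; exact indicator_of_notMem hx _
  have hIntg : ∀ (f : ℝ → ℝ) (k : ℝ), Measurable f → (∀ x, |f x| ≤ k) →
      (∀ x, x ∉ Icc (-T) 0 → f x = 0) → Integrable f := by
    intro f k hf hk hs
    have h1 : Integrable ((Icc (-T) (0:ℝ)).indicator fun _ => k) :=
      (integrable_indicator_iff hmI).mpr (integrableOn_const (by simp))
    refine h1.mono' hf.aestronglyMeasurable (ae_of_all _ fun x => ?_)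
    by_cases hx : x ∈ Icc (-T) 0
    · rw [indicator_of_mem hx]; exact hk x
    · rw [indicator_of_notMem hx, hs x hx, norm_zero]
  refine ⟨K, 2 * m, hK0, fun ζ => hIntg _ _ (hgm ζ) (hgb ζ) (hgs ζ), hgs, hgb, fun ζ ε hε => ?_,
    fun ζ h => ?_, fun ζ₀ => ?_⟩
  · have := (hbv ζ).2.2 ε hε
    rw [hgdef]
    refine this.trans ?_
    have := hKle ζ
    gcongr
  · rw [hDd_repr, ← integral_indicator hmI]
    congr 1
    ext x
    rw [hgdef]
    by_cases hx : x ∈ Icc (-T) 0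
    · simp only [indicator_of_mem hx]; rfl
    · simp only [indicator_of_notMem hx, zero_mul]
  · rw [Metric.tendsto_nhds]
    intro ε hε
    set d := ε / (2 * T) with hd
    have hd0 : 0 < d := by positivity
    obtain ⟨δ, hδ, hδ2⟩ := hH1_cont ζ₀ (√(d * ε / 2)) (Real.sqrt_pos.mpr (by positivity))
    rw [Real.sq_sqrt (by positivity)] at hδ2
    filter_upwards [Metric.ball_mem_nhds ζ₀ hδ] with ζ hζ
    have h1 := hδ2 ζ (by rwa [mem_ball_iff_norm] at hζ)
    have h2 : 0 ≤ ∫ x in Set.Icc (-T) (0 : ℝ), (Dd' ζ x - Dd' ζ₀ x) ^ 2 :=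
      integral_nonneg fun x => sq_nonneg _
    set k := K * (1 + ‖ζ‖) ^ (2 * m) + K * (1 + ‖ζ₀‖) ^ (2 * m) with hk
    have hdm : Measurable fun x => g ζ x - g ζ₀ x := (hgm ζ).sub (hgm ζ₀)
    have hdb : ∀ x, |g ζ x - g ζ₀ x| ≤ k := fun x =>
      (abs_sub _ _).trans (add_le_add (hgb ζ x) (hgb ζ₀ x))
    have hds : ∀ x, x ∉ Icc (-T) 0 → g ζ x - g ζ₀ x = 0 := fun x hx => by
      rw [hgs ζ x hx, hgs ζ₀ x hx, sub_zero]
    have i1 := hIntg _ k hdm hdb hds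
    have i2 : Integrable (fun x => (g ζ x - g ζ₀ x) ^ 2) := by
      refine hIntg _ (k ^ 2) (hdm.pow_const 2) (fun x => ?_) (fun x hx => by simp [hds x hx])
      rw [abs_pow]
      have := hdb x
      gcongr
    have e2 : ∫ x, (g ζ x - g ζ₀ x) ^ 2 = ∫ x in Set.Icc (-T) (0 : ℝ), (Dd ζ x - Dd ζ₀ x) ^ 2 := by
      rw [← integral_indicator hmI]
      congr 1
      ext x
      rw [hgdef]
      by_cases hx : x ∈ Icc (-T) 0
      · simp only [indicator_of_mem hx]
      · simp only [indicator_of_notMem hx, sub_zero]; norm_num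
    have i0 : Integrable ((Icc (-T) (0:ℝ)).indicator fun _ => d) :=
      (integrable_indicator_iff hmI).mpr (integrableOn_const (by simp))
    have hle : ∫ x, |g ζ x - g ζ₀ x| ≤
        ∫ x, ((Icc (-T) (0:ℝ)).indicator (fun _ => d) x + d⁻¹ * (g ζ x - g ζ₀ x) ^ 2) := by
      refine integral_mono i1.abs (i0.add (i2.const_mul _)) fun x => ?_
      by_cases hx : x ∈ Icc (-T) 0
      · simp only [indicator_of_mem hx]
        set a := g ζ x - g ζ₀ x
        have ha : |a| ^ 2 = a ^ 2 := sq_abs a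
        rw [← ha]
        have : d + d⁻¹ * |a| ^ 2 - |a| = d⁻¹ * ((d - |a| / 2) ^ 2 + 3 / 4 * |a| ^ 2) := by
          field_simp; ring
        have : 0 ≤ d⁻¹ * ((d - |a| / 2) ^ 2 + 3 / 4 * |a| ^ 2) := by positivity
        linarith
      · simp [hds x hx, indicator_of_notMem hx]
    rw [integral_add i0 (i2.const_mul _), integral_const_mul, integral_indicator hmI,
      setIntegral_const, e2, smul_eq_mul, Real.volume_real_Icc_of_le (by linarith)] at hle
    rw [Real.dist_eq, sub_zero, abs_of_nonneg (integral_nonneg fun x => abs_nonneg _)]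
    refine hle.trans_lt ?_
    have h3 : d⁻¹ * ∫ x in Set.Icc (-T) (0 : ℝ), (Dd ζ x - Dd ζ₀ x) ^ 2 < d⁻¹ * (d * ε / 2) := by
      gcongr; linarith
    have h4 : d⁻¹ * (d * ε / 2) = ε / 2 := by field_simp
    have h5 : (0 - -T) * d = ε / 2 := by rw [hd]; field_simp; ring
    linarith

lemma aux_fwd (T : ℝ) (hT : 0 < T) (η : C(Set.Icc (-T) (0 : ℝ), ℝ)) (D : ℝ → ℝ) (t : ℝ)
    (ht : t ∈ Ico 0 T) (ε : ℝ) (hε : 0 < ε) :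
    (∫ x in Set.Ioc (-t) 0,
              D (x - T + t) *
                (((fun y : ℝ =>
                    if 0 < y then η (Set.projIcc (-T) 0 (neg_nonpos.mpr hT.le) 0)
                    else if y < -t then η (Set.projIcc (-T) 0 (neg_nonpos.mpr hT.le) (-t))
                    else η (Set.projIcc (-T) 0 (neg_nonpos.mpr hT.le) y)) (x + ε) -
                  (fun y : ℝ =>
                    if 0 < y then η (Set.projIcc (-T) 0 (neg_nonpos.mpr hT.le) 0)
                    else if y < -t then η (Set.projIcc (-T) 0 (neg_nonpos.mpr hT.le) (-t))
                    else η (Set.projIcc (-T) 0 (neg_nonpos.mpr hT.le) y)) x) / ε)) =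
    (∫ x, (Icc (-T) (0:ℝ)).indicator D x *
        (auxExt T hT η (x + T - (t - ε)) - auxExt T hT η (x + T - t))) / ε := by
  have hif : ∀ y, -t ≤ y → (if 0 < y then η (Set.projIcc (-T) 0 (neg_nonpos.mpr hT.le) 0)
      else if y < -t then η (Set.projIcc (-T) 0 (neg_nonpos.mpr hT.le) (-t))
      else η (Set.projIcc (-T) 0 (neg_nonpos.mpr hT.le) y)) = auxExt T hT η y := by
    intro y hy
    split_ifs with h1 h2
    · exact (auxExt_zero_le T hT η y h1.le).symm
    · linarith
    · rfl
  have e1 : ∫ x, (Icc (-T) (0:ℝ)).indicator D x *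
        (auxExt T hT η (x + T - (t - ε)) - auxExt T hT η (x + T - t)) =
      ∫ x, (Icc (-T) (0:ℝ)).indicator D (x + (t - T)) *
        (auxExt T hT η (x + (t - T) + T - (t - ε)) - auxExt T hT η (x + (t - T) + T - t)) :=
    (integral_add_right_eq_self (fun x => (Icc (-T) (0:ℝ)).indicator D x *
        (auxExt T hT η (x + T - (t - ε)) - auxExt T hT η (x + T - t))) (t - T)).symm
  rw [e1, ← integral_div, ← integral_indicator measurableSet_Ioc]
  refine integral_congr_ae ?_
  have hne : ∀ᵐ x : ℝ, x ≠ -t := by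
    simp [ae_iff]
  filter_upwards [hne] with x hx
  have a1 : x + (t - T) + T - (t - ε) = x + ε := by ring
  have a2 : x + (t - T) + T - t = x := by ring
  have a3 : x + (t - T) = x - T + t := by ring
  rw [a1, a2, a3]
  by_cases h : x ∈ Ioc (-t) 0
  · rw [indicator_of_mem h, hif _ h.1.le, hif _ (by linarith [h.1]), indicator_of_mem, mul_div_assoc]
    exact ⟨by linarith [h.1], by linarith [h.2, ht.2]⟩
  · rw [indicator_of_notMem h]
    by_cases h0 : 0 < x
    · rw [auxExt_zero_le T hT η x h0.le, auxExt_zero_le T hT η (x + ε) (by linarith)]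
      simp
    · have : x < -t := by
        by_contra h1
        exact h ⟨lt_of_le_of_ne (not_lt.mp h1) (Ne.symm hx), not_lt.mp h0⟩
      rw [indicator_of_notMem]
      · simp
      · intro h2; linarith [h2.1]


lemma aux_incr {Ω : Type*} [MeasurableSpace Ω] (P : Measure Ω) [IsProbabilityMeasure P]
    (D : Ω → ℝ) (hD : Measurable D) (ε : ℝ) (hε : 0 ≤ ε)
    (h : Measure.map D P = gaussianReal 0 ε.toNNReal) (c : ℝ)
    (hc : ∀ d ≥ 0, ∫ x, x ^ (2 * 3) ∂(gaussianReal 0 d.toNNReal) = c * d ^ 3) :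
    ∫ ω, D ω ∂P = 0 ∧ ∫ ω, D ω ^ 2 ∂P = ε ∧ ∫ ω, D ω ^ 6 ∂P = c * ε ^ 3 := by
  have key : ∀ n : ℕ, ∫ ω, D ω ^ n ∂P = ∫ x, x ^ n ∂(gaussianReal 0 ε.toNNReal) := fun n => by
    rw [← h, integral_map hD.aemeasurable (by fun_prop)]
  refine ⟨?_, ?_, ?_⟩
  · have := key 1
    simp only [pow_one] at this
    rw [this, integral_id_gaussianReal]
  · rw [key 2]
    have := variance_eq_integral (μ := gaussianReal 0 ε.toNNReal) (X := fun x => x)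
      measurable_id.aemeasurable
    rw [variance_fun_id_gaussianReal, integral_id_gaussianReal] at this
    simp only [sub_zero] at this
    rw [← this, Real.coe_toNNReal _ hε]
  · rw [key 6]; exact hc ε hε

/-- Measurability of the path and of the auxiliary path. -/
lemma aux_meas (T : ℝ) (hT : 0 < T) (σ : ℝ) {Ω : Type*} [MeasurableSpace Ω]
    [MeasurableSpace C(Set.Icc (-T) (0 : ℝ), ℝ)] [BorelSpace C(Set.Icc (-T) (0 : ℝ), ℝ)]
    (w : Ω → C(ℝ, ℝ)) (hw : ∀ s, Measurable fun ω => w ω s)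
    (η : C(Set.Icc (-T) (0 : ℝ), ℝ)) (r s : ℝ) :
    Measurable (fun ω => auxPath T hT σ (w ω) η r) ∧
      Measurable (fun ω => auxV T hT σ (w ω) η r s) := by
  have h1 : ∀ r (x : Set.Icc (-T) (0 : ℝ)), Measurable fun ω => auxPath T hT σ (w ω) η r x := by
    intro r x
    simp only [auxPath_apply]
    exact (((hw _).sub (hw _)).const_mul σ).const_add _
  refine ⟨aux_measurable_of_eval _ (h1 r), aux_measurable_of_eval _ fun x => ?_⟩
  simp only [auxV, ContinuousMap.add_apply, ContinuousMap.smul_apply, smul_eq_mul]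
  exact (h1 s x).add ((((hw _).sub (hw _)).const_mul σ).mul_const _)

lemma aux_Y_eq (T : ℝ) (hT : 0 < T) (σ : ℝ) (w : C(ℝ, ℝ)) (t : ℝ)
    (η y : C(Set.Icc (-T) (0 : ℝ), ℝ))
    (hy : ∀ x : Set.Icc (-T) (0 : ℝ), y x =
          if (x : ℝ) ≤ t - T then
            η (Set.projIcc (-T) 0 (neg_nonpos.mpr hT.le) ((x : ℝ) + T - t))
          else
            η (Set.projIcc (-T) 0 (neg_nonpos.mpr hT.le) 0) + σ * (w (T + x) - w t)) :
    y = auxPath T hT σ w η t := by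
  ext x
  rw [hy, auxPath_apply]
  split_ifs with h
  · rw [max_eq_right (by linarith)]
    simp [auxExt]
  · rw [max_eq_left (by linarith), auxExt_zero_le T hT η _ (by linarith)]
    rfl

set_option maxSynthPendingDepth 3 in
lemma aux_c3_cont {E : Type*} [NormedAddCommGroup E] [NormedSpace ℝ E] (H : E → ℝ)
    (hH : ContDiff ℝ 3 H) : Continuous (fderiv ℝ (fderiv ℝ H)) := by
  have hc2 : ContDiff ℝ 2 (fderiv ℝ H) := hH.fderiv_right (by norm_num)
  have hc3 : ContDiff ℝ 1 (fderiv ℝ (fderiv ℝ H)) := hc2.fderiv_right (by norm_num)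
  exact hc3.continuous

set_option maxSynthPendingDepth 3 in
lemma aux_b_cont {E : Type*} [NormedAddCommGroup E] [NormedSpace ℝ E] (H : E → ℝ)
    (hH : ContDiff ℝ 3 H) (φ : E) : Continuous fun z => fderiv ℝ (fderiv ℝ H) z φ φ :=
  ((aux_c3_cont H hH).clm_apply continuous_const).clm_apply continuous_const


/-- Under hypotheses (i)–(iv) on `H ∈ C³(C([-T,0];ℝ))` (absolutely
continuous first derivative with `H¹` density `Dd`, polynomial growth and continuity in `H¹`,
second derivative represented by finite signed Borel measures `m2p ζ − m2m ζ` on `[-T,0]²`),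
the function `u(t,η) = E[H(Y_T^{t,η})]` has a time derivative at every `t ∈ [0,T[` given by
`∂_t u(t,η) = − E[ ∫_{]-t,0]} D_{x−T+t}H(Y_T^{t,η}) d⁻η(x) ]
  − (σ²/2) E[ m_{Y_T^{t,η}}( ]t−T,0] × ]t−T,0] ) ]`,
the first term being the expectation of a pathwise deterministic forward integral. -/
theorem time_derivative_of_u
    (T : ℝ) (hT : 0 < T) (σ : ℝ)
    {Ω : Type*} [MeasurableSpace Ω] (P : Measure Ω) [IsProbabilityMeasure P]
    -- the Brownian motion `W`
    (W : ℝ → Ω → ℝ)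
    (hW_meas : ∀ s, Measurable (W s))
    (hW_cont : ∀ ω, Continuous fun s => W s ω)
    (hW_zero : ∀ ω, W 0 ω = 0)
    (hW_incr : ∀ s t : ℝ, 0 ≤ s → s ≤ t →
      Measure.map (fun ω => W t ω - W s ω) P = gaussianReal 0 (Real.toNNReal (t - s)))
    (hW_indep : ∀ s t : ℝ, 0 ≤ s → s ≤ t →
      Indep (MeasurableSpace.comap (fun ω => W t ω - W s ω) inferInstance)
        (⨆ r ∈ Set.Icc (0 : ℝ) s, MeasurableSpace.comap (W r) inferInstance) P)
    -- the functional Brownian flow `Y ω t η = Y_T^{t,η}(ω)`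
    (Y : Ω → ℝ → C(Set.Icc (-T) (0 : ℝ), ℝ) → C(Set.Icc (-T) (0 : ℝ), ℝ))
    (hY : ∀ (ω : Ω) (t : ℝ), 0 ≤ t → t ≤ T →
      ∀ (η : C(Set.Icc (-T) (0 : ℝ), ℝ)) (x : Set.Icc (-T) (0 : ℝ)),
        Y ω t η x =
          if (x : ℝ) ≤ t - T then
            η (Set.projIcc (-T) 0 (neg_nonpos.mpr hT.le) ((x : ℝ) + T - t))
          else
            η (Set.projIcc (-T) 0 (neg_nonpos.mpr hT.le) 0) + σ * (W (T + x) ω - W t ω))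
    -- `H ∈ C³` with `D³H` of polynomial growth
    (H : C(Set.Icc (-T) (0 : ℝ), ℝ) → ℝ)
    (hH : ContDiff ℝ 3 H)
    (hH3_growth : ∃ C > (0 : ℝ), ∃ p : ℝ, 1 ≤ p ∧
      ∀ ζ : C(Set.Icc (-T) (0 : ℝ), ℝ), ‖iteratedFDeriv ℝ 3 H ζ‖ ≤ C * (1 + ‖ζ‖ ^ p))
    -- (i): `DH(η)` is absolutely continuous with density `Dd η` of class `H¹([-T,0])`,
    -- with weak derivative `Dd' η`
    (Dd Dd' : C(Set.Icc (-T) (0 : ℝ), ℝ) → ℝ → ℝ)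
    (hDd_repr : ∀ (η h : C(Set.Icc (-T) (0 : ℝ), ℝ)),
      fderiv ℝ H η h =
        ∫ x in Set.Icc (-T) (0 : ℝ),
          Dd η x * h (Set.projIcc (-T) 0 (neg_nonpos.mpr hT.le) x))
    (hDd_L2 : ∀ η, IntegrableOn (fun x => (Dd η x) ^ 2) (Set.Icc (-T) 0))
    (hDd'_L2 : ∀ η, IntegrableOn (fun x => (Dd' η x) ^ 2) (Set.Icc (-T) 0))
    (hDd_ac : ∀ η, ∀ x ∈ Set.Icc (-T) (0 : ℝ),
      Dd η x = Dd η (-T) + ∫ y in (-T)..x, Dd' η y)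
    -- (ii): polynomial growth of `‖DH(η)‖_{H¹}`
    (hH1_growth : ∃ C > (0 : ℝ), ∃ p : ℝ, 1 ≤ p ∧
      ∀ η : C(Set.Icc (-T) (0 : ℝ), ℝ),
        Real.sqrt ((∫ x in Set.Icc (-T) (0 : ℝ), (Dd η x) ^ 2) +
            ∫ x in Set.Icc (-T) (0 : ℝ), (Dd' η x) ^ 2) ≤ C * (1 + ‖η‖ ^ p))
    -- (iii): continuity of `η ↦ DH(η)` from `C([-T,0];ℝ)` to `H¹([-T,0])`
    (hH1_cont : ∀ η₀ : C(Set.Icc (-T) (0 : ℝ), ℝ), ∀ ε > (0 : ℝ), ∃ δ > (0 : ℝ),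
      ∀ η : C(Set.Icc (-T) (0 : ℝ), ℝ), ‖η - η₀‖ < δ →
        (∫ x in Set.Icc (-T) (0 : ℝ), (Dd η x - Dd η₀ x) ^ 2) +
          (∫ x in Set.Icc (-T) (0 : ℝ), (Dd' η x - Dd' η₀ x) ^ 2) < ε ^ 2)
    -- (iv): `D²H(ζ)` is represented by the finite signed measure `m2p ζ − m2m ζ` on `[-T,0]²`
    (m2p m2m : C(Set.Icc (-T) (0 : ℝ), ℝ) → Measure (ℝ × ℝ))
    (hm2p_fin : ∀ ζ, IsFiniteMeasure (m2p ζ))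
    (hm2m_fin : ∀ ζ, IsFiniteMeasure (m2m ζ))
    (hm2p_supp : ∀ ζ, m2p ζ ((Set.Icc (-T) 0 ×ˢ Set.Icc (-T) 0)ᶜ) = 0)
    (hm2m_supp : ∀ ζ, m2m ζ ((Set.Icc (-T) 0 ×ˢ Set.Icc (-T) 0)ᶜ) = 0)
    (hD2H_repr : ∀ ζ g h : C(Set.Icc (-T) (0 : ℝ), ℝ),
      fderiv ℝ (fderiv ℝ H) ζ g h =
        (∫ q : ℝ × ℝ,
          g (Set.projIcc (-T) 0 (neg_nonpos.mpr hT.le) q.1) *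
            h (Set.projIcc (-T) 0 (neg_nonpos.mpr hT.le) q.2) ∂(m2p ζ)) -
        ∫ q : ℝ × ℝ,
          g (Set.projIcc (-T) 0 (neg_nonpos.mpr hT.le) q.1) *
            h (Set.projIcc (-T) 0 (neg_nonpos.mpr hT.le) q.2) ∂(m2m ζ))
    -- `u(t,η) = E[H(Y_T^{t,η})]`
    (u : ℝ → C(Set.Icc (-T) (0 : ℝ), ℝ) → ℝ)
    (hu : ∀ t η, u t η = ∫ ω, H (Y ω t η) ∂P) :
    ∀ t ∈ Set.Ico (0 : ℝ) T, ∀ η : C(Set.Icc (-T) (0 : ℝ), ℝ),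
      ∃ J : Ω → ℝ,
        -- pathwise, `J ω` is the deterministic forward integral
        -- `∫_{]-t,0]} D_{x−T+t}H(Y_T^{t,η}(ω)) d⁻η(x)`
        (∀ ω : Ω,
          Tendsto
            (fun ε : ℝ => ∫ x in Set.Ioc (-t) 0,
              Dd (Y ω t η) (x - T + t) *
                (((fun y : ℝ =>
                    if 0 < y then η (Set.projIcc (-T) 0 (neg_nonpos.mpr hT.le) 0)
                    else if y < -t then η (Set.projIcc (-T) 0 (neg_nonpos.mpr hT.le) (-t))
                    else η (Set.projIcc (-T) 0 (neg_nonpos.mpr hT.le) y)) (x + ε) -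
                  (fun y : ℝ =>
                    if 0 < y then η (Set.projIcc (-T) 0 (neg_nonpos.mpr hT.le) 0)
                    else if y < -t then η (Set.projIcc (-T) 0 (neg_nonpos.mpr hT.le) (-t))
                    else η (Set.projIcc (-T) 0 (neg_nonpos.mpr hT.le) y)) x) / ε))
            (𝓝[>] 0) (𝓝 (J ω))) ∧
        -- `∂_t u(t,η)` exists and is given by the stated formula
        HasDerivWithinAt (fun s => u s η)
          (-(∫ ω, J ω ∂P) -
            σ ^ 2 / 2 *
              ∫ ω, ((m2p (Y ω t η) (Set.Ioc (t - T) 0 ×ˢ Set.Ioc (t - T) 0)).toReal -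
                (m2m (Y ω t η) (Set.Ioc (t - T) 0 ×ˢ Set.Ioc (t - T) 0)).toReal) ∂P)
          (Set.Ico 0 T) t := by
  intro t ht η
  have htI : t ∈ Icc 0 T := ⟨ht.1, ht.2.le⟩
  letI mC : MeasurableSpace C(Set.Icc (-T) (0 : ℝ), ℝ) := borel _
  haveI bC : BorelSpace C(Set.Icc (-T) (0 : ℝ), ℝ) := ⟨rfl⟩
  set w : Ω → C(ℝ, ℝ) := fun ω => ⟨fun s => W s ω, hW_cont ω⟩ with hw
  have hwW : ∀ ω s, w ω s = W s ω := fun ω s => rfl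
  have hwm : ∀ s, Measurable fun ω => w ω s := hW_meas
  have hYX : ∀ ω, ∀ r ∈ Icc 0 T, Y ω r η = auxPath T hT σ (w ω) η r := fun ω r hr =>
    aux_Y_eq T hT σ (w ω) r η _ (hY ω r hr.1 hr.2 η)
  -- the supremum of the Brownian path
  set Wp : Ω → C(Set.Icc (-T) (0 : ℝ), ℝ) := fun ω =>
    ⟨fun x => W (T + x) ω, (hW_cont ω).comp (by fun_prop)⟩ with hWp
  have hmom := aux_moments_s18 T hT P W hW_meas hW_cont hW_zero hW_incr Wp (fun _ _ => rfl)
  set S : Ω → ℝ := fun ω => ‖Wp ω‖ with hSdef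
  have hS0 : ∀ ω, 0 ≤ S ω := fun ω => norm_nonneg _
  have hS : ∀ ω, ∀ q ∈ Icc 0 T, |w ω q| ≤ S ω := by
    intro ω q hq
    have := (Wp ω).norm_coe_le_norm ⟨q - T, by linarith [hq.1], by linarith [hq.2]⟩
    have e : Wp ω ⟨q - T, by linarith [hq.1], by linarith [hq.2]⟩ = w ω q := by
      simp [hWp, hw]
    rwa [e] at this
  have hSm : Measurable S :=
    continuous_norm.measurable.comp (aux_measurable_of_eval Wp fun x => hW_meas _)
  set K := ‖η‖ + 4 * |σ| + 2 with hK
  have hK0 : 0 ≤ K := by positivity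
  set ρ : Ω → ℝ := fun ω => K * (1 + S ω) with hρdef
  have hρ0 : ∀ ω, 0 ≤ ρ ω := fun ω => by have := hS0 ω; positivity
  have hρ : ∀ n : ℕ, Integrable (fun ω => (1 + ρ ω) ^ n) P := by
    intro n
    refine ((hmom n).const_mul ((1 + K) ^ n)).mono'
      (((hSm.const_add 1).const_mul K).const_add 1 |>.pow_const n).aestronglyMeasurable
      (ae_of_all _ fun ω => ?_)
    have h1 := hS0 ω
    have h2 := hρ0 ω
    rw [Real.norm_eq_abs, abs_of_nonneg (by positivity), ← mul_pow]
    refine pow_le_pow_left₀ (by positivity) ?_ n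
    change 1 + K * (1 + S ω) ≤ (1 + K) * (1 + S ω)
    linarith
  have hρ4 : ∀ ω, ‖η‖ + 4 * |σ| * S ω ≤ ρ ω := by
    intro ω
    have h1 := hS0 ω
    change ‖η‖ + 4 * |σ| * S ω ≤ K * (1 + S ω)
    have h2 : 0 ≤ ‖η‖ * S ω := by positivity
    have h3 := abs_nonneg σ
    rw [hK]; linarith
  have hρX : ∀ ω, ∀ r ∈ Icc 0 T, ‖auxPath T hT σ (w ω) η r‖ ≤ ρ ω := by
    intro ω r hr
    have h1 := auxPath_norm T hT σ (w ω) η r hr (S ω) (hS ω)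
    have h2 := hρ4 ω
    have h3 : 0 ≤ |σ| * S ω := mul_nonneg (abs_nonneg _) (hS0 ω)
    linarith
  have hρV : ∀ ω, ∀ r ∈ Icc 0 T, ∀ s ∈ Icc 0 T, ‖auxV T hT σ (w ω) η r s‖ ≤ ρ ω := by
    intro ω r hr s hs
    exact (auxV_norm T hT σ (w ω) η r s hr hs (S ω) (hS ω)).trans (hρ4 ω)
  have hρD : ∀ ω, ∀ r ∈ Icc 0 T, ∀ s ∈ Icc 0 T, |W s ω - W r ω| ≤ ρ ω := by
    intro ω r hr s hs
    have h1 := abs_sub (W s ω) (W r ω)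
    have h2 := hS ω r hr
    have h3 := hS ω s hs
    rw [hwW] at h2 h3
    have h4 : 2 * S ω ≤ ρ ω := by
      change 2 * S ω ≤ K * (1 + S ω)
      have h5 := hS0 ω
      have : 2 * (1 + S ω) ≤ K * (1 + S ω) := by
        gcongr
        have := norm_nonneg η
        have := abs_nonneg σ
        rw [hK]; linarith
      linarith
    linarith
  -- growth of the derivatives
  obtain ⟨C, n, hC, h0, h1, h2, h3⟩ := aux_growths H hH hH3_growth
  have hHd : Differentiable ℝ H := hH.differentiable (by norm_num)
  have hHm : Measurable H := hHd.continuous.measurable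
  have hc3 := aux_c3_cont H hH
  have mono : ∀ ω (x : ℝ), x ≤ ρ ω → 0 ≤ x → C * (1 + x) ^ n ≤ C * (1 + ρ ω) ^ n := by
    intro ω x hx hx0
    gcongr
  -- the density
  set g : C(Set.Icc (-T) (0 : ℝ), ℝ) → ℝ → ℝ :=
    fun ζ => (Icc (-T) (0:ℝ)).indicator (Dd ζ) with hg
  obtain ⟨Cg, ng, hCg, hg_int, hg_supp, hg_bd, hg_shift, hg_repr, hg_L1⟩ :=
    aux_g T hT H Dd Dd' hDd_repr hDd_L2 hDd'_L2 hDd_ac hH1_growth hH1_cont g hg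
  have hlim := fun ω => auxPart1_lim T hT σ (w ω) η H hHd g Cg hCg ng hg_int hg_supp hg_bd
    hg_shift hg_repr hg_L1 t htI
  choose J hJ1 hJ2 using hlim
  refine ⟨J, fun ω => ?_, ?_⟩
  · refine (hJ1 ω).congr' ?_
    filter_upwards [self_mem_nhdsWithin] with ε hε
    rw [hYX ω t htI]
    exact (aux_fwd T hT η _ t ht ε hε).symm
  rw [hasDerivWithinAt_iff_tendsto_slope]
  set l := 𝓝[Ico 0 T \ {t}] t with hl
  set r : ℝ → ℝ := fun i => min t i with hr
  set s : ℝ → ℝ := fun i => max t i with hs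
  have hrt : Tendsto r l (𝓝 t) := by
    have : Continuous r := by fun_prop
    have h := this.tendsto t
    simp only [hr, min_self] at h
    exact h.mono_left nhdsWithin_le_nhds
  have hst : Tendsto s l (𝓝 t) := by
    have : Continuous s := by fun_prop
    have h := this.tendsto t
    simp only [hs, max_self] at h
    exact h.mono_left nhdsWithin_le_nhds
  have hev : ∀ᶠ i in l, r i ∈ Icc 0 T ∧ s i ∈ Icc 0 T ∧ r i < s i ∧ i ∈ Icc 0 T := by
    filter_upwards [self_mem_nhdsWithin] with i hi
    have hi2 : i ≠ t := hi.2
    refine ⟨⟨le_min ht.1 hi.1.1, (min_le_left _ _).trans ht.2.le⟩,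
      ⟨ht.1.trans (le_max_left _ _), max_le ht.2.le hi.1.2.le⟩, ?_, hi.1.1, hi.1.2.le⟩
    exact min_lt_max.mpr (Ne.symm hi2)
  -- first part
  have hA : Tendsto (fun i => ∫ ω, (H (auxPath T hT σ (w ω) η (r i)) -
      H (auxV T hT σ (w ω) η (r i) (s i))) / (s i - r i) ∂P) l (𝓝 (∫ ω, J ω ∂P)) := by
    refine tendsto_integral_filter_of_dominated_convergence
      (fun ω => 3 * Cg * (1 + ρ ω) ^ (ng + 1)) ?_ ?_ ((hρ _).const_mul _) ?_
    · refine Eventually.of_forall fun i => ?_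
      have hm := aux_meas T hT σ w hwm η (r i) (s i)
      exact (((hHm.comp hm.1).sub (hHm.comp hm.2)).div_const _).aestronglyMeasurable
    · filter_upwards [hev] with i hi
      refine ae_of_all _ fun ω => ?_
      refine (auxPart1_bound T hT σ (w ω) η H hHd g Cg hCg ng hg_int hg_supp hg_bd
        hg_shift hg_repr (r i) (s i) (S ω) hi.1 hi.2.1 hi.2.2.1 (hS ω)).trans ?_
      have h1 := hρ4 ω
      have h2 := hS0 ω
      gcongr
    · refine ae_of_all _ fun ω => ?_
      exact hJ2 ω l r s hrt hst (hev.mono fun i hi => ⟨hi.1, hi.2.1, hi.2.2.1⟩)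
  -- second part: convergence of the second derivative
  have hD2 : Tendsto (fun i => ∫ ω, fderiv ℝ (fderiv ℝ H) (auxPath T hT σ (w ω) η (s i))
      (auxPhi T (r i) (s i)) (auxPhi T (r i) (s i)) ∂P) l
      (𝓝 (∫ ω, ((m2p (Y ω t η) (Set.Ioc (t - T) 0 ×ˢ Set.Ioc (t - T) 0)).toReal -
                (m2m (Y ω t η) (Set.Ioc (t - T) 0 ×ˢ Set.Ioc (t - T) 0)).toReal) ∂P)) := by
    refine tendsto_integral_filter_of_dominated_convergence
      (fun ω => C * (1 + ρ ω) ^ n) ?_ ?_ ((hρ _).const_mul _) ?_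
    · refine Eventually.of_forall fun i => ?_
      have hm := aux_meas T hT σ w hwm η (s i) (s i)
      have hb := aux_b_cont H hH (auxPhi T (r i) (s i))
      exact (hb.measurable.comp hm.1).aestronglyMeasurable
    · filter_upwards [hev] with i hi
      refine ae_of_all _ fun ω => ?_
      exact (h2 _ _ (auxPhi_norm _ _ _)).trans (mono ω _ (hρX ω _ hi.2.1) (norm_nonneg _))
    · refine ae_of_all _ fun ω => ?_
      have := hm2p_fin (Y ω t η)
      have := hm2m_fin (Y ω t η)
      refine aux_D2_lim T hT t l r s hrt hst
        (hev.mono fun i hi => ⟨hi.2.2.1, le_max_left _ _⟩) H hc3 _ (Y ω t η) ?_ _ _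
        (hm2p_supp _) (hm2m_supp _) (fun a b => hD2H_repr _ a b)
      rw [hYX ω t htI]
      exact ((auxPath T hT σ (w ω) η).continuous.tendsto t).comp hst
  obtain ⟨c6, hc6, hc6e⟩ := aux_gauss_s18 3
  have hB : Tendsto (fun i => (∫ ω, (H (auxV T hT σ (w ω) η (r i) (s i)) -
      H (auxPath T hT σ (w ω) η (s i))) ∂P) / (s i - r i)) l
      (𝓝 (σ ^ 2 / 2 * ∫ ω, ((m2p (Y ω t η) (Set.Ioc (t - T) 0 ×ˢ Set.Ioc (t - T) 0)).toReal -
                (m2m (Y ω t η) (Set.Ioc (t - T) 0 ×ˢ Set.Ioc (t - T) 0)).toReal) ∂P)) := by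
    set Q := |σ| ^ 3 * ((c6 + C ^ 2 * ∫ ω, (1 + ρ ω) ^ (2 * n) ∂P) / 2) with hQ
    have hz : Tendsto (fun i => Q * √(s i - r i)) l (𝓝 0) := by
      have h := (hst.sub hrt).sqrt.const_mul Q
      simpa using h
    have hdiff : Tendsto (fun i => (∫ ω, (H (auxV T hT σ (w ω) η (r i) (s i)) -
      H (auxPath T hT σ (w ω) η (s i))) ∂P) / (s i - r i) -
      σ ^ 2 / 2 * ∫ ω, fderiv ℝ (fderiv ℝ H) (auxPath T hT σ (w ω) η (s i))
      (auxPhi T (r i) (s i)) (auxPhi T (r i) (s i)) ∂P) l (𝓝 0) := by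
      refine squeeze_zero_norm' ?_ hz
      filter_upwards [hev] with i hi
      have hpos : 0 < s i - r i := by linarith [hi.2.2.1]
      have hDm : Measurable fun ω => W (s i) ω - W (r i) ω := (hW_meas _).sub (hW_meas _)
      obtain ⟨e1, e2, e6⟩ := aux_incr P (fun ω => W (s i) ω - W (r i) ω) hDm (s i - r i) hpos.le
        (hW_incr _ _ hi.1.1 hi.2.2.1.le) c6 hc6e
      have hm := aux_meas T hT σ w hwm η (s i) (s i)
      have hm2 := aux_meas T hT σ w hwm η (r i) (s i)
      have hind : IndepFun (fun ω => W (s i) ω - W (r i) ω)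
          (fun ω => auxPath T hT σ (w ω) η (s i)) P := by
        refine aux_indep_Y P W hW_meas hW_indep (r i) (s i) hi.1.1 hi.2.2.1.le _ fun x => ?_
        exact ⟨auxExt T hT η (x + T - s i), σ, max (T + x) (s i), le_max_right _ _, fun ω => rfl⟩
      exact aux_part2 H hH C n hC h0 h1 h2 h3 P ρ hρ0 hρ σ (auxPhi T (r i) (s i))
        (auxPhi_norm _ _ _) (fun ω => auxPath T hT σ (w ω) η (s i))
        (fun ω => W (s i) ω - W (r i) ω) hm.1 hDm hm2.2 hind
        (fun ω => hρX ω _ hi.2.1) (fun ω => hρD ω _ hi.1 _ hi.2.1)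
        (fun ω => hρV ω _ hi.1 _ hi.2.1) (s i - r i) c6 hpos e1 e2 e6
    have := hdiff.add (hD2.const_mul (σ ^ 2 / 2))
    rw [zero_add] at this
    exact this.congr fun i => by ring
  have hAB := (hA.neg).sub hB
  refine hAB.congr' ?_
  filter_upwards [hev] with i hi
  have hpos : 0 < s i - r i := by linarith [hi.2.2.1]
  have iX : ∀ q ∈ Icc 0 T, Integrable (fun ω => H (auxPath T hT σ (w ω) η q)) P := fun q hq =>
    aux_dom P ρ _ hρ (hHm.comp (aux_meas T hT σ w hwm η q q).1) C n
      fun ω => (h0 _).trans (mono ω _ (hρX ω q hq) (norm_nonneg _))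
  have iV : Integrable (fun ω => H (auxV T hT σ (w ω) η (r i) (s i))) P :=
    aux_dom P ρ _ hρ (hHm.comp (aux_meas T hT σ w hwm η (r i) (s i)).2) C n
      fun ω => (h0 _).trans (mono ω _ (hρV ω _ hi.1 _ hi.2.1) (norm_nonneg _))
  have hu' : ∀ q ∈ Icc 0 T, u q η = ∫ ω, H (auxPath T hT σ (w ω) η q) ∂P := by
    intro q hq
    rw [hu]
    congr 1
    ext ω
    rw [hYX ω q hq]
  have hslope : slope (fun s => u s η) t i = (u (s i) η - u (r i) η) / (s i - r i) := by
    rw [slope_def_field]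
    rcases le_total t i with h | h
    · simp only [hs, hr, max_eq_right h, min_eq_left h]
    · simp only [hs, hr, max_eq_left h, min_eq_right h]
      rw [← neg_div_neg_eq]; ring
  rw [hslope, hu' _ hi.1, hu' _ hi.2.1, integral_div, integral_sub (iX _ hi.1) iV,
    integral_sub iV (iX _ hi.2.1)]
  ring
end
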